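/- Uniform-in-ħ spectral error estimate for the Hermite–Galerkin approximation of the von Neumann equation (Theorem 2.1): let p ≥ 1 and let V : ℝ → ℝ be of class C^{2p+3} with ‖V⁽ⁿ⁾‖_∞ < ∞ for n = 2,…,2p+3. There exist constants K_p > 0, C_p > 0, K'_p > 0 depending only on p, and constants C_{2p}[V], C_{2p+1}[V], C_{2p+2}[V] > 0 depending only on p and V (in particular independent of ħ and N), such that the following holds. For every ħ ∈ (0,1], every strong solution R^ħ of the von Neumann equation in Weyl variables with parameter ħ, every N ∈ ℕ, and every strong solution (R_k)_{k=0}^N of the von Neumann Hermite–Galerkin system with initial data R_k(0,x) = ∫_ℝ R^ħ(0,x,y) Φ_k(y) dy, one has for all t ≥ 0: ‖Σ_{k=0}^N R_k(t,·) Φ_k − R^ħ(t,·,·)‖_{L²(ℝ²)} ≤ K_p (2N+3)^{−p} e^{C_{2p}[V]t} 𝒩_{2p}(0) + √(C_p max(1,|V'(0)|,‖V''‖_∞)) (2N+3)^{−(p−1/2)} ((e^{C_{2p+1}[V]t} − 1)/C_{2p+1}[V]) 𝒩_{2p+1}(0) + (K'_p ħ²/4) (2N+3)^{−(p−1/2)}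 ‖V⁽³⁾‖_∞ ((e^{C_{2p+2}[V]t} − 1)/C_{2p+2}[V]) 𝒩_{2p+2}(0), where 𝒩_m is applied to R^ħ. -/

import Mathlib

open MeasureTheory

noncomputable section

/-- Mixed partial derivative `∂_x^b ∂_y^β` of a function `f(x,y)`. -/
def pd2 (b β : ℕ) (f : ℝ → ℝ → ℂ) (x y : ℝ) : ℂ :=
  iteratedDeriv b (fun x' => iteratedDeriv β (fun y' => f x' y') y) x

/-- Weighted derivative `x^a ∂_x^b y^α ∂_y^β` of `f(x,y)`. -/
def wD (a b α β : ℕ) (f : ℝ → ℝ → ℂ) (x y : ℝ) : ℂ :=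
  (x : ℂ) ^ a * (y : ℂ) ^ α * pd2 b β f x y

/-- Uncurried version of a two-variable function. -/
def unc (f : ℝ → ℝ → ℂ) : ℝ × ℝ → ℂ := fun p => f p.1 p.2

/-- L² norm over ℝ². -/
def L2 (f : ℝ → ℝ → ℂ) : ℝ := (eLpNorm (unc f) 2 (volume : Measure (ℝ × ℝ))).toReal

/-- L² norm over ℝ. -/
def L2one (f : ℝ → ℂ) : ℝ := (eLpNorm f 2 (volume : Measure ℝ)).toReal

/-- Schwartz-class predicate for smooth functions of two real variables. -/
def IsSchwartz2 (f : ℝ → ℝ → ℂ) : Prop :=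
  ContDiff ℝ (⊤ : ℕ∞) (unc f) ∧
    ∀ k n : ℕ, ∃ C : ℝ, ∀ p : ℝ × ℝ, ‖p‖ ^ k * ‖iteratedFDeriv ℝ n (unc f) p‖ ≤ C

/-- Schwartz-class predicate for smooth functions of one real variable. -/
def IsSchwartz1 (f : ℝ → ℂ) : Prop :=
  ContDiff ℝ (⊤ : ℕ∞) f ∧ ∀ k n : ℕ, ∃ C : ℝ, ∀ x : ℝ, |x| ^ k * ‖iteratedDeriv n f x‖ ≤ C

/-- Time derivative of a time-dependent two-variable function. -/
def dtR (R : ℝ → ℝ → ℝ → ℂ) (t x y : ℝ) : ℂ := deriv (fun s => R s x y) t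

/-- For all `a b α β`, the map `t ↦ x^a ∂_x^b y^α ∂_y^β R(t,·,·)` is continuously
differentiable from `[0,∞)` into `L²(ℝ²)` with derivative `x^a ∂_x^b y^α ∂_y^β ∂_t R(t,·,·)`. -/
def C1intoL2 (R : ℝ → ℝ → ℝ → ℂ) : Prop :=
  ∀ a b α β : ℕ, ∃ Ψ Ψ' : ℝ → Lp ℂ 2 (volume : Measure (ℝ × ℝ)),
    (∀ t : ℝ, 0 ≤ t → (Ψ t : ℝ × ℝ → ℂ) =ᵐ[volume] unc (wD a b α β (R t))) ∧
    (∀ t : ℝ, 0 ≤ t → (Ψ' t : ℝ × ℝ → ℂ) =ᵐ[volume] unc (wD a b α β (dtR R t))) ∧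
    (∀ t : ℝ, 0 ≤ t → HasDerivWithinAt Ψ (Ψ' t) (Set.Ici 0) t) ∧
    ContinuousOn Ψ' (Set.Ici 0)

/-- Regularity part of the notion of strong solution on `[0,∞) × ℝ²`. -/
def IsRegularSol (R : ℝ → ℝ → ℝ → ℂ) : Prop :=
  ContDiffOn ℝ (⊤ : ℕ∞) (fun p : ℝ × ℝ × ℝ => R p.1 p.2.1 p.2.2) {p : ℝ × ℝ × ℝ | 0 ≤ p.1} ∧
  (∀ t : ℝ, 0 ≤ t → IsSchwartz2 (R t)) ∧ C1intoL2 R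

/-- Strong solution of the von Neumann equation in Weyl variables. -/
def IsVNSol (hbar : ℝ) (V : ℝ → ℝ) (R : ℝ → ℝ → ℝ → ℂ) : Prop :=
  IsRegularSol R ∧
  ∀ t : ℝ, 0 ≤ t → ∀ x y : ℝ,
    dtR R t x y = Complex.I * pd2 1 1 (R t) x y -
      Complex.I * (((V (x + hbar * y / 2) - V (x - hbar * y / 2)) / hbar : ℝ) : ℂ) * R t x y

/-- Strong solution of the semiclassical equation. -/
def IsSCSol (V : ℝ → ℝ) (R : ℝ → ℝ → ℝ → ℂ) : Prop :=
  IsRegularSol R ∧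
  ∀ t : ℝ, 0 ≤ t → ∀ x y : ℝ,
    dtR R t x y = Complex.I * pd2 1 1 (R t) x y -
      Complex.I * ((deriv V x * y : ℝ) : ℂ) * R t x y

/-- The weighted Sobolev functional `𝒩_m` applied to a function of `(x,y)`. -/
def NN (m : ℕ) (f : ℝ → ℝ → ℂ) : ℝ :=
  ∑ q ∈ Finset.filter
      (fun q : ℕ × ℕ × ℕ × ℕ => q.1 + q.2.1 + q.2.2.1 + q.2.2.2 ≤ m)
      (Finset.range (m+1) ×ˢ Finset.range (m+1) ×ˢ Finset.range (m+1) ×ˢ Finset.range (m+1)),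
    L2 (wD q.1 q.2.1 q.2.2.1 q.2.2.2 f)

/-- Supremum norm of a real-valued function. -/
def supN (f : ℝ → ℝ) : ℝ := ⨆ x : ℝ, |f x|

/-- The constant `C_m[V]`. -/
def CmV (m : ℕ) (V : ℝ → ℝ) : ℝ :=
  ((m : ℝ)^2 + 2*m + m * supN (iteratedDeriv 2 V) + m * |deriv V 0|) +
    2^m * (1+m) * m * (⨆ n ∈ Finset.Icc 2 (m+1), supN (iteratedDeriv n V))

/-- Physicists' Hermite polynomial. -/
def Hpoly (k : ℕ) (y : ℝ) : ℝ :=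
  (-1)^k * Real.exp (y^2) * iteratedDeriv k (fun z => Real.exp (-z^2)) y

/-- Hermite function `Φ_k`. -/
def Φh (k : ℕ) (y : ℝ) : ℝ :=
  ((2:ℝ)^k * (Nat.factorial k : ℝ) * Real.sqrt Real.pi) ^ (-(1:ℝ)/2) *
    Real.exp (-y^2/2) * Hpoly k y

/-- The operator `𝒟 u = ∂_x u + V'(x) u`. -/
def Dop (V : ℝ → ℝ) (u : ℝ → ℂ) (x : ℝ) : ℂ := deriv u x + ((deriv V x : ℝ) : ℂ) * u x

/-- The operator `𝒟* u = −∂_x u + V'(x) u`. -/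
def Dstar (V : ℝ → ℝ) (u : ℝ → ℂ) (x : ℝ) : ℂ := -deriv u x + ((deriv V x : ℝ) : ℂ) * u x

/-- The quantum correction `ℰ^ħ(x,y)`. -/
def Eh (hbar : ℝ) (V : ℝ → ℝ) (x y : ℝ) : ℝ :=
  (V (x + hbar * y / 2) - V (x - hbar * y / 2)) / hbar - deriv V x * y

/-- Matrix elements `ℰ^ħ_{k,l}(x)` of the quantum correction. -/
def Ekl (hbar : ℝ) (V : ℝ → ℝ) (k l : ℕ) (x : ℝ) : ℝ :=
  ∫ y : ℝ, Eh hbar V x y * Φh k y * Φh l y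

/-- `t ↦ u(t,·)` is continuously differentiable from `[0,∞)` into `L²(ℝ)` with
derivative `∂_t u`. -/
def C1intoL2one (u : ℝ → ℝ → ℂ) : Prop :=
  ∃ Ψ Ψ' : ℝ → Lp ℂ 2 (volume : Measure ℝ),
    (∀ t : ℝ, 0 ≤ t → (Ψ t : ℝ → ℂ) =ᵐ[volume] u t) ∧
    (∀ t : ℝ, 0 ≤ t → (Ψ' t : ℝ → ℂ) =ᵐ[volume] fun x => deriv (fun s => u s x) t) ∧
    (∀ t : ℝ, 0 ≤ t → HasDerivWithinAt Ψ (Ψ' t) (Set.Ici 0) t) ∧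
    ContinuousOn Ψ' (Set.Ici 0)

/-- Regularity part of the notion of strong solution of a Hermite–Galerkin system of size `N`;
the convention `R_k = 0` for `k > N` is included. -/
def IsGalerkinReg (N : ℕ) (R : ℕ → ℝ → ℝ → ℂ) : Prop :=
  (∀ k, k ≤ N → ContDiffOn ℝ (⊤ : ℕ∞) (fun p : ℝ × ℝ => R k p.1 p.2) {p : ℝ × ℝ | 0 ≤ p.1}) ∧
  (∀ k, k ≤ N → ∀ t : ℝ, 0 ≤ t → IsSchwartz1 (R k t)) ∧
  (∀ k, k ≤ N → C1intoL2one (R k)) ∧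
  (∀ k, N < k → ∀ t x : ℝ, R k t x = 0)

/-- Strong solution of the semiclassical Hermite–Galerkin system of size `N`.
(For `k = 0` the coefficient `√(k/2)` vanishes, so the term `R_{k-1}` is harmless.) -/
def IsSCGalerkinSol (V : ℝ → ℝ) (N : ℕ) (R : ℕ → ℝ → ℝ → ℂ) : Prop :=
  IsGalerkinReg N R ∧
  ∀ k, k ≤ N → ∀ t : ℝ, 0 ≤ t → ∀ x : ℝ,
    deriv (fun s => R k s x) t +
      Complex.I * ((Real.sqrt ((k : ℝ)/2) : ℂ) * Dop V (R (k-1) t) x +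
        (Real.sqrt (((k : ℝ)+1)/2) : ℂ) * Dstar V (R (k+1) t) x) = 0

/-- Strong solution of the von Neumann Hermite–Galerkin system of size `N`. -/
def IsVNGalerkinSol (hbar : ℝ) (V : ℝ → ℝ) (N : ℕ) (R : ℕ → ℝ → ℝ → ℂ) : Prop :=
  IsGalerkinReg N R ∧
  ∀ k, k ≤ N → ∀ t : ℝ, 0 ≤ t → ∀ x : ℝ,
    deriv (fun s => R k s x) t +
      Complex.I * ((Real.sqrt ((k : ℝ)/2) : ℂ) * Dop V (R (k-1) t) x +
        (Real.sqrt (((k : ℝ)+1)/2) : ℂ) * Dstar V (R (k+1) t) x) =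
      -Complex.I * ∑ l ∈ Finset.range (N+1), ((Ekl hbar V k l x : ℝ) : ℂ) * R l t x

/-- Smooth potential with all derivatives of order `≥ 2` bounded. -/
def SmoothBounded (V : ℝ → ℝ) : Prop :=
  ContDiff ℝ (⊤ : ℕ∞) V ∧ ∀ n : ℕ, 2 ≤ n → ∃ C : ℝ, ∀ x : ℝ, |iteratedDeriv n V x| ≤ C

/-- The harmonic-oscillator operator `A G = y² G − G''`. -/
def Aop (g : ℝ → ℂ) : ℝ → ℂ := fun y => (y : ℂ)^2 * g y - iteratedDeriv 2 g y

namespace VNHermite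

open Polynomial in
/-- Physicists' Hermite polynomials through their recursion. -/
def hermiteP : ℕ → Polynomial ℝ
  | 0 => 1
  | k + 1 => 2 * X * hermiteP k - derivative (hermiteP k)

theorem iteratedDeriv_gaussian (k : ℕ) :
    iteratedDeriv k (fun z : ℝ => Real.exp (-z ^ 2)) =
      fun z => (-1) ^ k * (hermiteP k).eval z * Real.exp (-z ^ 2) := by
  induction k with
  | zero => ext z; simp [hermiteP]
  | succ k ih =>
    rw [iteratedDeriv_succ, ih]
    ext z
    have h1 : HasDerivAt (fun z : ℝ => Real.exp (-z ^ 2)) (Real.exp (-z ^ 2) * (-(2 * z))) z := by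
      have := ((hasDerivAt_id z).pow 2).neg.exp
      simpa using this
    have h2 := (((hermiteP k).hasDerivAt z).const_mul ((-1 : ℝ) ^ k)).mul h1
    refine (h2.deriv).trans ?_
    simp [hermiteP, pow_succ]
    ring

theorem Hpoly_eq (k : ℕ) (y : ℝ) : Hpoly k y = (hermiteP k).eval y := by
  unfold Hpoly
  rw [iteratedDeriv_gaussian]
  have h : Real.exp (y ^ 2) * Real.exp (-y ^ 2) = 1 := by rw [← Real.exp_add]; simp
  have h' : ((-1 : ℝ) ^ k) * (-1) ^ k = 1 := by rw [← mul_pow]; simp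
  calc _ = ((-1 : ℝ) ^ k * (-1) ^ k) * (Real.exp (y ^ 2) * Real.exp (-y ^ 2)) *
        (hermiteP k).eval y := by ring
    _ = _ := by rw [h, h']; ring

open Polynomial in
theorem derivative_hermiteP (k : ℕ) :
    derivative (hermiteP (k + 1)) = 2 * ((k : ℝ[X]) + 1) * hermiteP k := by
  induction k with
  | zero => simp [hermiteP]
  | succ k ih =>
    have e : hermiteP (k + 2) = 2 * X * hermiteP (k + 1) - derivative (hermiteP (k + 1)) := rfl
    have e1 : hermiteP (k + 1) = 2 * X * hermiteP k - derivative (hermiteP k) := rfl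
    rw [e, derivative_sub, ih]
    have d1 : derivative (2 * X * hermiteP (k + 1)) =
        2 * hermiteP (k + 1) + 2 * X * derivative (hermiteP (k + 1)) := by
      rw [derivative_mul]
      have : derivative (2 * X : ℝ[X]) = 2 := by
        rw [derivative_mul]; simp
      rw [this]
    have d2 : derivative (2 * ((k : ℝ[X]) + 1) * hermiteP k) =
        2 * ((k : ℝ[X]) + 1) * derivative (hermiteP k) := by
      rw [derivative_mul]
      have : derivative (2 * ((k : ℝ[X]) + 1)) = 0 := by
        rw [derivative_mul]; simp
      rw [this]; ring
    rw [d1, d2, ih, e1]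
    push_cast
    ring

/-- Normalization constant of the Hermite function. -/
def nrm (k : ℕ) : ℝ :=
  ((2 : ℝ) ^ k * (Nat.factorial k : ℝ) * Real.sqrt Real.pi) ^ (-(1 : ℝ) / 2)

theorem nrm_eq (k : ℕ) :
    nrm k = (Real.sqrt ((2 : ℝ) ^ k * (Nat.factorial k : ℝ) * Real.sqrt Real.pi))⁻¹ := by
  unfold nrm
  rw [show (-(1 : ℝ) / 2) = -(1 / 2) by ring, Real.rpow_neg (by positivity), ← Real.sqrt_eq_rpow]

theorem nrm_pos (k : ℕ) : 0 < nrm k := by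
  rw [nrm_eq]; positivity

theorem nrm_succ (k : ℕ) : nrm k = Real.sqrt (2 * ((k : ℝ) + 1)) * nrm (k + 1) := by
  rw [nrm_eq, nrm_eq]
  have : (2 : ℝ) ^ (k + 1) * ((k + 1).factorial : ℝ) * Real.sqrt Real.pi =
      (2 * ((k : ℝ) + 1)) * ((2 : ℝ) ^ k * (k.factorial : ℝ) * Real.sqrt Real.pi) := by
    rw [Nat.factorial_succ]; push_cast; ring
  rw [this, Real.sqrt_mul (show 0 ≤ 2 * ((k : ℝ) + 1) by positivity), mul_inv, ← mul_assoc,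
    mul_inv_cancel₀ (by positivity),
    one_mul]

theorem Φh_eq (k : ℕ) (y : ℝ) : Φh k y = nrm k * Real.exp (-y ^ 2 / 2) * (hermiteP k).eval y := by
  unfold Φh
  rw [Hpoly_eq]; rfl

theorem two_mul_sqrt_half (a : ℝ) : Real.sqrt (2 * a) = 2 * Real.sqrt (a / 2) := by
  rw [show 2 * a = 2 ^ 2 * (a / 2) by ring, Real.sqrt_mul (by positivity),
    Real.sqrt_sq (by norm_num)]

theorem eval_derivative_hermiteP (k : ℕ) (y : ℝ) :
    nrm k * (Polynomial.derivative (hermiteP k)).eval y =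
      2 * Real.sqrt ((k : ℝ) / 2) * (nrm (k - 1) * (hermiteP (k - 1)).eval y) := by
  cases k with
  | zero => simp [hermiteP]
  | succ k =>
    rw [derivative_hermiteP]
    simp only [Nat.add_sub_cancel, Polynomial.eval_mul, Polynomial.eval_add,
      Polynomial.eval_natCast, Polynomial.eval_one, Polynomial.eval_ofNat]
    rw [nrm_succ k, two_mul_sqrt_half]
    push_cast
    have : Real.sqrt (((k : ℝ) + 1) / 2) * Real.sqrt (((k : ℝ) + 1) / 2) = ((k : ℝ) + 1) / 2 :=
      Real.mul_self_sqrt (by positivity)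
    linear_combination (-(4 * nrm (k + 1) * (hermiteP k).eval y)) * this

theorem eval_hermiteP_succ (k : ℕ) (y : ℝ) :
    (hermiteP (k + 1)).eval y =
      2 * y * (hermiteP k).eval y - (Polynomial.derivative (hermiteP k)).eval y := by
  simp [hermiteP]

theorem mul_Φh (k : ℕ) (y : ℝ) :
    y * Φh k y = Real.sqrt ((k : ℝ) / 2) * Φh (k - 1) y +
      Real.sqrt (((k : ℝ) + 1) / 2) * Φh (k + 1) y := by
  simp only [Φh_eq]
  have h1 := eval_derivative_hermiteP k y
  have h2 := eval_hermiteP_succ k y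
  have h3 := nrm_succ k
  rw [two_mul_sqrt_half] at h3
  rw [h2]
  linear_combination (Real.exp (-y ^ 2 / 2)) / 2 * h1 +
    (y * Real.exp (-y ^ 2 / 2) * (hermiteP k).eval y -
      Real.exp (-y ^ 2 / 2) * (Polynomial.derivative (hermiteP k)).eval y / 2) * h3

theorem hasDerivAt_Φh (k : ℕ) (y : ℝ) :
    HasDerivAt (Φh k) (Real.sqrt ((k : ℝ) / 2) * Φh (k - 1) y -
      Real.sqrt (((k : ℝ) + 1) / 2) * Φh (k + 1) y) y := by
  have e : Φh k = fun y => nrm k * Real.exp (-y ^ 2 / 2) * (hermiteP k).eval y := by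
    ext; exact Φh_eq _ _
  have h1 : HasDerivAt (fun z : ℝ => Real.exp (-z ^ 2 / 2)) (Real.exp (-y ^ 2 / 2) * (-y)) y := by
    have := ((((hasDerivAt_id y).pow 2).neg.div_const 2).exp)
    refine this.congr_deriv ?_
    simp only [Pi.neg_apply, Pi.pow_apply, id]
    push_cast
    ring
  have h := (h1.const_mul (nrm k)).mul ((hermiteP k).hasDerivAt y)
  rw [e]
  refine h.congr_deriv ?_
  have hm := mul_Φh k y
  have h2 := eval_derivative_hermiteP k y
  rw [Φh_eq] at hm
  rw [Φh_eq (k - 1)] at hm ⊢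
  linear_combination -hm + Real.exp (-y ^ 2 / 2) * h2

theorem continuous_Φh (k : ℕ) : Continuous (Φh k) :=
  continuous_iff_continuousAt.2 fun y => (hasDerivAt_Φh k y).continuousAt

theorem exists_bound_pow_mul_gaussian (n : ℕ) :
    ∃ C : ℝ, ∀ y : ℝ, |y| ^ n * Real.exp (-y ^ 2 / 2) ≤ C := by
  refine ⟨1 + 2 ^ n * n.factorial, fun y => ?_⟩
  have h0 : Real.exp (-y ^ 2 / 2) ≤ 1 := by
    rw [Real.exp_le_one_iff]; nlinarith [sq_nonneg y]
  have h1 : (y ^ 2) ^ n * Real.exp (-y ^ 2 / 2) ≤ 2 ^ n * n.factorial := by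
    have := Real.pow_div_factorial_le_exp (y ^ 2 / 2) (by positivity) n
    rw [div_pow, div_div, div_le_iff₀ (by positivity)] at this
    have e : Real.exp (y ^ 2 / 2) * Real.exp (-y ^ 2 / 2) = 1 := by
      rw [← Real.exp_add]; simp; ring
    calc _ ≤ Real.exp (y ^ 2 / 2) * (2 ^ n * n.factorial) * Real.exp (-y ^ 2 / 2) := by gcongr
      _ = (Real.exp (y ^ 2 / 2) * Real.exp (-y ^ 2 / 2)) * (2 ^ n * n.factorial) := by ring
      _ = _ := by rw [e, one_mul]
  have h2 : |y| ^ n ≤ 1 + (y ^ 2) ^ n := by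
    rw [← sq_abs, ← pow_mul, mul_comm 2 n, pow_mul]
    nlinarith [sq_nonneg (|y| ^ n - 1), pow_nonneg (abs_nonneg y) n]
  calc _ ≤ (1 + (y ^ 2) ^ n) * Real.exp (-y ^ 2 / 2) := by gcongr
    _ ≤ _ := by nlinarith

theorem exists_bound_pow_mul_polynomial (P : Polynomial ℝ) (n : ℕ) :
    ∃ C : ℝ, ∀ y : ℝ, |y| ^ n * |Real.exp (-y ^ 2 / 2) * P.eval y| ≤ C := by
  induction P using Polynomial.induction_on' with
  | add p q hp hq =>
    obtain ⟨C, hC⟩ := hp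
    obtain ⟨D, hD⟩ := hq
    refine ⟨C + D, fun y => ?_⟩
    rw [Polynomial.eval_add, mul_add]
    calc _ ≤ |y| ^ n * (|Real.exp (-y ^ 2 / 2) * p.eval y| +
          |Real.exp (-y ^ 2 / 2) * q.eval y|) := by gcongr; exact abs_add_le _ _
      _ ≤ _ := by rw [mul_add]; exact add_le_add (hC y) (hD y)
  | monomial m a =>
    obtain ⟨C, hC⟩ := exists_bound_pow_mul_gaussian (n + m)
    refine ⟨|a| * C, fun y => ?_⟩
    rw [Polynomial.eval_monomial, abs_mul, abs_mul, abs_pow, abs_of_pos (Real.exp_pos _)]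
    calc _ = |a| * (|y| ^ (n + m) * Real.exp (-y ^ 2 / 2)) := by rw [pow_add]; ring
      _ ≤ _ := by gcongr; exact hC y

theorem exists_bound_pow_mul_Φh (k n : ℕ) : ∃ C : ℝ, ∀ y : ℝ, |y| ^ n * |Φh k y| ≤ C := by
  obtain ⟨C, hC⟩ := exists_bound_pow_mul_polynomial (Polynomial.C (nrm k) * hermiteP k) n
  refine ⟨C, fun y => ?_⟩
  convert hC y using 3
  rw [Φh_eq]; simp; ring

/-- Hermite functions decay faster than any power. -/
theorem exists_decay_Φh (k n : ℕ) :
    ∃ C : ℝ, 0 ≤ C ∧ ∀ y : ℝ, (1 + |y|) ^ n * |Φh k y| ≤ C * (1 + y ^ 2)⁻¹ := by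
  choose C hC using exists_bound_pow_mul_Φh k
  refine ⟨2 ^ (n + 2) * (C 0 + C (n + 2)), ?_, fun y => ?_⟩
  · have h0 := (by positivity : (0:ℝ) ≤ |(0:ℝ)| ^ 0 * |Φh k 0|).trans (hC 0 0)
    have h1 := (by positivity : (0:ℝ) ≤ |(0:ℝ)| ^ (n + 2) * |Φh k 0|).trans (hC (n + 2) 0)
    positivity
  · rw [← div_eq_mul_inv, le_div_iff₀ (by positivity)]
    have h1 : (1 + |y|) ^ (n + 2) ≤ 2 ^ (n + 2) * (1 + |y| ^ (n + 2)) := by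
      rcases le_total |y| 1 with h | h
      · calc (1 + |y|) ^ (n + 2) ≤ (1 + 1) ^ (n + 2) := by gcongr
          _ = 2 ^ (n + 2) * 1 := by norm_num
          _ ≤ _ := by gcongr; linarith [pow_nonneg (abs_nonneg y) (n + 2)]
      · calc (1 + |y|) ^ (n + 2) ≤ (|y| + |y|) ^ (n + 2) := by gcongr
          _ = 2 ^ (n + 2) * |y| ^ (n + 2) := by rw [← two_mul, mul_pow]
          _ ≤ _ := by gcongr; linarith
    have h2 : 1 + y ^ 2 ≤ (1 + |y|) ^ 2 := by
      rw [← sq_abs y]; nlinarith [abs_nonneg y]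
    calc (1 + |y|) ^ n * |Φh k y| * (1 + y ^ 2) ≤ (1 + |y|) ^ n * |Φh k y| * (1 + |y|) ^ 2 := by
          gcongr
      _ = (1 + |y|) ^ (n + 2) * |Φh k y| := by ring
      _ ≤ (2 ^ (n + 2) * (1 + |y| ^ (n + 2))) * |Φh k y| := by gcongr
      _ = 2 ^ (n + 2) * (|y| ^ 0 * |Φh k y| + |y| ^ (n + 2) * |Φh k y|) := by ring
      _ ≤ _ := by gcongr <;> apply hC

/-- Products of Hermite functions with functions of polynomial growth are integrable. -/
theorem integrable_mul_Φh {g : ℝ → ℂ} (hg : AEStronglyMeasurable g volume) (k : ℕ) {n : ℕ} {B : ℝ}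
    (hB : ∀ y, ‖g y‖ ≤ B * (1 + |y|) ^ n) :
    Integrable (fun y => g y * ((Φh k y : ℝ) : ℂ)) := by
  obtain ⟨C, hC0, hC⟩ := exists_decay_Φh k n
  refine (integrable_inv_one_add_sq.const_mul (|B| * C)).mono'
    (hg.mul (Complex.continuous_ofReal.comp (continuous_Φh k)).aestronglyMeasurable) ?_
  refine Filter.Eventually.of_forall fun y => ?_
  rw [norm_mul, Complex.norm_real, Real.norm_eq_abs]
  calc ‖g y‖ * |Φh k y| ≤ (|B| * (1 + |y|) ^ n) * |Φh k y| := by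
        gcongr
        exact (hB y).trans (by gcongr; exact le_abs_self B)
    _ = |B| * ((1 + |y|) ^ n * |Φh k y|) := by ring
    _ ≤ |B| * (C * (1 + y ^ 2)⁻¹) := mul_le_mul_of_nonneg_left (hC y) (abs_nonneg B)
    _ = _ := by ring

theorem norm_Φh_le (k : ℕ) : ∃ B : ℝ, 0 ≤ B ∧ ∀ y, |Φh k y| ≤ B := by
  obtain ⟨C, hC0, hC⟩ := exists_decay_Φh k 0
  refine ⟨C, hC0, fun y => ?_⟩
  have := hC y
  simp only [pow_zero, one_mul] at this
  refine this.trans (mul_le_of_le_one_right hC0 (inv_le_one_of_one_le₀ ?_))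
  nlinarith [sq_nonneg y]

theorem memLp_pow_mul_Φh (k n : ℕ) :
    MemLp (fun y : ℝ => ((y ^ n * Φh k y : ℝ) : ℂ)) 2 := by
  have hc : Continuous (fun y : ℝ => ((y ^ n * Φh k y : ℝ) : ℂ)) :=
    Complex.continuous_ofReal.comp ((continuous_pow n).mul (continuous_Φh k))
  refine (memLp_two_iff_integrable_sq_norm hc.aestronglyMeasurable).2 ?_
  obtain ⟨B, hB0, hB⟩ := norm_Φh_le k
  have := integrable_mul_Φh (g := fun y : ℝ => ((y ^ (2 * n) * Φh k y : ℝ) : ℂ))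
    (Complex.continuous_ofReal.comp
      ((continuous_pow _).mul (continuous_Φh k))).aestronglyMeasurable k (n := 2 * n) (B := B) ?_
  · refine this.norm.congr (Filter.Eventually.of_forall fun y => ?_)
    simp only [norm_mul, Complex.norm_real, Real.norm_eq_abs, abs_pow]
    ring
  · intro y
    rw [Complex.norm_real, Real.norm_eq_abs, abs_mul, abs_pow, mul_comm]
    have : |y| ≤ 1 + |y| := by linarith
    gcongr
    exact hB y

theorem memLp_Φh (k : ℕ) : MemLp (fun y : ℝ => ((Φh k y : ℝ) : ℂ)) 2 := by
  simpa using memLp_pow_mul_Φh k 0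

theorem integrable_Φh_mul_Φh (k l : ℕ) : Integrable (fun y : ℝ => Φh k y * Φh l y) := by
  have h := (memLp_Φh k).integrable_mul (memLp_Φh l)
  have h2 : Integrable (fun y : ℝ => ((Φh k y * Φh l y : ℝ) : ℂ)) := by
    refine h.congr (Filter.Eventually.of_forall fun y => ?_); simp
  exact h2.re

/-- Adjointness of the ladder operators on the Hermite functions. -/
theorem ladder_Φh (k l : ℕ) :
    Real.sqrt (((k : ℝ) + 1) / 2) * ∫ y, Φh (k + 1) y * Φh l y =
      Real.sqrt ((l : ℝ) / 2) * ∫ y, Φh k y * Φh (l - 1) y := by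
  set s := Real.sqrt ((k : ℝ) / 2)
  set s' := Real.sqrt (((k : ℝ) + 1) / 2)
  set r := Real.sqrt ((l : ℝ) / 2)
  set r' := Real.sqrt (((l : ℝ) + 1) / 2)
  have i1 := integrable_Φh_mul_Φh (k - 1) l
  have i2 := integrable_Φh_mul_Φh (k + 1) l
  have i3 := integrable_Φh_mul_Φh k (l - 1)
  have i4 := integrable_Φh_mul_Φh k (l + 1)
  have hA : ∫ y, Φh k y * (r * Φh (l - 1) y - r' * Φh (l + 1) y) =
      - ∫ y, (s * Φh (k - 1) y - s' * Φh (k + 1) y) * Φh l y := by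
    refine integral_mul_deriv_eq_deriv_mul_of_integrable (fun y _ => hasDerivAt_Φh k y)
      (fun y _ => hasDerivAt_Φh l y) ?_ ?_ (integrable_Φh_mul_Φh k l)
    · refine ((i3.const_mul r).sub (i4.const_mul r')).congr
        (Filter.Eventually.of_forall fun y => ?_)
      simp only [Pi.mul_apply, Pi.sub_apply]; ring
    · refine ((i1.const_mul s).sub (i2.const_mul s')).congr
        (Filter.Eventually.of_forall fun y => ?_)
      simp only [Pi.mul_apply, Pi.sub_apply]; ring
  have hB : ∫ y, Φh k y * (r * Φh (l - 1) y + r' * Φh (l + 1) y) =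
      ∫ y, (s * Φh (k - 1) y + s' * Φh (k + 1) y) * Φh l y := by
    congr 1; ext y
    rw [← mul_Φh, ← mul_Φh]; ring
  have e1 : ∀ y, Φh k y * (r * Φh (l - 1) y - r' * Φh (l + 1) y) =
    r * (Φh k y * Φh (l - 1) y) - r' * (Φh k y * Φh (l + 1) y) := fun y => by ring
  have e2 : ∀ y, Φh k y * (r * Φh (l - 1) y + r' * Φh (l + 1) y) =
    r * (Φh k y * Φh (l - 1) y) + r' * (Φh k y * Φh (l + 1) y) := fun y => by ring
  have e3 : ∀ y, (s * Φh (k - 1) y - s' * Φh (k + 1) y) * Φh l y =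
    s * (Φh (k - 1) y * Φh l y) - s' * (Φh (k + 1) y * Φh l y) := fun y => by ring
  have e4 : ∀ y, (s * Φh (k - 1) y + s' * Φh (k + 1) y) * Φh l y =
    s * (Φh (k - 1) y * Φh l y) + s' * (Φh (k + 1) y * Φh l y) := fun y => by ring
  simp only [e1, e3] at hA
  simp only [e2, e4] at hB
  rw [integral_sub (i3.const_mul r) (i4.const_mul r'),
    integral_sub (i1.const_mul s) (i2.const_mul s')] at hA
  rw [integral_add (i3.const_mul r) (i4.const_mul r'),
    integral_add (i1.const_mul s) (i2.const_mul s')] at hB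
  simp only [integral_const_mul] at hA hB
  linarith

theorem integral_Φh_zero_sq : ∫ y, Φh 0 y * Φh 0 y = 1 := by
  have e : ∀ y, Φh 0 y * Φh 0 y = (Real.sqrt Real.pi)⁻¹ * Real.exp (-1 * y ^ 2) := by
    intro y
    simp only [Φh_eq, hermiteP, Polynomial.eval_one, nrm_eq]
    have h1 : Real.exp (-y ^ 2 / 2) * Real.exp (-y ^ 2 / 2) = Real.exp (-1 * y ^ 2) := by
      rw [← Real.exp_add]; congr 1; ring
    have h2 : (Real.sqrt (2 ^ 0 * (Nat.factorial 0 : ℝ) * Real.sqrt Real.pi)) *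
        (Real.sqrt (2 ^ 0 * (Nat.factorial 0 : ℝ) * Real.sqrt Real.pi)) = Real.sqrt Real.pi := by
      rw [Real.mul_self_sqrt (by positivity)]; simp
    have h3 : ∀ z : ℝ, z * z = √Real.pi → z⁻¹ * z⁻¹ = (√Real.pi)⁻¹ := by
      intro z hz; rw [← mul_inv, hz]
    rw [← h1, ← h3 _ h2]; ring
  simp only [e]
  rw [integral_const_mul, integral_gaussian]
  simp only [div_one]
  exact inv_mul_cancel₀ (by positivity)

theorem integral_Φh_mul_Φh (k l : ℕ) : ∫ y, Φh k y * Φh l y = if k = l then 1 else 0 := by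
  have key : ∀ k l : ℕ, k ≤ l → ∫ y, Φh k y * Φh l y = if k = l then 1 else 0 := by
    intro k
    induction k with
    | zero =>
      intro l _
      cases l with
      | zero => simpa using integral_Φh_zero_sq
      | succ l =>
        have h := ladder_Φh l 0
        simp only [Nat.cast_zero, zero_div, Real.sqrt_zero, zero_mul] at h
        have hs : Real.sqrt (((l : ℝ) + 1) / 2) ≠ 0 := by positivity
        have h2 := (mul_eq_zero.1 h).resolve_left hs
        simpa [mul_comm] using h2
    | succ k ih =>
      intro l hl
      obtain ⟨l, rfl⟩ : ∃ l', l = l' + 1 := ⟨l - 1, by omega⟩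
      have h := ladder_Φh k (l + 1)
      rw [Nat.add_sub_cancel, ih l (by omega)] at h
      have hs : Real.sqrt (((k : ℝ) + 1) / 2) ≠ 0 := by positivity
      by_cases hkl : k = l
      · subst hkl
        simp only [if_true, Nat.cast_add, Nat.cast_one] at h ⊢
        exact mul_left_cancel₀ hs h
      · simp only [hkl, if_false, mul_zero, add_left_inj] at h ⊢
        exact (mul_eq_zero.1 h).resolve_left hs
  rcases le_total k l with h | h
  · exact key k l h
  · have := key l k h
    simp only [mul_comm (Φh k _)]
    rw [this]; simp [eq_comm]

open scoped FourierTransform SchwartzMap ContDiff in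
/-- Injectivity of the Fourier transform on integrable functions. -/
theorem ae_eq_zero_of_fourier_eq_zero {F : ℝ → ℂ} (hF : Integrable F)
    (h : ∀ ξ : ℝ, 𝓕 F ξ = 0) : ∀ᵐ y, F y = 0 := by
  refine ae_eq_zero_of_integral_contDiff_smul_eq_zero hF.locallyIntegrable fun g hg hgs => ?_
  have hgC : ContDiff ℝ ∞ (fun x => (g x : ℂ)) := Complex.ofRealCLM.contDiff.comp hg
  have hgsC : HasCompactSupport (fun x => (g x : ℂ)) := hgs.comp_left Complex.ofReal_zero
  let G : 𝓢(ℝ, ℂ) := hgsC.toSchwartzMap hgC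
  have hG : ∀ x, G x = g x := fun x => rfl
  let K : 𝓢(ℝ, ℂ) := 𝓕⁻ G
  have hK : 𝓕 K = G := by simp [K]
  have key := VectorFourier.integral_fourierIntegral_smul_eq_flip (μ := volume) (ν := volume)
    (L := innerₗ ℝ) (f := (K : ℝ → ℂ)) (g := F) Real.continuous_fourierChar
    (by fun_prop) K.integrable hF
  have e1 : ∀ ξ, VectorFourier.fourierIntegral Real.fourierChar volume (innerₗ ℝ).flip F ξ = 0 := by
    intro ξ
    rw [flip_innerₗ]
    exact h ξ
  have e2 : ∀ ξ, VectorFourier.fourierIntegral Real.fourierChar volume (innerₗ ℝ) (K : ℝ → ℂ) ξ =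
      (g ξ : ℂ) := by
    intro ξ
    rw [← hG, ← hK]
    rfl
  simp only [e1, e2, smul_zero, integral_zero] at key
  rw [← key]
  congr 1

theorem memLp_exp_abs_mul_Φh_zero (c : ℝ) :
    MemLp (fun y : ℝ => ((Real.exp (c * |y|) * Φh 0 y : ℝ) : ℂ)) 2 := by
  have hc : Continuous (fun y : ℝ => ((Real.exp (c * |y|) * Φh 0 y : ℝ) : ℂ)) :=
    Complex.continuous_ofReal.comp
      ((Real.continuous_exp.comp (continuous_const.mul continuous_abs)).mul (continuous_Φh 0))
  refine (memLp_two_iff_integrable_sq_norm hc.aestronglyMeasurable).2 ?_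
  refine (((integrable_exp_neg_mul_sq (b := 1 / 2) (by norm_num)).const_mul
    (nrm 0 ^ 2 * Real.exp (2 * c ^ 2)))).mono' (hc.norm.pow 2).aestronglyMeasurable
    (Filter.Eventually.of_forall fun y => ?_)
  rw [Complex.norm_real, Real.norm_eq_abs, Real.norm_eq_abs, abs_of_nonneg (by positivity), sq_abs,
    Φh_eq]
  simp only [hermiteP, Polynomial.eval_one, mul_one]
  calc (Real.exp (c * |y|) * (nrm 0 * Real.exp (-y ^ 2 / 2))) ^ 2
      = nrm 0 ^ 2 * Real.exp (2 * (c * |y|) + 2 * (-y ^ 2 / 2)) := by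
        rw [mul_pow, mul_pow, Real.exp_add, two_mul (c * |y|), two_mul (-y ^ 2 / 2), Real.exp_add,
          Real.exp_add]
        ring
    _ ≤ nrm 0 ^ 2 * Real.exp (2 * c ^ 2 + -(1 / 2) * y ^ 2) := by
        refine mul_le_mul_of_nonneg_left (Real.exp_le_exp.2 ?_) (sq_nonneg _)
        nlinarith [sq_nonneg (2 * c - |y|), sq_abs y]
    _ = _ := by rw [Real.exp_add]; ring

theorem integral_pow_mul_Φh_eq_zero {g : ℝ → ℂ} (hg : MemLp g 2)
    (h : ∀ k, ∫ y, g y * ((Φh k y : ℝ) : ℂ) = 0) (n k : ℕ) :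
    ∫ y, g y * ((y ^ n * Φh k y : ℝ) : ℂ) = 0 := by
  induction n generalizing k with
  | zero => simpa using h k
  | succ n ih =>
    have e : ∀ y : ℝ, g y * ((y ^ (n + 1) * Φh k y : ℝ) : ℂ) =
        (Real.sqrt ((k : ℝ) / 2) : ℂ) * (g y * ((y ^ n * Φh (k - 1) y : ℝ) : ℂ)) +
        (Real.sqrt (((k : ℝ) + 1) / 2) : ℂ) * (g y * ((y ^ n * Φh (k + 1) y : ℝ) : ℂ)) := by
      intro y
      rw [pow_succ, mul_assoc, mul_Φh]; push_cast; ring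
    simp only [e]
    rw [integral_add, integral_const_mul, integral_const_mul, ih, ih]
    · simp
    · exact (hg.integrable_mul (memLp_pow_mul_Φh _ _)).const_mul _
    · exact (hg.integrable_mul (memLp_pow_mul_Φh _ _)).const_mul _

open scoped FourierTransform in
/-- Completeness of the Hermite functions. -/
theorem ae_eq_zero_of_integral_mul_Φh {g : ℝ → ℂ} (hg : MemLp g 2)
    (h : ∀ k, ∫ y, g y * ((Φh k y : ℝ) : ℂ) = 0) : ∀ᵐ y, g y = 0 := by
  have hF : Integrable (fun y => g y * ((Φh 0 y : ℝ) : ℂ)) := hg.integrable_mul (memLp_Φh 0)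
  have hz : ∀ᵐ y, g y * ((Φh 0 y : ℝ) : ℂ) = 0 := by
    refine ae_eq_zero_of_fourier_eq_zero hF fun ξ => ?_
    rw [Real.fourier_eq']
    set a : ℂ := ((-2 * Real.pi * ξ : ℝ) : ℂ) * Complex.I with ha
    have hs := hasSum_integral_of_dominated_convergence (μ := volume)
      (F := fun (n : ℕ) (y : ℝ) => (a * y) ^ n / (n.factorial : ℂ) * (g y * ((Φh 0 y : ℝ) : ℂ)))
      (f := fun y => Complex.exp (a * y) * (g y * ((Φh 0 y : ℝ) : ℂ)))
      (fun n y => (‖a‖ * |y|) ^ n / (n.factorial : ℝ) * ‖g y * ((Φh 0 y : ℝ) : ℂ)‖) ?_ ?_ ?_ ?_ ?_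
    · have hn : ∀ n : ℕ,
          ∫ y : ℝ, (a * y) ^ n / (n.factorial : ℂ) * (g y * ((Φh 0 y : ℝ) : ℂ)) = 0 := by
        intro n
        have e : ∀ y : ℝ, (a * y) ^ n / (n.factorial : ℂ) * (g y * ((Φh 0 y : ℝ) : ℂ)) =
            (a ^ n / (n.factorial : ℂ)) * (g y * ((y ^ n * Φh 0 y : ℝ) : ℂ)) := by
          intro y; push_cast; ring
        simp only [e]
        rw [integral_const_mul, integral_pow_mul_Φh_eq_zero hg h, mul_zero]
      simp only [hn] at hs
      rw [← hs.unique hasSum_zero]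
      refine integral_congr_ae (Filter.Eventually.of_forall fun y => ?_)
      simp only [smul_eq_mul]
      congr 2
      rw [ha]
      simp
      ring
    · intro n
      exact (by fun_prop : Continuous fun y : ℝ => (a * y) ^ n / (n.factorial : ℂ)
        ).aestronglyMeasurable.mul hF.aestronglyMeasurable
    · intro n
      refine Filter.Eventually.of_forall fun y => ?_
      rw [norm_mul, norm_div, norm_pow, norm_mul, Complex.norm_real, Complex.norm_natCast,
        Real.norm_eq_abs]
    · refine Filter.Eventually.of_forall fun y => ?_
      exact (Real.summable_pow_div_factorial _).mul_right _
    · have hi := (hg.integrable_mul (memLp_exp_abs_mul_Φh_zero ‖a‖)).norm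
      refine hi.congr (Filter.Eventually.of_forall fun y => ?_)
      simp only
      rw [tsum_mul_right]
      have : ∑' n : ℕ, (‖a‖ * |y|) ^ n / (n.factorial : ℝ) = Real.exp (‖a‖ * |y|) := by
        rw [Real.exp_eq_exp_ℝ, NormedSpace.exp_eq_tsum_div]
      rw [this]
      simp only [norm_mul, Complex.norm_real, Real.norm_eq_abs, Real.abs_exp, Pi.mul_apply]
      ring
    · refine Filter.Eventually.of_forall fun y => ?_
      refine HasSum.mul_right _ ?_
      rw [Complex.exp_eq_exp_ℂ]
      exact NormedSpace.expSeries_div_hasSum_exp _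
  filter_upwards [hz] with y hy
  have : Φh 0 y ≠ 0 := by
    rw [Φh_eq]
    simp only [hermiteP, Polynomial.eval_one, mul_one]
    exact (mul_pos (nrm_pos 0) (Real.exp_pos _)).ne'
  exact (mul_eq_zero.1 hy).resolve_right (by exact_mod_cast this)

/-- The Hermite functions as elements of `L²(ℝ)`. -/
def ΦL (k : ℕ) : Lp ℂ 2 (volume : Measure ℝ) := (memLp_Φh k).toLp _

theorem inner_ΦL {g : ℝ → ℂ} (hg : MemLp g 2) (k : ℕ) :
    inner ℂ (ΦL k) (hg.toLp g) = ∫ y, g y * ((Φh k y : ℝ) : ℂ) := by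
  rw [L2.inner_def]
  refine integral_congr_ae ?_
  filter_upwards [(memLp_Φh k).coeFn_toLp, hg.coeFn_toLp] with y h1 h2
  rw [ΦL, h1, h2]
  simp

theorem orthonormal_ΦL : Orthonormal ℂ ΦL := by
  rw [orthonormal_iff_ite]
  intro k l
  have := inner_ΦL (memLp_Φh l) k
  rw [ΦL] at this
  rw [ΦL, ΦL, this]
  have h2 := integral_Φh_mul_Φh k l
  rw [show (∫ y, ((Φh l y : ℝ) : ℂ) * ((Φh k y : ℝ) : ℂ)) =
    ((∫ y, Φh k y * Φh l y : ℝ) : ℂ) by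
      rw [← integral_complex_ofReal]; congr 1; ext y; push_cast; ring, h2]
  split_ifs <;> simp

/-- The Hermite functions form a Hilbert basis of `L²(ℝ)`. -/
def hermiteBasis : HilbertBasis ℕ ℂ (Lp ℂ 2 (volume : Measure ℝ)) :=
  HilbertBasis.mkOfOrthogonalEqBot orthonormal_ΦL (by
    rw [Submodule.eq_bot_iff]
    intro g hg
    rw [Submodule.mem_orthogonal] at hg
    have h : ∀ k, ∫ y, g y * ((Φh k y : ℝ) : ℂ) = 0 := by
      intro k
      have := hg (ΦL k) (Submodule.subset_span ⟨k, rfl⟩)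
      rw [← inner_ΦL (Lp.memLp g) k, Lp.toLp_coeFn]; exact this
    rw [Lp.eq_zero_iff_ae_eq_zero]
    exact ae_eq_zero_of_integral_mul_Φh (Lp.memLp g) h)

theorem hermiteBasis_apply (k : ℕ) : hermiteBasis k = ΦL k := by
  rw [hermiteBasis, HilbertBasis.coe_mkOfOrthogonalEqBot]

/-- Parseval identity for the Hermite expansion. -/
theorem tsum_enorm_sq_integral_mul_Φh {g : ℝ → ℂ} (hg : MemLp g 2) :
    ∑' k, ‖∫ y, g y * ((Φh k y : ℝ) : ℂ)‖ₑ ^ 2 = ∫⁻ y, ‖g y‖ₑ ^ 2 := by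
  have h1 := hermiteBasis.hasSum_inner_mul_inner (hg.toLp g) (hg.toLp g)
  have h2 : HasSum (fun k => ‖∫ y, g y * ((Φh k y : ℝ) : ℂ)‖ ^ 2) (‖hg.toLp g‖ ^ 2) := by
    have := (Complex.hasSum_re h1)
    rw [inner_self_eq_norm_sq_to_K] at this
    convert this using 1
    · ext k
      rw [hermiteBasis_apply, inner_ΦL, ← inner_conj_symm, inner_ΦL, ← Complex.normSq_eq_norm_sq,
        mul_comm, Complex.mul_conj, Complex.ofReal_re]
    · norm_cast
  have h3 : (eLpNorm g 2 volume) ^ 2 = ∫⁻ y, ‖g y‖ₑ ^ 2 := by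
    have := eLpNorm_nnreal_pow_eq_lintegral (f := g) (μ := volume) (p := 2) (by norm_num)
    simpa using this
  rw [← h3, ← ENNReal.ofReal_toReal hg.2.ne, ← Lp.norm_toLp g hg, ← ENNReal.ofReal_pow (norm_nonneg _),
    ← h2.tsum_eq, ENNReal.ofReal_tsum_of_nonneg (fun _ => by positivity) h2.summable]
  congr 1; ext k
  rw [ENNReal.ofReal_pow (norm_nonneg _), ofReal_norm]

/-- Hermite coefficient in the second variable. -/
def cf (k : ℕ) (f : ℝ × ℝ → ℂ) (x : ℝ) : ℂ := ∫ y, f (x, y) * ((Φh k y : ℝ) : ℂ)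

/-- The square of the `L²` norm. -/
def sqn {α : Type*} [MeasureSpace α] (f : α → ℂ) : ENNReal := ∫⁻ p, ‖f p‖ₑ ^ 2

theorem eLpNorm_sq {α : Type*} [MeasureSpace α] (f : α → ℂ) :
    eLpNorm f 2 volume ^ 2 = sqn f := by
  have := eLpNorm_nnreal_pow_eq_lintegral (f := f) (μ := (volume : Measure α)) (p := 2)
    (by norm_num)
  simpa [sqn] using this

theorem memLp_iff_sqn {α : Type*} [MeasureSpace α] {f : α → ℂ}
    (hf : AEStronglyMeasurable f volume) : MemLp f 2 ↔ sqn f < ⊤ := by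
  rw [← eLpNorm_sq]
  constructor
  · intro h; exact ENNReal.pow_lt_top h.2
  · intro h
    refine ⟨hf, ?_⟩
    by_contra hc
    rw [not_lt, top_le_iff] at hc
    simp [hc] at h

theorem sqn_congr {α : Type*} [MeasureSpace α] {f g : α → ℂ} (h : f =ᵐ[volume] g) :
    sqn f = sqn g := by
  unfold sqn
  refine lintegral_congr_ae ?_
  filter_upwards [h] with x hx
  rw [hx]

theorem aestronglyMeasurable_cf {f : ℝ × ℝ → ℂ} (hf : AEStronglyMeasurable f volume) (k : ℕ) :
    AEStronglyMeasurable (cf k f) volume := by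
  have : AEStronglyMeasurable (fun p : ℝ × ℝ => f p * ((Φh k p.2 : ℝ) : ℂ))
      ((volume : Measure ℝ).prod volume) := by
    rw [← Measure.volume_eq_prod]
    exact hf.mul (Complex.continuous_ofReal.comp
      ((continuous_Φh k).comp continuous_snd)).aestronglyMeasurable
  exact this.integral_prod_right'

theorem memLp_slice {f : ℝ × ℝ → ℂ} (hf : MemLp f 2) :
    ∀ᵐ x : ℝ, MemLp (fun y => f (x, y)) 2 (volume : Measure ℝ) := by
  have h1 : ∀ᵐ x : ℝ, AEStronglyMeasurable (fun y => f (x, y)) (volume : Measure ℝ) := by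
    have := hf.1
    rw [Measure.volume_eq_prod] at this
    exact this.prodMk_left
  have h2 : sqn f < ⊤ := (memLp_iff_sqn hf.1).1 hf
  unfold sqn at h2
  have hm : AEMeasurable (fun p : ℝ × ℝ => ‖f p‖ₑ ^ 2) ((volume : Measure ℝ).prod volume) := by
    rw [← Measure.volume_eq_prod]; exact (hf.1.enorm).pow_const 2
  rw [Measure.volume_eq_prod, lintegral_prod _ hm] at h2
  have h3 := ae_lt_top' (hm.lintegral_prod_right') h2.ne
  filter_upwards [h1, h3] with x hx1 hx2
  exact (memLp_iff_sqn hx1).2 hx2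

/-- Parseval identity for the partial Hermite expansion. -/
theorem tsum_sqn_cf {f : ℝ × ℝ → ℂ} (hf : MemLp f 2) : ∑' k, sqn (cf k f) = sqn f := by
  have hm : AEMeasurable (fun p : ℝ × ℝ => ‖f p‖ₑ ^ 2) ((volume : Measure ℝ).prod volume) := by
    rw [← Measure.volume_eq_prod]; exact (hf.1.enorm).pow_const 2
  unfold sqn
  rw [Measure.volume_eq_prod ℝ ℝ, lintegral_prod _ hm, ← lintegral_tsum]
  · refine lintegral_congr_ae ?_
    filter_upwards [memLp_slice hf] with x hx
    exact tsum_enorm_sq_integral_mul_Φh hx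
  · intro k
    exact (aestronglyMeasurable_cf hf.1 k).enorm.pow_const 2

theorem sqn_cf_le {f : ℝ × ℝ → ℂ} (hf : MemLp f 2) (k : ℕ) : sqn (cf k f) ≤ sqn f := by
  rw [← tsum_sqn_cf hf]; exact ENNReal.le_tsum k

theorem memLp_cf {f : ℝ × ℝ → ℂ} (hf : MemLp f 2) (k : ℕ) : MemLp (cf k f) 2 :=
  (memLp_iff_sqn (aestronglyMeasurable_cf hf.1 k)).2
    ((sqn_cf_le hf k).trans_lt ((memLp_iff_sqn hf.1).1 hf))

theorem cf_congr_ae {f g : ℝ × ℝ → ℂ} (h : f =ᵐ[volume] g) (k : ℕ) :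
    cf k f =ᵐ[volume] cf k g := by
  rw [Measure.volume_eq_prod] at h
  filter_upwards [Measure.ae_ae_of_ae_prod h] with x hx
  refine integral_congr_ae ?_
  filter_upwards [hx] with y hy
  rw [hy]

theorem cf_add_ae {f g : ℝ × ℝ → ℂ} (hf : MemLp f 2) (hg : MemLp g 2) (k : ℕ) :
    cf k (f + g) =ᵐ[volume] cf k f + cf k g := by
  filter_upwards [memLp_slice hf, memLp_slice hg] with x h1 h2
  simp only [cf, Pi.add_apply, add_mul]
  exact integral_add (h1.integrable_mul (memLp_Φh k)) (h2.integrable_mul (memLp_Φh k))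

theorem cf_smul (c : ℂ) (f : ℝ × ℝ → ℂ) (k : ℕ) : cf k (c • f) = c • cf k f := by
  ext x
  simp only [cf, Pi.smul_apply, smul_eq_mul, mul_assoc]
  exact integral_const_mul _ _

theorem norm_toLp_sq {α : Type*} [MeasureSpace α] {f : α → ℂ} (hf : MemLp f 2) :
    ENNReal.ofReal (‖hf.toLp f‖ ^ 2) = sqn f := by
  rw [Lp.norm_toLp, ENNReal.ofReal_pow ENNReal.toReal_nonneg, ENNReal.ofReal_toReal hf.2.ne,
    eLpNorm_sq]

/-- The Hermite coefficient as a bounded operator from `L²(ℝ²)` to `L²(ℝ)`. -/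
def cL (k : ℕ) : Lp ℂ 2 (volume : Measure (ℝ × ℝ)) →L[ℂ] Lp ℂ 2 (volume : Measure ℝ) :=
  LinearMap.mkContinuous
    { toFun := fun f => (memLp_cf (Lp.memLp f) k).toLp _
      map_add' := fun f g => by
        rw [← MemLp.toLp_add]
        refine MemLp.toLp_congr _ _ ?_
        exact (cf_congr_ae (Lp.coeFn_add f g) k).trans (cf_add_ae (Lp.memLp f) (Lp.memLp g) k)
      map_smul' := fun c f => by
        rw [RingHom.id_apply, ← MemLp.toLp_const_smul]
        refine MemLp.toLp_congr _ _ ?_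
        rw [← cf_smul]
        exact cf_congr_ae (Lp.coeFn_smul c f) k }
    1 (fun f => by
      rw [one_mul]
      refine abs_le_of_sq_le_sq' ?_ (norm_nonneg _) |>.2
      rw [← ENNReal.ofReal_le_ofReal_iff (by positivity)]
      have h := norm_toLp_sq (Lp.memLp f)
      rw [Lp.toLp_coeFn] at h
      rw [h]
      exact (norm_toLp_sq (memLp_cf (Lp.memLp f) k)).trans_le (sqn_cf_le (Lp.memLp f) k))

theorem cL_coeFn (k : ℕ) (F : Lp ℂ 2 (volume : Measure (ℝ × ℝ))) {f : ℝ × ℝ → ℂ}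
    (h : F =ᵐ[volume] f) : cL k F =ᵐ[volume] cf k f :=
  ((memLp_cf (Lp.memLp F) k).coeFn_toLp).trans (cf_congr_ae h k)

theorem sqn_add_le {α : Type*} [MeasureSpace α] (f g : α → ℂ) (hf : AEStronglyMeasurable f volume) :
    sqn (f + g) ≤ 2 * sqn f + 2 * sqn g := by
  unfold sqn
  rw [← lintegral_const_mul'' _ (hf.enorm.pow_const 2), ← lintegral_const_mul' _ _ (by simp),
    ← lintegral_add_left' ((hf.enorm.pow_const 2).const_mul _)]
  refine lintegral_mono fun x => ?_
  rw [Pi.add_apply]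
  calc ‖f x + g x‖ₑ ^ 2 ≤ (‖f x‖ₑ + ‖g x‖ₑ) ^ 2 := by gcongr; exact enorm_add_le _ _
    _ ≤ _ := by
      rw [enorm_eq_nnnorm, enorm_eq_nnnorm]
      norm_cast
      have := add_sq_le (a := (‖f x‖₊ : ℝ)) (b := (‖g x‖₊ : ℝ))
      rw [mul_add] at this
      exact_mod_cast this

theorem sqn_smul {α : Type*} [MeasureSpace α] (c : ℂ) (f : α → ℂ) :
    sqn (fun x => c * f x) = ‖c‖ₑ ^ 2 * sqn f := by
  unfold sqn
  rw [← lintegral_const_mul' _ _ (by simp)]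
  simp only [enorm_mul, mul_pow]

theorem sqn_mono {α : Type*} [MeasureSpace α] {f g : α → ℂ} (h : ∀ x, ‖f x‖ ≤ ‖g x‖) :
    sqn f ≤ sqn g := by
  unfold sqn
  refine lintegral_mono fun x => ?_
  gcongr
  exact enorm_le_iff_norm_le.2 (h x)

open scoped SchwartzMap LineDeriv

/-- Multiplication by `x`. -/
def mx : 𝓢(ℝ × ℝ, ℂ) →ₗ[ℂ] 𝓢(ℝ × ℝ, ℂ) :=
  (SchwartzMap.smulLeftCLM ℂ (fun p : ℝ × ℝ => (p.1 : ℂ))).toLinearMap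

/-- Multiplication by `y`. -/
def my : 𝓢(ℝ × ℝ, ℂ) →ₗ[ℂ] 𝓢(ℝ × ℝ, ℂ) :=
  (SchwartzMap.smulLeftCLM ℂ (fun p : ℝ × ℝ => (p.2 : ℂ))).toLinearMap

/-- The derivative `∂_x`. -/
def dx : 𝓢(ℝ × ℝ, ℂ) →ₗ[ℂ] 𝓢(ℝ × ℝ, ℂ) :=
  (LineDeriv.lineDerivOpCLM ℂ 𝓢(ℝ × ℝ, ℂ) ((1, 0) : ℝ × ℝ)).toLinearMap

/-- The derivative `∂_y`. -/
def dy : 𝓢(ℝ × ℝ, ℂ) →ₗ[ℂ] 𝓢(ℝ × ℝ, ℂ) :=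
  (LineDeriv.lineDerivOpCLM ℂ 𝓢(ℝ × ℝ, ℂ) ((0, 1) : ℝ × ℝ)).toLinearMap

theorem mx_apply (f : 𝓢(ℝ × ℝ, ℂ)) (p : ℝ × ℝ) : mx f p = (p.1 : ℂ) * f p := by
  refine SchwartzMap.smulLeftCLM_apply_apply ?_ f p
  exact (Complex.ofRealCLM.comp (ContinuousLinearMap.fst ℝ ℝ ℝ)).hasTemperateGrowth

theorem my_apply (f : 𝓢(ℝ × ℝ, ℂ)) (p : ℝ × ℝ) : my f p = (p.2 : ℂ) * f p := by
  refine SchwartzMap.smulLeftCLM_apply_apply ?_ f p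
  exact (Complex.ofRealCLM.comp (ContinuousLinearMap.snd ℝ ℝ ℝ)).hasTemperateGrowth

theorem dx_apply_eq (f : 𝓢(ℝ × ℝ, ℂ)) : dx f = ∂_{((1, 0) : ℝ × ℝ)} f := rfl

theorem dy_apply_eq (f : 𝓢(ℝ × ℝ, ℂ)) : dy f = ∂_{((0, 1) : ℝ × ℝ)} f := rfl

theorem hasDerivAt_fst (f : 𝓢(ℝ × ℝ, ℂ)) (x y : ℝ) :
    HasDerivAt (fun x' => f (x', y)) (dx f (x, y)) x := by
  rw [dx_apply_eq, SchwartzMap.lineDerivOp_apply_eq_fderiv]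
  have h := (SchwartzMap.hasFDerivAt f (x, y)).comp_hasDerivAt x
    ((hasDerivAt_id x).prodMk (hasDerivAt_const x y))
  exact h

theorem hasDerivAt_snd (f : 𝓢(ℝ × ℝ, ℂ)) (x y : ℝ) :
    HasDerivAt (fun y' => f (x, y')) (dy f (x, y)) y := by
  rw [dy_apply_eq, SchwartzMap.lineDerivOp_apply_eq_fderiv]
  have h := (SchwartzMap.hasFDerivAt f (x, y)).comp_hasDerivAt y
    ((hasDerivAt_const y x).prodMk (hasDerivAt_id y))
  exact h

theorem dx_eq_of_hasDerivAt {f g : 𝓢(ℝ × ℝ, ℂ)}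
    (h : ∀ x y, HasDerivAt (fun x' => f (x', y)) (g (x, y)) x) : dx f = g := by
  ext p
  exact (hasDerivAt_fst f p.1 p.2).unique (h p.1 p.2)

theorem dy_eq_of_hasDerivAt {f g : 𝓢(ℝ × ℝ, ℂ)}
    (h : ∀ x y, HasDerivAt (fun y' => f (x, y')) (g (x, y)) y) : dy f = g := by
  ext p
  exact (hasDerivAt_snd f p.1 p.2).unique (h p.1 p.2)

theorem dx_mx (f : 𝓢(ℝ × ℝ, ℂ)) : dx (mx f) = f + mx (dx f) := by
  refine dx_eq_of_hasDerivAt fun x y => ?_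
  have h := (Complex.ofRealCLM.hasDerivAt (x := x)).mul (hasDerivAt_fst f x y)
  simp only [mx_apply, add_apply]
  refine h.congr_deriv ?_
  simp

theorem dy_my (f : 𝓢(ℝ × ℝ, ℂ)) : dy (my f) = f + my (dy f) := by
  refine dy_eq_of_hasDerivAt fun x y => ?_
  have h := (Complex.ofRealCLM.hasDerivAt (x := y)).mul (hasDerivAt_snd f x y)
  simp only [my_apply, add_apply]
  refine h.congr_deriv ?_
  simp

theorem dx_my (f : 𝓢(ℝ × ℝ, ℂ)) : dx (my f) = my (dx f) := by
  refine dx_eq_of_hasDerivAt fun x y => ?_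
  simp only [my_apply]
  exact (hasDerivAt_fst f x y).const_mul _

theorem dy_mx (f : 𝓢(ℝ × ℝ, ℂ)) : dy (mx f) = mx (dy f) := by
  refine dy_eq_of_hasDerivAt fun x y => ?_
  simp only [mx_apply]
  exact (hasDerivAt_snd f x y).const_mul _

theorem mx_my (f : 𝓢(ℝ × ℝ, ℂ)) : mx (my f) = my (mx f) := by
  ext p; simp only [mx_apply, my_apply]; ring

theorem dx_dy (f : 𝓢(ℝ × ℝ, ℂ)) : dx (dy f) = dy (dx f) := by
  ext p
  have hf : ContDiff ℝ 2 f := f.smooth 2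
  have hsym : IsSymmSndFDerivAt ℝ f p :=
    hf.contDiffAt.isSymmSndFDerivAt (by simp)
  have key : ∀ v w : ℝ × ℝ, fderiv ℝ (⇑(∂_{w} f : 𝓢(ℝ × ℝ, ℂ))) p v =
      fderiv ℝ (fderiv ℝ f) p v w := by
    intro v w
    have e : (⇑(∂_{w} f : 𝓢(ℝ × ℝ, ℂ))) = fun q => fderiv ℝ f q w := by
      ext q; exact SchwartzMap.lineDerivOp_apply_eq_fderiv w f q
    rw [e]
    have hd : DifferentiableAt ℝ (fderiv ℝ f) p :=
      ((hf.fderiv_right (m := 1) (by norm_num)).differentiable (by norm_num)) p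
    rw [fderiv_clm_apply hd (differentiableAt_const w)]
    simp
  rw [dx_apply_eq, SchwartzMap.lineDerivOp_apply_eq_fderiv, dy_apply_eq, key, hsym.eq, ← key,
    dy_apply_eq, SchwartzMap.lineDerivOp_apply_eq_fderiv, dx_apply_eq]

/-- The normally ordered operator `x^a ∂_x^b y^α ∂_y^β`, with `q = (a, b, α, β)`. -/
def mono (q : ℕ × ℕ × ℕ × ℕ) : 𝓢(ℝ × ℝ, ℂ) →ₗ[ℂ] 𝓢(ℝ × ℝ, ℂ) :=
  mx ^ q.1 * my ^ q.2.2.1 * dx ^ q.2.1 * dy ^ q.2.2.2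

/-- Total order of a multi-index. -/
def tot (q : ℕ × ℕ × ℕ × ℕ) : ℕ := q.1 + q.2.1 + q.2.2.1 + q.2.2.2

theorem commute_mx_my : Commute mx my := LinearMap.ext mx_my

theorem commute_dx_dy : Commute dx dy := LinearMap.ext dx_dy

theorem commute_dx_my : Commute dx my := LinearMap.ext dx_my

theorem commute_dy_mx : Commute dy mx := LinearMap.ext dy_mx

theorem dx_mul_mx_pow (a : ℕ) : dx * mx ^ a = (a : ℂ) • mx ^ (a - 1) + mx ^ a * dx := by
  have h1 : dx * mx = 1 + mx * dx := LinearMap.ext dx_mx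
  induction a with
  | zero => simp
  | succ a ih =>
    rw [pow_succ', ← mul_assoc, h1, add_mul, one_mul, mul_assoc, ih, mul_add, Nat.add_sub_cancel]
    cases a with
    | zero => simp
    | succ a =>
      rw [Nat.add_sub_cancel, mul_smul_comm, ← pow_succ', ← add_assoc, ← mul_assoc, ← pow_succ']
      push_cast
      simp only [add_smul, one_smul]
      abel

theorem dy_mul_my_pow (a : ℕ) : dy * my ^ a = (a : ℂ) • my ^ (a - 1) + my ^ a * dy := by
  have h1 : dy * my = 1 + my * dy := LinearMap.ext dy_my
  induction a with
  | zero => simp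
  | succ a ih =>
    rw [pow_succ', ← mul_assoc, h1, add_mul, one_mul, mul_assoc, ih, mul_add, Nat.add_sub_cancel]
    cases a with
    | zero => simp
    | succ a =>
      rw [Nat.add_sub_cancel, mul_smul_comm, ← pow_succ', ← add_assoc, ← mul_assoc, ← pow_succ']
      push_cast
      simp only [add_smul, one_smul]
      abel

theorem mx_mul_mono (a b α β : ℕ) : mx * mono (a, b, α, β) = mono (a + 1, b, α, β) := by
  simp only [mono, pow_succ', mul_assoc]

theorem my_mul_mono (a b α β : ℕ) : my * mono (a, b, α, β) = mono (a, b, α + 1, β) := by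
  simp only [mono]
  rw [← mul_assoc, ← mul_assoc, ← mul_assoc, ((commute_mx_my.pow_left a).symm).eq, pow_succ',
    mul_assoc (mx ^ a)]

theorem dx_mul_mono (a b α β : ℕ) :
    dx * mono (a, b, α, β) = (a : ℂ) • mono (a - 1, b, α, β) + mono (a, b + 1, α, β) := by
  simp only [mono]
  rw [← mul_assoc, ← mul_assoc, ← mul_assoc, dx_mul_mx_pow]
  simp only [add_mul, smul_mul_assoc]
  congr 1
  rw [mul_assoc (mx ^ a) dx, (commute_dx_my.pow_right α).eq, pow_succ']
  simp only [mul_assoc]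

theorem dy_mul_mono (a b α β : ℕ) :
    dy * mono (a, b, α, β) = (α : ℂ) • mono (a, b, α - 1, β) + mono (a, b, α, β + 1) := by
  simp only [mono]
  rw [← mul_assoc, ← mul_assoc, ← mul_assoc, (commute_dy_mx.pow_right a).eq, mul_assoc (mx ^ a),
    dy_mul_my_pow]
  simp only [add_mul, mul_add, smul_mul_assoc, mul_smul_comm, mul_assoc]
  congr 1
  rw [← mul_assoc dy, ((commute_dx_dy.pow_left b).symm).eq, pow_succ', mul_assoc]

theorem mono_apply (q : ℕ × ℕ × ℕ × ℕ) (u : 𝓢(ℝ × ℝ, ℂ)) (p : ℝ × ℝ) :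
    mono q u p = (p.1 : ℂ) ^ q.1 * (p.2 : ℂ) ^ q.2.2.1 * ((dx ^ q.2.1) ((dy ^ q.2.2.2) u)) p := by
  have hx : ∀ (a : ℕ) (f : 𝓢(ℝ × ℝ, ℂ)), (mx ^ a) f p = (p.1 : ℂ) ^ a * f p := by
    intro a
    induction a with
    | zero => intro f; simp
    | succ a ih =>
      intro f; rw [pow_succ', Module.End.mul_apply, mx_apply, ih]; ring
  have hy : ∀ (a : ℕ) (f : 𝓢(ℝ × ℝ, ℂ)), (my ^ a) f p = (p.2 : ℂ) ^ a * f p := by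
    intro a
    induction a with
    | zero => intro f; simp
    | succ a ih =>
      intro f; rw [pow_succ', Module.End.mul_apply, my_apply, ih]; ring
  simp only [mono, Module.End.mul_apply]
  rw [hx, hy, mul_assoc]

/-- Curried form of a Schwartz function. -/
def cur (u : 𝓢(ℝ × ℝ, ℂ)) : ℝ → ℝ → ℂ := fun x y => u (x, y)

theorem iteratedDeriv_snd (β : ℕ) (u : 𝓢(ℝ × ℝ, ℂ)) (x : ℝ) :
    iteratedDeriv β (fun y => u (x, y)) = fun y => (dy ^ β) u (x, y) := by
  induction β with
  | zero => simp
  | succ β ih =>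
    rw [iteratedDeriv_succ, ih]
    ext y
    rw [pow_succ', Module.End.mul_apply]
    exact (hasDerivAt_snd _ x y).deriv

theorem iteratedDeriv_fst (b : ℕ) (u : 𝓢(ℝ × ℝ, ℂ)) (y : ℝ) :
    iteratedDeriv b (fun x => u (x, y)) = fun x => (dx ^ b) u (x, y) := by
  induction b with
  | zero => simp
  | succ b ih =>
    rw [iteratedDeriv_succ, ih]
    ext x
    rw [pow_succ', Module.End.mul_apply]
    exact (hasDerivAt_fst _ x y).deriv

theorem pd2_cur (b β : ℕ) (u : 𝓢(ℝ × ℝ, ℂ)) (x y : ℝ) :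
    pd2 b β (cur u) x y = (dx ^ b) ((dy ^ β) u) (x, y) := by
  have h : ∀ x', iteratedDeriv β (fun y' => cur u x' y') y = (dy ^ β) u (x', y) := by
    intro x'
    exact congrFun (iteratedDeriv_snd β u x') y
  simp only [pd2, h]
  exact congrFun (iteratedDeriv_fst b _ y) x

theorem wD_cur (a b α β : ℕ) (u : 𝓢(ℝ × ℝ, ℂ)) (x y : ℝ) :
    wD a b α β (cur u) x y = mono (a, b, α, β) u (x, y) := by
  rw [wD, pd2_cur, mono_apply]

/-- The multi-indices of total order at most `m`. -/
def idx (m : ℕ) : Finset (ℕ × ℕ × ℕ × ℕ) :=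
  Finset.filter (fun q : ℕ × ℕ × ℕ × ℕ => q.1 + q.2.1 + q.2.2.1 + q.2.2.2 ≤ m)
    (Finset.range (m+1) ×ˢ Finset.range (m+1) ×ˢ Finset.range (m+1) ×ˢ Finset.range (m+1))

theorem mem_idx {m : ℕ} {q : ℕ × ℕ × ℕ × ℕ} : q ∈ idx m ↔ tot q ≤ m := by
  simp only [idx, tot, Finset.mem_filter, Finset.mem_product, Finset.mem_range]
  omega

/-- `L²` norm of a Schwartz function. -/
def nL (f : 𝓢(ℝ × ℝ, ℂ)) : ℝ := (eLpNorm f 2 volume).toReal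

theorem NN_cur (m : ℕ) (u : 𝓢(ℝ × ℝ, ℂ)) : NN m (cur u) = ∑ q ∈ idx m, nL (mono q u) := by
  unfold NN idx L2 nL
  refine Finset.sum_congr rfl fun q _ => ?_
  congr 2
  ext p
  exact wD_cur _ _ _ _ u p.1 p.2

/-- Schwartz function associated with a function satisfying the Schwartz predicate. -/
def toS {f : ℝ → ℝ → ℂ} (hf : IsSchwartz2 f) : 𝓢(ℝ × ℝ, ℂ) where
  toFun := unc f
  smooth' := hf.1
  decay' := hf.2

theorem cur_toS {f : ℝ → ℝ → ℂ} (hf : IsSchwartz2 f) : cur (toS hf) = f := rfl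

/-- Operators that are combinations of normally ordered operators of total order at most `m`. -/
def W (m : ℕ) : Submodule ℂ (Module.End ℂ 𝓢(ℝ × ℝ, ℂ)) :=
  Submodule.span ℂ (mono '' {q | tot q ≤ m})

theorem mono_mem_W {q : ℕ × ℕ × ℕ × ℕ} {m : ℕ} (h : tot q ≤ m) : mono q ∈ W m :=
  Submodule.subset_span ⟨q, h, rfl⟩

theorem W_mono {m n : ℕ} (h : m ≤ n) : W m ≤ W n :=
  Submodule.span_mono (Set.image_mono fun _ hq => le_trans hq h)

theorem one_mem_W (m : ℕ) : 1 ∈ W m := by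
  have : mono (0, 0, 0, 0) ∈ W m := mono_mem_W (by simp [tot])
  simpa [mono] using this

theorem mul_mem_W {A : Module.End ℂ 𝓢(ℝ × ℝ, ℂ)} {m n : ℕ}
    (h : ∀ q, tot q ≤ m → A * mono q ∈ W n) {T : Module.End ℂ 𝓢(ℝ × ℝ, ℂ)} (hT : T ∈ W m) :
    A * T ∈ W n := by
  induction hT using Submodule.span_induction with
  | mem T hT => obtain ⟨q, hq, rfl⟩ := hT; exact h q hq
  | zero => simp
  | add S T _ _ hS hT => rw [mul_add]; exact add_mem hS hT
  | smul c T _ hT => rw [mul_smul_comm]; exact Submodule.smul_mem _ _ hT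

theorem mx_mul_mem_W {T : Module.End ℂ 𝓢(ℝ × ℝ, ℂ)} {m : ℕ} (hT : T ∈ W m) :
    mx * T ∈ W (m + 1) := by
  refine mul_mem_W (fun q hq => ?_) hT
  obtain ⟨a, b, α, β⟩ := q
  rw [mx_mul_mono]
  exact mono_mem_W (by simp only [tot] at hq ⊢; omega)

theorem my_mul_mem_W {T : Module.End ℂ 𝓢(ℝ × ℝ, ℂ)} {m : ℕ} (hT : T ∈ W m) :
    my * T ∈ W (m + 1) := by
  refine mul_mem_W (fun q hq => ?_) hT
  obtain ⟨a, b, α, β⟩ := q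
  rw [my_mul_mono]
  exact mono_mem_W (by simp only [tot] at hq ⊢; omega)

theorem dx_mul_mem_W {T : Module.End ℂ 𝓢(ℝ × ℝ, ℂ)} {m : ℕ} (hT : T ∈ W m) :
    dx * T ∈ W (m + 1) := by
  refine mul_mem_W (fun q hq => ?_) hT
  obtain ⟨a, b, α, β⟩ := q
  rw [dx_mul_mono]
  exact add_mem (Submodule.smul_mem _ _ (mono_mem_W (by simp only [tot] at hq ⊢; omega)))
    (mono_mem_W (by simp only [tot] at hq ⊢; omega))

theorem dy_mul_mem_W {T : Module.End ℂ 𝓢(ℝ × ℝ, ℂ)} {m : ℕ} (hT : T ∈ W m) :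
    dy * T ∈ W (m + 1) := by
  refine mul_mem_W (fun q hq => ?_) hT
  obtain ⟨a, b, α, β⟩ := q
  rw [dy_mul_mono]
  exact add_mem (Submodule.smul_mem _ _ (mono_mem_W (by simp only [tot] at hq ⊢; omega)))
    (mono_mem_W (by simp only [tot] at hq ⊢; omega))

/-- The ladder operator `y + ∂_y`. -/
def bop : Module.End ℂ 𝓢(ℝ × ℝ, ℂ) := my + dy

theorem bop_pow_mul_mem_W {T : Module.End ℂ 𝓢(ℝ × ℝ, ℂ)} {m : ℕ} (hT : T ∈ W m) (l : ℕ) :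
    bop ^ l * T ∈ W (m + l) := by
  induction l with
  | zero => simpa using hT
  | succ l ih =>
    rw [pow_succ', mul_assoc, bop, add_mul]
    exact add_mem (my_mul_mem_W ih) (dy_mul_mem_W ih)

/-- Pointwise sum of all normally ordered monomials of order at most `m`. -/
def Pt (m : ℕ) (u : 𝓢(ℝ × ℝ, ℂ)) (p : ℝ × ℝ) : ℝ := ∑ q ∈ idx m, ‖mono q u p‖

theorem Pt_nonneg (m : ℕ) (u : 𝓢(ℝ × ℝ, ℂ)) (p : ℝ × ℝ) : 0 ≤ Pt m u p :=
  Finset.sum_nonneg fun _ _ => norm_nonneg _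

theorem norm_mono_le_Pt {q : ℕ × ℕ × ℕ × ℕ} {m : ℕ} (h : tot q ≤ m) (u : 𝓢(ℝ × ℝ, ℂ))
    (p : ℝ × ℝ) : ‖mono q u p‖ ≤ Pt m u p :=
  Finset.single_le_sum (f := fun q => ‖mono q u p‖) (fun _ _ => norm_nonneg _) (mem_idx.2 h)

theorem idx_mono {m n : ℕ} (h : m ≤ n) : idx m ⊆ idx n := fun _ hq =>
  mem_idx.2 ((mem_idx.1 hq).trans h)

theorem Pt_mono {m n : ℕ} (h : m ≤ n) (u : 𝓢(ℝ × ℝ, ℂ)) (p : ℝ × ℝ) : Pt m u p ≤ Pt n u p :=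
  Finset.sum_le_sum_of_subset_of_nonneg (idx_mono h) fun _ _ _ => norm_nonneg _

theorem exists_bound_of_mem_W {T : Module.End ℂ 𝓢(ℝ × ℝ, ℂ)} {m : ℕ} (hT : T ∈ W m) :
    ∃ C : ℝ, 0 ≤ C ∧ ∀ (u : 𝓢(ℝ × ℝ, ℂ)) (p : ℝ × ℝ), ‖T u p‖ ≤ C * Pt m u p := by
  induction hT using Submodule.span_induction with
  | mem T hT =>
    obtain ⟨q, hq, rfl⟩ := hT
    exact ⟨1, zero_le_one, fun u p => by rw [one_mul]; exact norm_mono_le_Pt hq u p⟩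
  | zero => exact ⟨0, le_rfl, fun u p => by simp⟩
  | add S T _ _ hS hT =>
    obtain ⟨C, hC0, hC⟩ := hS
    obtain ⟨D, hD0, hD⟩ := hT
    refine ⟨C + D, add_nonneg hC0 hD0, fun u p => ?_⟩
    rw [add_mul]
    exact (norm_add_le _ _).trans (add_le_add (hC u p) (hD u p))
  | smul c T _ hT =>
    obtain ⟨C, hC0, hC⟩ := hT
    refine ⟨‖c‖ * C, by positivity, fun u p => ?_⟩
    rw [mul_assoc]
    exact (norm_smul_le c (T u p)).trans (mul_le_mul_of_nonneg_left (hC u p) (norm_nonneg c))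

theorem nL_nonneg (f : 𝓢(ℝ × ℝ, ℂ)) : 0 ≤ nL f := ENNReal.toReal_nonneg

theorem NN_nonneg (m : ℕ) (u : 𝓢(ℝ × ℝ, ℂ)) : 0 ≤ NN m (cur u) := by
  rw [NN_cur]; exact Finset.sum_nonneg fun _ _ => nL_nonneg _

theorem memLp_two (f : 𝓢(ℝ × ℝ, ℂ)) : MemLp f 2 volume := f.memLp 2 volume

theorem eLpNorm_eq_ofReal_nL (f : 𝓢(ℝ × ℝ, ℂ)) :
    eLpNorm f 2 volume = ENNReal.ofReal (nL f) := by
  rw [nL, ENNReal.ofReal_toReal]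
  exact (memLp_two f).2.ne

theorem eLpNorm_Pt_le (m : ℕ) (u : 𝓢(ℝ × ℝ, ℂ)) :
    eLpNorm (Pt m u) 2 volume ≤ ENNReal.ofReal (NN m (cur u)) := by
  have e : Pt m u = ∑ q ∈ idx m, fun p => ‖mono q u p‖ := by
    ext p; rw [Finset.sum_apply]; rfl
  have h : ∀ q ∈ idx m, AEStronglyMeasurable (fun p => ‖mono q u p‖) volume :=
    fun q _ => ((mono q u).continuous.norm).aestronglyMeasurable
  have h2 := eLpNorm_sum_le h (p := 2) (by norm_num)
  rw [e, NN_cur, ENNReal.ofReal_sum_of_nonneg fun _ _ => nL_nonneg _]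
  refine h2.trans (Finset.sum_le_sum fun q _ => ?_)
  rw [← eLpNorm_eq_ofReal_nL]
  exact (eLpNorm_norm _).le

theorem eLpNorm_le_of_le_Pt {f : ℝ × ℝ → ℂ} {C : ℝ} {m : ℕ} {u : 𝓢(ℝ × ℝ, ℂ)} (hC : 0 ≤ C)
    (h : ∀ᵐ p, ‖f p‖ ≤ C * Pt m u p) :
    eLpNorm f 2 volume ≤ ENNReal.ofReal (C * NN m (cur u)) := by
  refine (eLpNorm_le_mul_eLpNorm_of_ae_le_mul (g := Pt m u) (c := C) ?_ 2).trans ?_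
  · filter_upwards [h] with p hp
    rwa [Real.norm_of_nonneg (Pt_nonneg _ _ _)]
  · rw [ENNReal.ofReal_mul hC]
    gcongr
    exact eLpNorm_Pt_le m u

theorem sqn_le_of_le_Pt {f : ℝ × ℝ → ℂ} {C : ℝ} {m : ℕ} {u : 𝓢(ℝ × ℝ, ℂ)} (hC : 0 ≤ C)
    (h : ∀ p, ‖f p‖ ≤ C * Pt m u p) :
    sqn f ≤ ENNReal.ofReal ((C * NN m (cur u)) ^ 2) := by
  rw [← eLpNorm_sq, ENNReal.ofReal_pow (mul_nonneg hC (NN_nonneg m u))]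
  gcongr
  exact eLpNorm_le_of_le_Pt hC (Filter.Eventually.of_forall h)

theorem memLp_of_le_Pt {f : ℝ × ℝ → ℂ} {C : ℝ} {m : ℕ} {u : 𝓢(ℝ × ℝ, ℂ)} (hC : 0 ≤ C)
    (hf : AEStronglyMeasurable f volume) (h : ∀ p, ‖f p‖ ≤ C * Pt m u p) : MemLp f 2 :=
  ⟨hf, (eLpNorm_le_of_le_Pt hC (Filter.Eventually.of_forall h)).trans_lt ENNReal.ofReal_lt_top⟩

theorem integral_inner_I_mul_dx_dy (f : 𝓢(ℝ × ℝ, ℂ)) :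
    ∫ p, inner ℝ (f p) (Complex.I * dx (dy f) p) = 0 := by
  have h1 := SchwartzMap.integral_bilinear_lineDerivOp_right_eq_neg_left (μ := volume) f (Complex.I • dy f)
    (innerSL ℝ : ℂ →L[ℝ] ℂ →L[ℝ] ℝ) ((1, 0) : ℝ × ℝ)
  have h2 := SchwartzMap.integral_bilinear_lineDerivOp_right_eq_neg_left (μ := volume) f (Complex.I • dx f)
    (innerSL ℝ : ℂ →L[ℝ] ℂ →L[ℝ] ℝ) ((0, 1) : ℝ × ℝ)
  have e1 : ∂_{((1, 0) : ℝ × ℝ)} (Complex.I • dy f) = Complex.I • dx (dy f) := by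
    rw [← dx_apply_eq, map_smul]
  have e2 : ∂_{((0, 1) : ℝ × ℝ)} (Complex.I • dx f) = Complex.I • dx (dy f) := by
    rw [← dy_apply_eq, map_smul, dx_dy]
  rw [e1, ← dx_apply_eq] at h1
  rw [e2, ← dy_apply_eq] at h2
  have e3 : ∀ p, (innerSL ℝ : ℂ →L[ℝ] ℂ →L[ℝ] ℝ) (dx f p) ((Complex.I • dy f) p) =
      -(innerSL ℝ : ℂ →L[ℝ] ℂ →L[ℝ] ℝ) (dy f p) ((Complex.I • dx f) p) := by
    intro p
    simp [Complex.inner]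
    ring
  have h3 : ∫ p, (innerSL ℝ : ℂ →L[ℝ] ℂ →L[ℝ] ℝ) (dx f p) ((Complex.I • dy f) p) =
      -∫ p, (innerSL ℝ : ℂ →L[ℝ] ℂ →L[ℝ] ℝ) (dy f p) ((Complex.I • dx f) p) := by
    rw [← integral_neg]; exact integral_congr_ae (Filter.Eventually.of_forall e3)
  have h4 : ∀ p, (innerSL ℝ : ℂ →L[ℝ] ℂ →L[ℝ] ℝ) (f p) ((Complex.I • dx (dy f)) p) =
    inner ℝ (f p) (Complex.I * dx (dy f) p) := fun p => rfl
  simp only [h4] at h1 h2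
  linarith

/-- `V` is of class `C^L`, and `|V'(0)|`, `|V''|`, …, `|V^(L)|` are bounded by `B`. -/
structure PotBound (L : ℕ) (B : ℝ) (V : ℝ → ℝ) : Prop where
  three_le : 3 ≤ L
  nonneg : 0 ≤ B
  contDiff : ContDiff ℝ L V
  deriv_zero : |deriv V 0| ≤ B
  bound : ∀ n, 2 ≤ n → n ≤ L → ∀ x, |iteratedDeriv n V x| ≤ B

/-- The mixed derivatives `∂_x^i ∂_y^j` of `(V(x + ħy/2) - V(x - ħy/2)) / ħ`. -/
def Fd (h : ℝ) (V : ℝ → ℝ) (i j : ℕ) (x y : ℝ) : ℝ :=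
  (h / 2) ^ j * (iteratedDeriv (i + j) V (x + h * y / 2) -
    (-1) ^ j * iteratedDeriv (i + j) V (x - h * y / 2)) / h

theorem Fd_zero_zero (h : ℝ) (V : ℝ → ℝ) (x y : ℝ) :
    Fd h V 0 0 x y = (V (x + h * y / 2) - V (x - h * y / 2)) / h := by
  simp [Fd]

section
variable {L : ℕ} {B : ℝ} {V : ℝ → ℝ} {h : ℝ}

theorem PotBound.hasDerivAt_iteratedDeriv (hV : PotBound L B V) {n : ℕ} (hn : n < L) (x : ℝ) :
    HasDerivAt (iteratedDeriv n V) (iteratedDeriv (n + 1) V x) x := by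
  have h1 := hV.contDiff.differentiable_iteratedDeriv n (by exact_mod_cast hn)
  rw [iteratedDeriv_succ]
  exact (h1 x).hasDerivAt

theorem PotBound.continuous_iteratedDeriv (hV : PotBound L B V) {n : ℕ} (hn : n ≤ L) :
    Continuous (iteratedDeriv n V) :=
  hV.contDiff.continuous_iteratedDeriv n (by exact_mod_cast hn)

theorem PotBound.hasDerivAt_Fd_x (hV : PotBound L B V) {i j : ℕ} (hij : i + j < L) (x y : ℝ) :
    HasDerivAt (fun x' => Fd h V i j x' y) (Fd h V (i + 1) j x y) x := by
  have h1 := (hV.hasDerivAt_iteratedDeriv hij (x + h * y / 2)).comp x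
    ((hasDerivAt_id x).add_const (h * y / 2))
  have h2 := (hV.hasDerivAt_iteratedDeriv hij (x - h * y / 2)).comp x
    ((hasDerivAt_id x).sub_const (h * y / 2))
  refine HasDerivAt.congr_deriv
    (((h1.sub (h2.const_mul ((-1 : ℝ) ^ j))).const_mul ((h / 2) ^ j)).div_const h) ?_
  simp [Fd, add_right_comm i 1 j]

theorem PotBound.hasDerivAt_Fd_y (hV : PotBound L B V) {i j : ℕ} (hij : i + j < L) (x y : ℝ) :
    HasDerivAt (fun y' => Fd h V i j x y') (Fd h V i (j + 1) x y) y := by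
  have e1 : HasDerivAt (fun y' => x + h * y' / 2) (h / 2) y := by
    simpa using (((hasDerivAt_id y).const_mul h).div_const 2).const_add x
  have e2 : HasDerivAt (fun y' => x - h * y' / 2) (-(h / 2)) y := by
    simpa using (((hasDerivAt_id y).const_mul h).div_const 2).const_sub x
  have h1 := (hV.hasDerivAt_iteratedDeriv hij (x + h * y / 2)).comp y e1
  have h2 := (hV.hasDerivAt_iteratedDeriv hij (x - h * y / 2)).comp y e2
  refine HasDerivAt.congr_deriv
    (((h1.sub (h2.const_mul ((-1 : ℝ) ^ j))).const_mul ((h / 2) ^ j)).div_const h) ?_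
  simp only [Fd, ← add_assoc]
  ring

theorem PotBound.continuous_Fd (hV : PotBound L B V) {i j : ℕ} (hij : i + j ≤ L) :
    Continuous (fun p : ℝ × ℝ => Fd h V i j p.1 p.2) := by
  have h1 := hV.continuous_iteratedDeriv hij
  unfold Fd
  fun_prop

theorem PotBound.abs_sub_le (hV : PotBound L B V) {n : ℕ} (h1 : 1 ≤ n) (hn : n < L) (x y : ℝ) :
    |iteratedDeriv n V x - iteratedDeriv n V y| ≤ B * |x - y| := by
  have := Convex.norm_image_sub_le_of_norm_hasDerivWithin_le (f := iteratedDeriv n V)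
    (f' := iteratedDeriv (n + 1) V) (s := Set.univ) (C := B) (x := y) (y := x)
    (fun z _ => (hV.hasDerivAt_iteratedDeriv hn z).hasDerivWithinAt)
    (fun z _ => hV.bound (n + 1) (by omega) (by omega) z) convex_univ trivial trivial
  simpa using this

theorem PotBound.abs_deriv_le (hV : PotBound L B V) (x : ℝ) : |deriv V x| ≤ B * (1 + |x|) := by
  have h1 := hV.abs_sub_le le_rfl (by have := hV.three_le; omega) x 0
  rw [iteratedDeriv_one, sub_zero] at h1
  have h2 := hV.deriv_zero
  have h3 := abs_sub_abs_le_abs_sub (deriv V x) (deriv V 0)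
  linarith

theorem abs_Fd_le_of_odd (h0 : 0 < h) (h1 : h ≤ 1) {i j : ℕ} (hj : Odd j) {x y A A' : ℝ}
    (hA : |iteratedDeriv (i + j) V (x + h * y / 2)| ≤ A)
    (hA' : |iteratedDeriv (i + j) V (x - h * y / 2)| ≤ A') :
    |Fd h V i j x y| ≤ (A + A') / 2 := by
  obtain ⟨k, rfl⟩ := hj
  have h3 : Fd h V i (2 * k + 1) x y = (h / 2) ^ (2 * k) *
      ((iteratedDeriv (i + (2 * k + 1)) V (x + h * y / 2) +
        iteratedDeriv (i + (2 * k + 1)) V (x - h * y / 2)) / 2) := by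
    rw [Fd, pow_succ (-1 : ℝ), pow_mul (-1 : ℝ)]
    field_simp
    ring
  rw [h3, abs_mul, abs_of_nonneg (by positivity), abs_div, abs_two]
  have h4 : (h / 2) ^ (2 * k) ≤ 1 := pow_le_one₀ (by positivity) (by linarith)
  refine (mul_le_of_le_one_left (by positivity) h4).trans ?_
  gcongr
  exact (abs_add_le _ _).trans (add_le_add hA hA')

theorem PotBound.abs_Fd_le (hV : PotBound L B V) (h0 : 0 < h) (h1 : h ≤ 1) {i j : ℕ}
    (hij : 1 ≤ i + j) (hL : i + j < L) (x y : ℝ) :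
    |Fd h V i j x y| ≤ B * (1 + |x| + |y|) := by
  have hB := hV.nonneg
  have hx := abs_nonneg x
  have hy := abs_nonneg y
  rcases Nat.even_or_odd j with hj | hj
  · have h2 := hV.abs_sub_le hij hL (x + h * y / 2) (x - h * y / 2)
    have e : x + h * y / 2 - (x - h * y / 2) = h * y := by ring
    rw [e, abs_mul, abs_of_pos h0] at h2
    rw [Fd, hj.neg_one_pow, one_mul, abs_div, abs_mul, abs_of_pos h0,
      abs_of_nonneg (by positivity : 0 ≤ (h / 2) ^ j), div_le_iff₀ h0]
    have h4 : (h / 2) ^ j ≤ 1 := pow_le_one₀ (by positivity) (by linarith)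
    refine (mul_le_of_le_one_left (by positivity) h4).trans (h2.trans ?_)
    have : 0 ≤ B * h * (1 + |x|) := by positivity
    nlinarith
  · have h5 : ∀ z, |iteratedDeriv (i + j) V z| ≤ B * (1 + |z|) := by
      intro z
      rcases Nat.lt_or_ge 1 (i + j) with h6 | h6
      · have := hV.bound (i + j) h6 hL.le z
        have : 0 ≤ B * |z| := by positivity
        linarith [hV.bound (i + j) h6 hL.le z]
      · rw [le_antisymm h6 hij, iteratedDeriv_one]
        exact hV.abs_deriv_le z
    refine (abs_Fd_le_of_odd h0 h1 hj (h5 _) (h5 _)).trans ?_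
    have h7 : |h * y / 2| ≤ |y| := by
      rw [abs_div, abs_mul, abs_of_pos h0, abs_two]
      nlinarith
    have h8 := abs_add_le x (h * y / 2)
    have h9 := abs_sub x (h * y / 2)
    have : 0 ≤ B := hB
    rw [← mul_add, mul_div_assoc]
    gcongr
    linarith

/-- The derivatives `∂_y^i` of the quantum correction `ℰ^ħ`. -/
def Ed (h : ℝ) (V : ℝ → ℝ) : ℕ → ℝ → ℝ → ℝ
  | 0 => Eh h V
  | 1 => fun x y => Fd h V 0 1 x y - deriv V x
  | i + 2 => Fd h V 0 (i + 2)

theorem PotBound.hasDerivAt_Ed (hV : PotBound L B V) {i : ℕ} (hi : i < L) (x y : ℝ) :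
    HasDerivAt (fun y' => Ed h V i x y') (Ed h V (i + 1) x y) y := by
  match i with
  | 0 =>
    have h1 := (hV.hasDerivAt_Fd_y (h := h) (i := 0) (j := 0) hi x y).sub
      ((hasDerivAt_id y).const_mul (deriv V x))
    simp only [Fd_zero_zero, mul_one] at h1
    exact h1
  | 1 => exact (hV.hasDerivAt_Fd_y (h := h) (i := 0) (j := 1) hi x y).sub_const _
  | i + 2 => exact hV.hasDerivAt_Fd_y (h := h) (i := 0) (j := i + 2) (by omega) x y

theorem PotBound.continuous_deriv (hV : PotBound L B V) : Continuous (deriv V) := by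
  rw [← iteratedDeriv_one]
  exact hV.continuous_iteratedDeriv (by have := hV.three_le; omega)

theorem PotBound.continuous_Ed (hV : PotBound L B V) {i : ℕ} (hi : i ≤ L) :
    Continuous (fun p : ℝ × ℝ => Ed h V i p.1 p.2) := by
  have h2 := hV.continuous_deriv
  match i with
  | 0 =>
    have h1 := hV.contDiff.continuous
    simp only [Ed, Eh]
    fun_prop
  | 1 => exact (hV.continuous_Fd (i := 0) (j := 1) hi).sub (h2.comp continuous_fst)
  | i + 2 => exact hV.continuous_Fd (i := 0) (j := i + 2) (by omega)

theorem Ed_one_eq (h0 : 0 < h) (x y : ℝ) : Ed h V 1 x y =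
    (deriv V (x + h * y / 2) - deriv V x + (deriv V (x - h * y / 2) - deriv V x)) / 2 := by
  simp only [Ed, Fd, zero_add, pow_one, iteratedDeriv_one]
  field_simp
  ring

theorem PotBound.abs_Ed_one_le (hV : PotBound L B V) (h0 : 0 < h) (x y : ℝ) :
    |Ed h V 1 x y| ≤ B * h * |y| := by
  have h2 := hV.abs_sub_le le_rfl (by have := hV.three_le; omega) (x + h * y / 2) x
  have h3 := hV.abs_sub_le le_rfl (by have := hV.three_le; omega) (x - h * y / 2) x
  have e1 : |x + h * y / 2 - x| = h * |y| / 2 := by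
    rw [add_sub_cancel_left, abs_div, abs_mul, abs_of_pos h0, abs_two]
  have e2 : |x - h * y / 2 - x| = h * |y| / 2 := by
    rw [sub_sub_cancel_left, abs_neg, abs_div, abs_mul, abs_of_pos h0, abs_two]
  rw [e1, iteratedDeriv_one] at h2
  rw [e2, iteratedDeriv_one] at h3
  rw [Ed_one_eq h0, abs_div, abs_two]
  have h4 := abs_add_le (deriv V (x + h * y / 2) - deriv V x) (deriv V (x - h * y / 2) - deriv V x)
  have : 0 ≤ B * (h * |y|) := by have := hV.nonneg; positivity
  linarith

theorem Eh_zero (h : ℝ) (V : ℝ → ℝ) (x : ℝ) : Eh h V x 0 = 0 := by simp [Eh]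

theorem PotBound.abs_Eh_le (hV : PotBound L B V) (h0 : 0 < h) (x y : ℝ) :
    |Eh h V x y| ≤ B * h * y ^ 2 := by
  have h1 := Convex.norm_image_sub_le_of_norm_hasDerivWithin_le (f := Eh h V x)
    (f' := Ed h V 1 x) (s := Set.Icc (-|y|) |y|) (C := B * h * |y|) (x := 0) (y := y)
    (fun z _ => (hV.hasDerivAt_Ed (i := 0) (by have := hV.three_le; omega) x z).hasDerivWithinAt)
    (fun z hz => (hV.abs_Ed_one_le h0 x z).trans
      (mul_le_mul_of_nonneg_left (abs_le.2 hz) (mul_nonneg hV.nonneg h0.le)))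
    (convex_Icc _ _) (by simp) (abs_le.1 le_rfl)
  rw [Eh_zero, sub_zero, sub_zero, Real.norm_eq_abs, Real.norm_eq_abs, mul_assoc,
    ← abs_mul, ← sq, abs_of_nonneg (sq_nonneg y)] at h1
  exact h1

theorem PotBound.abs_Ed_le (hV : PotBound L B V) (h0 : 0 < h) (h1 : h ≤ 1) {i : ℕ} (hi : i ≤ L)
    (x y : ℝ) : |Ed h V i x y| ≤ B * h * (1 + y ^ 2) := by
  have hB := hV.nonneg
  match i with
  | 0 => exact (hV.abs_Eh_le h0 x y).trans (by gcongr; linarith)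
  | 1 =>
    refine (hV.abs_Ed_one_le h0 x y).trans ?_
    gcongr
    nlinarith [sq_nonneg (|y| - 1), sq_abs y]
  | i + 2 =>
    have h2 := hV.bound (i + 2) (by omega) hi (x + h * y / 2)
    have h3 := hV.bound (i + 2) (by omega) hi (x - h * y / 2)
    have e : Ed h V (i + 2) x y = h * ((h / 2) ^ i * ((iteratedDeriv (i + 2) V (x + h * y / 2) -
        (-1) ^ i * iteratedDeriv (i + 2) V (x - h * y / 2)) / 4)) := by
      simp only [Ed, Fd, zero_add, pow_add]
      field_simp
      ring
    rw [e, abs_mul, abs_mul, abs_of_pos h0, abs_of_nonneg (by positivity : 0 ≤ (h / 2) ^ i),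
      mul_comm B, mul_assoc h]
    have h4 : (h / 2) ^ i ≤ 1 := pow_le_one₀ (by positivity) (by linarith)
    refine mul_le_mul_of_nonneg_left ?_ h0.le
    refine (mul_le_of_le_one_left (by positivity) h4).trans ?_
    rw [abs_div, abs_of_pos (by norm_num : (0 : ℝ) < 4)]
    have h5 := abs_sub (iteratedDeriv (i + 2) V (x + h * y / 2))
      ((-1) ^ i * iteratedDeriv (i + 2) V (x - h * y / 2))
    rw [abs_mul, abs_pow, abs_neg, abs_one, one_pow, one_mul] at h5
    have : 0 ≤ B * y ^ 2 := by positivity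
    linarith

theorem PotBound.Eh_eq_zero (hV : PotBound L B V) (h0 : 0 < h)
    (h3 : ∀ x, iteratedDeriv 3 V x = 0) (x y : ℝ) : Eh h V x y = 0 := by
  have hL := hV.three_le
  have c2 : ∀ a b, iteratedDeriv 2 V a = iteratedDeriv 2 V b := fun a b =>
    is_const_of_deriv_eq_zero (fun z => (hV.hasDerivAt_iteratedDeriv (by omega) z).differentiableAt)
      (fun z => (hV.hasDerivAt_iteratedDeriv (by omega) z).deriv.trans (h3 z)) a b
  have d2 : ∀ z, Ed h V 2 x z = 0 := fun z => by
    simp [Ed, Fd, c2 (x + h * z / 2) (x - h * z / 2)]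
  have d1 : ∀ z, Ed h V 1 x z = 0 := fun z => by
    have := is_const_of_deriv_eq_zero (f := Ed h V 1 x)
      (fun z => (hV.hasDerivAt_Ed (by omega) x z).differentiableAt)
      (fun z => (hV.hasDerivAt_Ed (by omega) x z).deriv.trans (d2 z)) z 0
    rw [this, Ed_one_eq h0]
    simp
  have := is_const_of_deriv_eq_zero (f := Ed h V 0 x)
      (fun z => (hV.hasDerivAt_Ed (by omega) x z).differentiableAt)
      (fun z => (hV.hasDerivAt_Ed (by omega) x z).deriv.trans (d1 z)) y 0
  exact this.trans (Eh_zero h V x)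

end

theorem iteratedDeriv_of_family {G : ℕ → ℝ → ℂ} {n : ℕ}
    (hG : ∀ i < n, ∀ y, HasDerivAt (G i) (G (i + 1) y) y) {i : ℕ} (hi : i ≤ n) :
    iteratedDeriv i (G 0) = G i := by
  induction i with
  | zero => simp
  | succ i ih =>
    rw [iteratedDeriv_succ, ih (by omega)]
    ext y
    exact (hG i (by omega) y).deriv

theorem contDiff_of_family {G : ℕ → ℝ → ℂ} {n : ℕ}
    (hG : ∀ i < n, ∀ y, HasDerivAt (G i) (G (i + 1) y) y) (hc : Continuous (G n)) :
    ContDiff ℝ n (G 0) := by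
  rw [contDiff_nat_iff_iteratedDeriv]
  refine ⟨fun m hm => ?_, fun m hm => ?_⟩
  · rw [iteratedDeriv_of_family hG (by exact_mod_cast hm)]
    rcases (lt_or_eq_of_le hm) with h | h
    · exact continuous_iff_continuousAt.2 fun y => (hG m (by exact_mod_cast h) y).continuousAt
    · rwa [h]
  · rw [iteratedDeriv_of_family hG (by exact_mod_cast hm.le)]
    exact fun y => (hG m (by exact_mod_cast hm) y).differentiableAt

theorem iteratedDeriv_family_mul {G : ℕ → ℝ → ℂ} {n : ℕ}
    (hG : ∀ i < n, ∀ y, HasDerivAt (G i) (G (i + 1) y) y) (hc : Continuous (G n))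
    {g : ℝ → ℂ} (hg : ContDiff ℝ n g) (y : ℝ) :
    iteratedDeriv n (fun y => G 0 y * g y) y =
      ∑ i ∈ Finset.range (n + 1), (n.choose i : ℂ) * G i y * iteratedDeriv (n - i) g y := by
  rw [iteratedDeriv_fun_mul (contDiff_of_family hG hc).contDiffAt hg.contDiffAt]
  refine Finset.sum_congr rfl fun i hi => ?_
  rw [iteratedDeriv_of_family hG (by simp at hi; omega)]

section
variable {L : ℕ} {B : ℝ} {V : ℝ → ℝ} {h : ℝ}

theorem contDiff_fst (u : 𝓢(ℝ × ℝ, ℂ)) (n : ℕ) (y : ℝ) : ContDiff ℝ n (fun x => u (x, y)) :=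
  (u.smooth n).comp (contDiff_id.prodMk contDiff_const)

theorem contDiff_snd (u : 𝓢(ℝ × ℝ, ℂ)) (n : ℕ) (x : ℝ) : ContDiff ℝ n (fun y => u (x, y)) :=
  (u.smooth n).comp (contDiff_const.prodMk contDiff_id)

theorem PotBound.continuous_Fd_x (hV : PotBound L B V) {i j : ℕ} (hij : i + j ≤ L) (y : ℝ) :
    Continuous (fun x => ((Fd h V i j x y : ℝ) : ℂ)) :=
  Complex.continuous_ofReal.comp
    ((hV.continuous_Fd hij).comp (continuous_id.prodMk continuous_const))

theorem PotBound.continuous_Fd_y (hV : PotBound L B V) {i j : ℕ} (hij : i + j ≤ L) (x : ℝ) :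
    Continuous (fun y => ((Fd h V i j x y : ℝ) : ℂ)) :=
  Complex.continuous_ofReal.comp
    ((hV.continuous_Fd hij).comp (continuous_const.prodMk continuous_id))

/-- The right-hand side of the von Neumann equation. -/
def vnRhs (h : ℝ) (V : ℝ → ℝ) (u : 𝓢(ℝ × ℝ, ℂ)) (x y : ℝ) : ℂ :=
  Complex.I * dx (dy u) (x, y) - Complex.I * ((Fd h V 0 0 x y : ℝ) : ℂ) * u (x, y)

theorem PotBound.pd2_vnRhs (hV : PotBound L B V) (u : 𝓢(ℝ × ℝ, ℂ)) {b β : ℕ} (hb : b + β ≤ L)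
    (x y : ℝ) : pd2 b β (vnRhs h V u) x y =
      Complex.I * (dx ^ b) ((dy ^ β) (dx (dy u))) (x, y) -
      Complex.I * ∑ j ∈ Finset.range (β + 1), ∑ i ∈ Finset.range (b + 1),
        (β.choose j : ℂ) * (b.choose i : ℂ) * ((Fd h V i j x y : ℝ) : ℂ) *
          (dx ^ (b - i)) ((dy ^ (β - j)) u) (x, y) := by
  have hGy : ∀ x', ∀ j < β, ∀ y, HasDerivAt (fun y => ((Fd h V 0 j x' y : ℝ) : ℂ))
      ((Fd h V 0 (j + 1) x' y : ℝ) : ℂ) y := fun x' j hj y =>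
    (hV.hasDerivAt_Fd_y (by omega) x' y).ofReal_comp
  have hGx : ∀ j ≤ β, ∀ i < b, ∀ x', HasDerivAt (fun x' => ((Fd h V i j x' y : ℝ) : ℂ))
      ((Fd h V (i + 1) j x' y : ℝ) : ℂ) x' := fun j hj i hi x' =>
    (hV.hasDerivAt_Fd_x (by omega) x' y).ofReal_comp
  have inner : ∀ x', iteratedDeriv β (fun y => vnRhs h V u x' y) y =
      Complex.I * (dy ^ β) (dx (dy u)) (x', y) - Complex.I * ∑ j ∈ Finset.range (β + 1),
        (β.choose j : ℂ) * (((Fd h V 0 j x' y : ℝ) : ℂ) * (dy ^ (β - j)) u (x', y)) := by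
    intro x'
    have c1 := contDiff_snd (dx (dy u)) β x'
    have c2 := contDiff_snd u β x'
    have c3 := contDiff_of_family (G := fun j y => ((Fd h V 0 j x' y : ℝ) : ℂ)) (hGy x')
      (hV.continuous_Fd_y (by omega) x')
    have e : (fun y => vnRhs h V u x' y) = fun y => Complex.I * dx (dy u) (x', y) -
        Complex.I * (((Fd h V 0 0 x' y : ℝ) : ℂ) * u (x', y)) := by
      ext y; simp only [vnRhs]; ring
    rw [e, iteratedDeriv_fun_sub (contDiff_const.mul c1).contDiffAt
      (contDiff_const.mul (c3.mul c2)).contDiffAt,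
      iteratedDeriv_const_mul_field, iteratedDeriv_const_mul_field, iteratedDeriv_snd,
      iteratedDeriv_family_mul (G := fun j y => ((Fd h V 0 j x' y : ℝ) : ℂ)) (hGy x')
        (hV.continuous_Fd_y (by omega) x') c2]
    simp only [iteratedDeriv_snd, mul_assoc]
  have c4 := contDiff_fst ((dy ^ β) (dx (dy u))) b y
  have c5 : ∀ j, ContDiff ℝ b (fun x => (dy ^ (β - j)) u (x, y)) := fun j => contDiff_fst _ b y
  have c6 : ∀ j ∈ Finset.range (β + 1), ContDiff ℝ b (fun x => ((Fd h V 0 j x y : ℝ) : ℂ)) := by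
    intro j hj
    have hj' : j ≤ β := by simp at hj; omega
    exact contDiff_of_family (G := fun i x => ((Fd h V i j x y : ℝ) : ℂ)) (hGx j hj')
      (hV.continuous_Fd_x (by omega) y)
  have c7 : ∀ j ∈ Finset.range (β + 1), ContDiff ℝ b (fun x' => (β.choose j : ℂ) *
      (((Fd h V 0 j x' y : ℝ) : ℂ) * (dy ^ (β - j)) u (x', y))) := fun j hj =>
    contDiff_const.mul ((c6 j hj).mul (c5 j))
  simp only [pd2, inner]
  rw [iteratedDeriv_fun_sub (contDiff_const.mul c4).contDiffAt
      (contDiff_const.mul (ContDiff.sum c7)).contDiffAt,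
      iteratedDeriv_const_mul_field, iteratedDeriv_const_mul_field, iteratedDeriv_fst,
      iteratedDeriv_fun_sum fun j hj => (c7 j hj).contDiffAt]
  congr 2
  refine Finset.sum_congr rfl fun j hj => ?_
  have hj' : j ≤ β := by simp at hj; omega
  rw [iteratedDeriv_const_mul_field,
    iteratedDeriv_family_mul (G := fun i x => ((Fd h V i j x y : ℝ) : ℂ)) (hGx j hj')
        (hV.continuous_Fd_x (by omega) y) (c5 j), Finset.mul_sum]
  simp only [iteratedDeriv_fst, mul_assoc]

theorem commutator_dx_dy_mono {q : ℕ × ℕ × ℕ × ℕ} {m : ℕ} (hq : tot q ≤ m) :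
    mono q * (dx * dy) - dx * (dy * mono q) ∈ W m := by
  obtain ⟨a, b, α, β⟩ := q
  have e : mono (a, b, α, β) * (dx * dy) = mono (a, b + 1, α, β + 1) := by
    simp only [mono, mul_assoc]
    rw [← mul_assoc (dy ^ β), (commute_dx_dy.symm.pow_left β).eq, mul_assoc, ← pow_succ,
      ← mul_assoc (dx ^ b), ← pow_succ]
  rw [e, dy_mul_mono, mul_add, mul_smul_comm, dx_mul_mono, dx_mul_mono]
  have h1 : (α : ℂ) • ((a : ℂ) • mono (a - 1, b, α - 1, β) + mono (a, b + 1, α - 1, β)) ∈ W m := by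
    rcases Nat.eq_zero_or_pos α with rfl | hα
    · simp
    · exact Submodule.smul_mem _ _ (add_mem
        (Submodule.smul_mem _ _ (mono_mem_W (by simp only [tot] at hq ⊢; omega)))
        (mono_mem_W (by simp only [tot] at hq ⊢; omega)))
  have h2 : (a : ℂ) • mono (a - 1, b, α, β + 1) ∈ W m := by
    rcases Nat.eq_zero_or_pos a with rfl | ha
    · simp
    · exact Submodule.smul_mem _ _ (mono_mem_W (by simp only [tot] at hq ⊢; omega))
  convert neg_mem (add_mem h1 h2) using 1
  abel

theorem rho_mul_norm_mono_le {q : ℕ × ℕ × ℕ × ℕ} {m : ℕ} (hq : tot q + 1 ≤ m)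
    (u : 𝓢(ℝ × ℝ, ℂ)) (p : ℝ × ℝ) :
    (1 + |p.1| + |p.2|) * ‖mono q u p‖ ≤ 3 * Pt m u p := by
  have h1 := norm_mono_le_Pt (m := m) (q := q) (by omega) u p
  have h2 : |p.1| * ‖mono q u p‖ = ‖mono (q.1 + 1, q.2.1, q.2.2.1, q.2.2.2) u p‖ := by
    rw [← mx_mul_mono, Module.End.mul_apply, mx_apply, norm_mul, Complex.norm_real,
      Real.norm_eq_abs]
  have h3 : |p.2| * ‖mono q u p‖ = ‖mono (q.1, q.2.1, q.2.2.1 + 1, q.2.2.2) u p‖ := by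
    rw [← my_mul_mono, Module.End.mul_apply, my_apply, norm_mul, Complex.norm_real,
      Real.norm_eq_abs]
  have h4 := norm_mono_le_Pt (m := m) (q := (q.1 + 1, q.2.1, q.2.2.1, q.2.2.2))
    (by simp only [tot] at hq ⊢; omega) u p
  have h5 := norm_mono_le_Pt (m := m) (q := (q.1, q.2.1, q.2.2.1 + 1, q.2.2.2))
    (by simp only [tot] at hq ⊢; omega) u p
  rw [add_mul, add_mul, h2, h3]
  linarith

theorem exists_wD_vnRhs_bound {m : ℕ} (q : ℕ × ℕ × ℕ × ℕ) (hq : tot q ≤ m) (hm : m < L)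
    (hV : PotBound L B V) :
    ∃ K, 0 ≤ K ∧ ∀ h, 0 < h → h ≤ 1 → ∀ (u : 𝓢(ℝ × ℝ, ℂ)) (p : ℝ × ℝ),
      ‖wD q.1 q.2.1 q.2.2.1 q.2.2.2 (vnRhs h V u) p.1 p.2 - Complex.I * dx (dy (mono q u)) p +
        Complex.I * ((Fd h V 0 0 p.1 p.2 : ℝ) : ℂ) * mono q u p‖ ≤ K * Pt m u p := by
  obtain ⟨K₁, hK₁, hK₁'⟩ := exists_bound_of_mem_W (commutator_dx_dy_mono hq)
  obtain ⟨a, b, α, β⟩ := q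
  have hq' : a + b + α + β ≤ m := hq
  set S := (Finset.range (β + 1) ×ˢ Finset.range (b + 1)) with hS
  set K₂ : ℝ := ∑ z ∈ S.erase (0, 0), (β.choose z.1 : ℝ) * (b.choose z.2 : ℝ) * (B * 3) with hK₂
  have hB := hV.nonneg
  refine ⟨K₁ + K₂, by positivity, fun h h0 h1 u p => ?_⟩
  have e1 : wD a b α β (vnRhs h V u) p.1 p.2 = Complex.I * mono (a, b, α, β) (dx (dy u)) p -
      Complex.I * ∑ z ∈ S, (β.choose z.1 : ℂ) * (b.choose z.2 : ℂ) *
        ((Fd h V z.2 z.1 p.1 p.2 : ℝ) : ℂ) * mono (a, b - z.2, α, β - z.1) u p := by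
    rw [wD, hV.pd2_vnRhs u (by omega), hS, Finset.sum_product, mono_apply]
    simp only [mono_apply, mul_sub, Finset.mul_sum, Prod.mk.eta]
    congr 1
    · ring
    · refine Finset.sum_congr rfl fun j _ => Finset.sum_congr rfl fun i _ => ?_
      ring
  have e2 : (0, 0) ∈ S := by simp [hS]
  rw [← Finset.add_sum_erase _ _ e2] at e1
  have e3 : wD a b α β (vnRhs h V u) p.1 p.2 - Complex.I * dx (dy (mono (a, b, α, β) u)) p +
        Complex.I * ((Fd h V 0 0 p.1 p.2 : ℝ) : ℂ) * mono (a, b, α, β) u p =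
      Complex.I * (mono (a, b, α, β) * (dx * dy) - dx * (dy * mono (a, b, α, β))) u p -
      Complex.I * ∑ z ∈ S.erase (0, 0), (β.choose z.1 : ℂ) * (b.choose z.2 : ℂ) *
        ((Fd h V z.2 z.1 p.1 p.2 : ℝ) : ℂ) * mono (a, b - z.2, α, β - z.1) u p := by
    rw [e1]
    simp only [LinearMap.sub_apply, Module.End.mul_apply, sub_apply, Nat.choose_zero_right,
      Nat.cast_one, one_mul, Nat.sub_zero]
    ring
  rw [e3]
  refine (norm_sub_le _ _).trans ?_
  rw [norm_mul, norm_mul, Complex.norm_I, one_mul, one_mul, add_mul]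
  refine add_le_add (hK₁' u p) ?_
  rw [hK₂, Finset.sum_mul]
  refine (norm_sum_le _ _).trans (Finset.sum_le_sum fun z hz => ?_)
  have hz2 : 1 ≤ z.2 + z.1 ∧ z.1 ≤ β ∧ z.2 ≤ b := by
    simp only [hS, Finset.mem_erase, Finset.mem_product, Finset.mem_range, ne_eq,
      Prod.ext_iff] at hz
    omega
  have h5 := hV.abs_Fd_le h0 h1 (i := z.2) (j := z.1) hz2.1 (by omega) p.1 p.2
  have h6 := rho_mul_norm_mono_le (m := m) (q := (a, b - z.2, α, β - z.1))
    (by simp only [tot]; omega) u p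
  simp only [norm_mul, Complex.norm_natCast, Complex.norm_real, Real.norm_eq_abs, mul_assoc]
  refine mul_le_mul_of_nonneg_left (mul_le_mul_of_nonneg_left ?_ (by positivity)) (by positivity)
  calc |Fd h V z.2 z.1 p.1 p.2| * ‖mono (a, b - z.2, α, β - z.1) u p‖
      ≤ B * (1 + |p.1| + |p.2|) * ‖mono (a, b - z.2, α, β - z.1) u p‖ := by gcongr
    _ ≤ B * (3 * Pt m u p) := by rw [mul_assoc]; gcongr

end

theorem le_exp_mul_of_deriv_le {e e' : ℝ → ℝ} {c : ℝ}
    (hd : ∀ t, 0 ≤ t → HasDerivWithinAt e (e' t) (Set.Ici 0) t)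
    (hle : ∀ t, 0 ≤ t → e' t ≤ c * e t) {t : ℝ} (ht : 0 ≤ t) : e t ≤ Real.exp (c * t) * e 0 := by
  have hd' : ∀ t, 0 ≤ t → HasDerivWithinAt (fun t => Real.exp (-(c * t)) * e t)
      (Real.exp (-(c * t)) * (e' t - c * e t)) (Set.Ici 0) t := by
    intro t ht
    have h1 : HasDerivAt (fun t => Real.exp (-(c * t))) (Real.exp (-(c * t)) * (-c)) t := by
      simpa using ((hasDerivAt_id t).const_mul c).neg.exp
    refine (h1.hasDerivWithinAt.mul (hd t ht)).congr_deriv ?_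
    ring
  have h2 : AntitoneOn (fun t => Real.exp (-(c * t)) * e t) (Set.Ici 0) := by
    refine antitoneOn_of_hasDerivWithinAt_nonpos (f' := fun t => Real.exp (-(c * t)) * (e' t - c * e t))
      (convex_Ici 0)
      (fun t ht => (hd' t ht).continuousWithinAt) (fun t ht => ?_) (fun t ht => ?_)
    · rw [interior_Ici] at ht ⊢
      exact (hd' t ht.le).mono Set.Ioi_subset_Ici_self
    · rw [interior_Ici] at ht
      exact mul_nonpos_of_nonneg_of_nonpos (Real.exp_pos _).le (sub_nonpos.2 (hle t ht.le))
  have h3 := h2 Set.self_mem_Ici ht ht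
  simp only [mul_zero, neg_zero, Real.exp_zero, one_mul] at h3
  have h4 := mul_le_mul_of_nonneg_left h3 (Real.exp_pos (c * t)).le
  rwa [← mul_assoc, ← Real.exp_add, add_neg_cancel, Real.exp_zero, one_mul] at h4

theorem sqrt_le_of_deriv_le {e e' : ℝ → ℝ} {A C : ℝ} (hC : 0 < C)
    (he : ∀ t, 0 ≤ t → 0 ≤ e t)
    (hd : ∀ t, 0 ≤ t → HasDerivWithinAt e (e' t) (Set.Ici 0) t) (hA : 0 ≤ A)
    (hle : ∀ t, 0 ≤ t → e' t ≤ 2 * √(e t) * (A * Real.exp (C * t))) {t : ℝ} (ht : 0 ≤ t) :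
    √(e t) ≤ √(e 0) + A * ((Real.exp (C * t) - 1) / C) := by
  have key : ∀ ε, 0 < ε → √(e t + ε) ≤ √(e 0 + ε) + A * ((Real.exp (C * t) - 1) / C) := by
    intro ε hε
    have hd' : ∀ t, 0 ≤ t → HasDerivWithinAt
        (fun t => √(e t + ε) - A * ((Real.exp (C * t) - 1) / C))
        (e' t / (2 * √(e t + ε)) - A * Real.exp (C * t)) (Set.Ici 0) t := by
      intro t ht
      have hpos : 0 < e t + ε := add_pos_of_nonneg_of_pos (he t ht) hε
      have h1 : HasDerivAt (fun t => A * ((Real.exp (C * t) - 1) / C))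
          (A * Real.exp (C * t)) t := by
        have := (((((hasDerivAt_id t).const_mul C).exp).sub_const 1).div_const C).const_mul A
        refine this.congr_deriv ?_
        simp only [id, mul_one]
        field_simp
      exact ((hd t ht).add_const ε).sqrt hpos.ne' |>.sub h1.hasDerivWithinAt
    have h2 : AntitoneOn (fun t => √(e t + ε) - A * ((Real.exp (C * t) - 1) / C)) (Set.Ici 0) := by
      refine antitoneOn_of_hasDerivWithinAt_nonpos
        (f' := fun t => e' t / (2 * √(e t + ε)) - A * Real.exp (C * t)) (convex_Ici 0)
        (fun t ht => (hd' t ht).continuousWithinAt) (fun t ht => ?_) (fun t ht => ?_)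
      · rw [interior_Ici] at ht ⊢
        exact (hd' t ht.le).mono Set.Ioi_subset_Ici_self
      · rw [interior_Ici] at ht
        have hpos : 0 < e t + ε := add_pos_of_nonneg_of_pos (he t ht.le) hε
        have h3 : 0 < √(e t + ε) := Real.sqrt_pos.2 hpos
        rw [sub_nonpos, div_le_iff₀ (by positivity)]
        have h4 : √(e t) ≤ √(e t + ε) := Real.sqrt_le_sqrt (by linarith)
        have h5 : 0 ≤ A * Real.exp (C * t) := by positivity
        nlinarith [hle t ht.le]
    have h3 := h2 Set.self_mem_Ici ht ht
    simp only [mul_zero, Real.exp_zero, sub_self, zero_div] at h3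
    linarith
  have t1 : Filter.Tendsto (fun ε => √(e t + ε)) (nhdsWithin 0 (Set.Ioi 0)) (nhds √(e t)) := by
    have : Continuous fun ε => √(e t + ε) := by fun_prop
    simpa using (this.tendsto 0).mono_left nhdsWithin_le_nhds
  have t2 : Filter.Tendsto (fun ε => √(e 0 + ε) + A * ((Real.exp (C * t) - 1) / C))
      (nhdsWithin 0 (Set.Ioi 0)) (nhds (√(e 0) + A * ((Real.exp (C * t) - 1) / C))) := by
    have : Continuous fun ε => √(e 0 + ε) + A * ((Real.exp (C * t) - 1) / C) := by fun_prop
    simpa using (this.tendsto 0).mono_left nhdsWithin_le_nhds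
  refine le_of_tendsto_of_tendsto t1 t2 ?_
  filter_upwards [self_mem_nhdsWithin] with ε hε using key ε hε

/-- Two functions whose difference from `g` is skew against `f` give the same energy bound. -/
theorem inner_le_of_remainder {f : 𝓢(ℝ × ℝ, ℂ)} {g : ℝ × ℝ → ℂ} {φ : ℝ × ℝ → ℝ} {K : ℝ} {m : ℕ}
    {u : 𝓢(ℝ × ℝ, ℂ)} (hφ : Continuous φ) (hK : 0 ≤ K) {F G : Lp ℂ 2 (volume : Measure (ℝ × ℝ))}
    (hF : F =ᵐ[volume] f) (hG : G =ᵐ[volume] g)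
    (hr : ∀ p, ‖g p - Complex.I * dx (dy f) p + Complex.I * ((φ p : ℝ) : ℂ) * f p‖
      ≤ K * Pt m u p) :
    inner ℝ F G ≤ ‖F‖ * (K * NN m (cur u)) := by
  set A : ℝ × ℝ → ℂ := fun p => Complex.I * dx (dy f) p with hA
  set b : ℝ × ℝ → ℂ := fun p => -(Complex.I * ((φ p : ℝ) : ℂ) * f p) with hb
  set r : ℝ × ℝ → ℂ := fun p => g p - A p - b p with hrdef
  have hg : MemLp g 2 volume := (memLp_congr_ae hG).1 (Lp.memLp G)
  have mA : MemLp A 2 volume := (memLp_two (dx (dy f))).const_mul Complex.I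
  have cb : Continuous b := by
    have := f.continuous
    fun_prop
  have mr : MemLp r 2 volume := by
    refine memLp_of_le_Pt (m := m) (u := u) hK ((hg.1.sub mA.1).sub cb.aestronglyMeasurable) (fun p => ?_)
    simpa [hrdef, hb, hA] using hr p
  have mb : MemLp b 2 volume := by
    have := (hg.sub mA).sub mr
    refine this.ae_eq (Filter.Eventually.of_forall fun p => ?_)
    simp [hrdef]
  have e : G = mA.toLp A + mb.toLp b + mr.toLp r := by
    refine Lp.ext ?_
    filter_upwards [hG, Lp.coeFn_add (mA.toLp A + mb.toLp b) (mr.toLp r),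
      Lp.coeFn_add (mA.toLp A) (mb.toLp b), mA.coeFn_toLp, mb.coeFn_toLp, mr.coeFn_toLp]
      with p h1 h2 h3 h4 h5 h6
    rw [h1, h2, Pi.add_apply, h3, Pi.add_apply, h4, h5, h6]
    simp [hrdef]
  have i1 : inner ℝ F (mA.toLp A) = 0 := by
    rw [L2.inner_def, ← integral_inner_I_mul_dx_dy f]
    refine integral_congr_ae ?_
    filter_upwards [hF, mA.coeFn_toLp] with p h1 h2
    rw [h1, h2]
  have i2 : inner ℝ F (mb.toLp b) = 0 := by
    rw [L2.inner_def]
    refine integral_eq_zero_of_ae ?_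
    filter_upwards [hF, mb.coeFn_toLp] with p h1 h2
    rw [h1, h2]
    simp [hb, Complex.inner]
    ring
  have i3 : inner ℝ F (mr.toLp r) ≤ ‖F‖ * (K * NN m (cur u)) := by
    refine (real_inner_le_norm _ _).trans (mul_le_mul_of_nonneg_left ?_ (norm_nonneg _))
    rw [Lp.norm_toLp]
    refine ENNReal.toReal_le_of_le_ofReal (mul_nonneg hK (NN_nonneg m u)) ?_
    refine eLpNorm_le_of_le_Pt hK (Filter.Eventually.of_forall fun p => ?_)
    simpa [hrdef, hb, hA] using hr p
  rw [e, inner_add_right, inner_add_right, i1, i2]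
  linarith

section
variable {L : ℕ} {B : ℝ} {V : ℝ → ℝ}

theorem dtR_eq_vnRhs {h : ℝ} {R : ℝ → ℝ → ℝ → ℂ} (hR : IsVNSol h V R) {t : ℝ} (ht : 0 ≤ t) :
    dtR R t = vnRhs h V (toS (hR.1.2.1 t ht)) := by
  ext x y
  rw [hR.2 t ht, vnRhs, Fd_zero_zero]
  have h1 := pd2_cur 1 1 (toS (hR.1.2.1 t ht)) x y
  rw [cur_toS, pow_one, pow_one] at h1
  rw [h1]
  rfl

/-- Propagation of the weighted Sobolev norms. -/
theorem exists_NN_le (m : ℕ) (hm : m < L) (hV : PotBound L B V) :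
    ∃ K, 0 ≤ K ∧ ∀ h, 0 < h → h ≤ 1 → ∀ R, IsVNSol h V R → ∀ t, 0 ≤ t →
      NN m (R t) ≤ √((idx m).card) * Real.exp (K * t) * NN m (R 0) := by
  have hK : ∀ q : ℕ × ℕ × ℕ × ℕ, ∃ K, 0 ≤ K ∧ (q ∈ idx m → ∀ h, 0 < h → h ≤ 1 →
      ∀ (u : 𝓢(ℝ × ℝ, ℂ)) (p : ℝ × ℝ),
      ‖wD q.1 q.2.1 q.2.2.1 q.2.2.2 (vnRhs h V u) p.1 p.2 - Complex.I * dx (dy (mono q u)) p +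
        Complex.I * ((Fd h V 0 0 p.1 p.2 : ℝ) : ℂ) * mono q u p‖ ≤ K * Pt m u p) := by
    intro q
    by_cases hq : q ∈ idx m
    · obtain ⟨K, h1, h2⟩ := exists_wD_vnRhs_bound q (mem_idx.1 hq) hm hV
      exact ⟨K, h1, fun _ => h2⟩
    · exact ⟨0, le_rfl, fun h => absurd h hq⟩
  choose K hK0 hK using hK
  set K' := ∑ q ∈ idx m, K q with hK'
  have hKle : ∀ q ∈ idx m, K q ≤ K' := fun q hq =>
    Finset.single_le_sum (f := K) (fun q _ => hK0 q) hq
  have hK'0 : 0 ≤ K' := Finset.sum_nonneg fun q _ => hK0 q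
  refine ⟨K' * (idx m).card, by positivity, fun h h0 h1 R hR t ht => ?_⟩
  choose Ψ Ψ' hΨ using fun q : ℕ × ℕ × ℕ × ℕ => hR.1.2.2 q.1 q.2.1 q.2.2.1 q.2.2.2
  have hn : ∀ q t, 0 ≤ t → ‖Ψ q t‖ = L2 (wD q.1 q.2.1 q.2.2.1 q.2.2.2 (R t)) := by
    intro q t ht
    rw [Lp.norm_def, L2, eLpNorm_congr_ae ((hΨ q).1 t ht)]
  have hNN : ∀ t, 0 ≤ t → NN m (R t) = ∑ q ∈ idx m, ‖Ψ q t‖ := fun t ht =>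
    Finset.sum_congr rfl fun q _ => (hn q t ht).symm
  set e : ℝ → ℝ := fun t => ∑ q ∈ idx m, ‖Ψ q t‖ ^ 2 with he
  have hcs : ∀ t, 0 ≤ t → NN m (R t) ^ 2 ≤ (idx m).card * e t := by
    intro t ht
    rw [hNN t ht]
    exact sq_sum_le_card_mul_sum_sq
  have hed : ∀ t, 0 ≤ t → HasDerivWithinAt e
      (∑ q ∈ idx m, 2 * inner ℝ (Ψ q t) (Ψ' q t)) (Set.Ici 0) t := by
    intro t ht
    exact HasDerivWithinAt.fun_sum fun q _ => ((hΨ q).2.2.1 t ht).norm_sq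
  have hle : ∀ t, 0 ≤ t → ∑ q ∈ idx m, 2 * inner ℝ (Ψ q t) (Ψ' q t) ≤
      (2 * (K' * (idx m).card)) * e t := by
    intro t ht
    set u := toS (hR.1.2.1 t ht) with hu
    have hcu : cur u = R t := rfl
    have h2 : ∀ q ∈ idx m, 2 * inner ℝ (Ψ q t) (Ψ' q t) ≤
        ‖Ψ q t‖ * (2 * (K' * NN m (R t))) := by
      intro q hq
      have hF : Ψ q t =ᵐ[volume] mono q u := by
        refine ((hΨ q).1 t ht).trans (Filter.Eventually.of_forall fun p => ?_)
        exact wD_cur q.1 q.2.1 q.2.2.1 q.2.2.2 u p.1 p.2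
      have h3 := inner_le_of_remainder (φ := fun p => Fd h V 0 0 p.1 p.2) (m := m)
        (hV.continuous_Fd (by omega)) (hK0 q) hF ((hΨ q).2.1 t ht) (u := u) (fun p => by
          have := hK q hq h h0 h1 u p
          rw [dtR_eq_vnRhs hR ht]
          exact this)
      rw [hcu] at h3
      have h4 : ‖Ψ q t‖ * (K q * NN m (R t)) ≤ ‖Ψ q t‖ * (K' * NN m (R t)) := by
        have := NN_nonneg m u
        rw [hcu] at this
        exact mul_le_mul_of_nonneg_left (mul_le_mul_of_nonneg_right (hKle q hq) this) (norm_nonneg _)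
      linarith
    refine (Finset.sum_le_sum h2).trans ?_
    rw [← Finset.sum_mul, ← hNN t ht]
    have := mul_le_mul_of_nonneg_left (hcs t ht) hK'0
    linarith
  have hg := le_exp_mul_of_deriv_le hed hle ht
  have he0 : e 0 ≤ NN m (R 0) ^ 2 := by
    rw [hNN 0 le_rfl]
    exact Finset.sum_sq_le_sq_sum_of_nonneg fun q _ => norm_nonneg _
  have hN0 : 0 ≤ NN m (R 0) := NN_nonneg m (toS (hR.1.2.1 0 le_rfl))
  refine abs_le_of_sq_le_sq' ?_ (by positivity) |>.2
  refine (hcs t ht).trans ?_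
  rw [mul_pow, mul_pow, Real.sq_sqrt (Nat.cast_nonneg _), ← Real.exp_nat_mul, mul_assoc]
  refine mul_le_mul_of_nonneg_left (hg.trans ?_) (Nat.cast_nonneg _)
  have : Real.exp (2 * (K' * (idx m).card) * t) = Real.exp (((2 : ℕ) : ℝ) * (K' * (idx m).card * t)) := by
    congr 1; push_cast; ring
  rw [this]
  exact mul_le_mul_of_nonneg_left he0 (Real.exp_pos _).le

end

/-- Weighted sums of the squared norms of the Hermite coefficients. -/
def SS (j : ℕ) (f : ℝ × ℝ → ℂ) : ENNReal := ∑' k : ℕ, ((k : ENNReal) + 1) ^ j * sqn (cf k f)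

theorem SS_zero {f : ℝ × ℝ → ℂ} (hf : MemLp f 2) : SS 0 f = sqn f := by
  simp [SS, tsum_sqn_cf hf]

theorem SS_add_le {f g : ℝ × ℝ → ℂ} (hf : MemLp f 2) (hg : MemLp g 2) (j : ℕ) :
    SS j (f + g) ≤ 2 * SS j f + 2 * SS j g := by
  unfold SS
  rw [← ENNReal.tsum_mul_left, ← ENNReal.tsum_mul_left, ← ENNReal.tsum_add]
  refine ENNReal.tsum_le_tsum fun k => ?_
  rw [sqn_congr (cf_add_ae hf hg k)]
  refine (mul_le_mul_right (sqn_add_le _ _ (memLp_cf hf k).1) _).trans (le_of_eq ?_)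
  ring

/-- Polynomial growth in the second variable, for every value of the first one. -/
def PolyGrowth (g : ℝ → ℝ → ℝ) : Prop :=
  Continuous (fun p : ℝ × ℝ => g p.1 p.2) ∧ ∀ x, ∃ (B : ℝ) (n : ℕ), ∀ y, |g x y| ≤ B * (1 + |y|) ^ n

theorem exists_norm_le (f : 𝓢(ℝ × ℝ, ℂ)) : ∃ C, 0 ≤ C ∧ ∀ p, ‖f p‖ ≤ C :=
  ⟨SchwartzMap.seminorm ℝ 0 0 f, apply_nonneg _ _, fun p => SchwartzMap.norm_le_seminorm ℝ f p⟩

theorem PolyGrowth.integrable {g : ℝ → ℝ → ℝ} (hg : PolyGrowth g) (f : 𝓢(ℝ × ℝ, ℂ)) (x : ℝ) (k : ℕ) :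
    Integrable (fun y => ((g x y : ℝ) : ℂ) * f (x, y) * ((Φh k y : ℝ) : ℂ)) := by
  obtain ⟨C, hC0, hC⟩ := exists_norm_le f
  obtain ⟨B, n, hB⟩ := hg.2 x
  refine integrable_mul_Φh (B := B * C) (n := n) ?_ k fun y => ?_
  · have h1 : Continuous fun y => g x y := hg.1.comp (continuous_const.prodMk continuous_id)
    have h2 := f.continuous
    exact (by fun_prop : Continuous fun y => ((g x y : ℝ) : ℂ) * f (x, y)).aestronglyMeasurable
  · rw [norm_mul, Complex.norm_real, Real.norm_eq_abs, mul_right_comm]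
    exact mul_le_mul (hB y) (hC _) (norm_nonneg _) ((abs_nonneg _).trans (hB y))

theorem bop_apply (f : 𝓢(ℝ × ℝ, ℂ)) (p : ℝ × ℝ) : bop f p = (p.2 : ℂ) * f p + dy f p := by
  rw [bop, LinearMap.add_apply, add_apply, my_apply]

theorem cf_ladder {g g' : ℝ → ℝ → ℝ} (hg : PolyGrowth g) (hg' : PolyGrowth g')
    (hd : ∀ x y, HasDerivAt (g x) (g' x y) y) (f : 𝓢(ℝ × ℝ, ℂ)) (k : ℕ) (x : ℝ) :
    cf k ((fun p => ((g' p.1 p.2 : ℝ) : ℂ) * f p) + fun p => ((g p.1 p.2 : ℝ) : ℂ) * bop f p) x =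
      (√(2 * ((k : ℝ) + 1)) : ℂ) * cf (k + 1) (fun p => ((g p.1 p.2 : ℝ) : ℂ) * f p) x := by
  have hder : ∀ y, HasDerivAt (fun y => ((g x y : ℝ) : ℂ) * f (x, y))
      (((g' x y : ℝ) : ℂ) * f (x, y) + ((g x y : ℝ) : ℂ) * dy f (x, y)) y := fun y =>
    ((hd x y).ofReal_comp).mul (hasDerivAt_snd f x y)
  have i1 := hg.integrable f x (k - 1)
  have i2 := hg.integrable f x (k + 1)
  have i3 := hg'.integrable f x k
  have i4 := hg.integrable (dy f) x k
  have i5 := hg.integrable f x k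
  have i6 := hg.integrable (bop f) x k
  have ip := integral_mul_deriv_eq_deriv_mul_of_integrable
    (u := fun y => ((g x y : ℝ) : ℂ) * f (x, y)) (v := fun y => ((Φh k y : ℝ) : ℂ))
    (v' := fun y => ((√((k : ℝ) / 2) * Φh (k - 1) y - √(((k : ℝ) + 1) / 2) * Φh (k + 1) y : ℝ) : ℂ))
    (fun y _ => hder y) (fun y _ => (hasDerivAt_Φh k y).ofReal_comp)
    (by
      refine ((i1.const_mul (√((k : ℝ) / 2) : ℂ)).sub
        (i2.const_mul (√(((k : ℝ) + 1) / 2) : ℂ))).congr (Filter.Eventually.of_forall fun y => ?_)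
      simp only [Pi.mul_apply, Pi.sub_apply]
      push_cast
      ring)
    (by
      refine (i3.add i4).congr (Filter.Eventually.of_forall fun y => ?_)
      simp only [Pi.mul_apply, Pi.add_apply]
      ring) i5
  have e1 : cf k ((fun p => ((g' p.1 p.2 : ℝ) : ℂ) * f p) +
      fun p => ((g p.1 p.2 : ℝ) : ℂ) * bop f p) x =
      (∫ y, (((g' x y : ℝ) : ℂ) * f (x, y) + ((g x y : ℝ) : ℂ) * dy f (x, y)) * ((Φh k y : ℝ) : ℂ))
      + ∫ y, ((g x y : ℝ) : ℂ) * f (x, y) * ((y * Φh k y : ℝ) : ℂ) := by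
    rw [← integral_add]
    · refine integral_congr_ae (Filter.Eventually.of_forall fun y => ?_)
      simp only [Pi.add_apply, bop_apply]
      push_cast
      ring
    · refine (i3.add i4).congr (Filter.Eventually.of_forall fun y => ?_)
      simp only [Pi.add_apply]
      ring
    · refine (i6.sub i4).congr (Filter.Eventually.of_forall fun y => ?_)
      simp only [Pi.sub_apply, bop_apply]
      push_cast
      ring
  have e2 : cf (k + 1) (fun p => ((g p.1 p.2 : ℝ) : ℂ) * f p) x * (√(2 * ((k : ℝ) + 1)) : ℂ) =
      (∫ y, ((g x y : ℝ) : ℂ) * f (x, y) * ((y * Φh k y : ℝ) : ℂ)) -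
      ∫ y, ((g x y : ℝ) : ℂ) * f (x, y) *
        ((√((k : ℝ) / 2) * Φh (k - 1) y - √(((k : ℝ) + 1) / 2) * Φh (k + 1) y : ℝ) : ℂ) := by
    rw [cf, ← integral_mul_const, ← integral_sub]
    · refine integral_congr_ae (Filter.Eventually.of_forall fun y => ?_)
      simp only [mul_Φh, two_mul_sqrt_half ((k : ℝ) + 1)]
      push_cast
      ring
    · refine ((i1.const_mul (√((k : ℝ) / 2) : ℂ)).add
        (i2.const_mul (√(((k : ℝ) + 1) / 2) : ℂ))).congr (Filter.Eventually.of_forall fun y => ?_)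
      simp only [Pi.add_apply, mul_Φh]
      push_cast
      ring
    · refine ((i1.const_mul (√((k : ℝ) / 2) : ℂ)).sub
        (i2.const_mul (√(((k : ℝ) + 1) / 2) : ℂ))).congr (Filter.Eventually.of_forall fun y => ?_)
      simp only [Pi.sub_apply]
      push_cast
      ring
  rw [e1, mul_comm, e2, ip]
  ring

theorem SS_succ_le {g g' : ℝ → ℝ → ℝ} (hg : PolyGrowth g) (hg' : PolyGrowth g')
    (hd : ∀ x y, HasDerivAt (g x) (g' x y) y) (f : 𝓢(ℝ × ℝ, ℂ)) (j : ℕ)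
    (hL : MemLp (fun p => ((g p.1 p.2 : ℝ) : ℂ) * f p) 2) :
    SS (j + 1) (fun p => ((g p.1 p.2 : ℝ) : ℂ) * f p) ≤
      sqn (fun p => ((g p.1 p.2 : ℝ) : ℂ) * f p) +
      2 ^ j * SS j ((fun p => ((g' p.1 p.2 : ℝ) : ℂ) * f p) +
        fun p => ((g p.1 p.2 : ℝ) : ℂ) * bop f p) := by
  unfold SS
  rw [tsum_eq_zero_add' ENNReal.summable, ← ENNReal.tsum_mul_left]
  refine add_le_add ?_ (ENNReal.tsum_le_tsum fun k => ?_)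
  · simpa using sqn_cf_le hL 0
  · have e := funext (cf_ladder hg hg' hd f k)
    rw [e, sqn_smul]
    have e2 : ‖(√(2 * ((k : ℝ) + 1)) : ℂ)‖ₑ ^ 2 = 2 * ((k : ENNReal) + 1) := by
      rw [← ofReal_norm, Complex.norm_real, Real.norm_of_nonneg (Real.sqrt_nonneg _),
        ← ENNReal.ofReal_pow (Real.sqrt_nonneg _), Real.sq_sqrt (by positivity),
        ENNReal.ofReal_mul (by norm_num), ENNReal.ofReal_add (by positivity) (by norm_num)]
      simp
    rw [e2, ← mul_assoc, ← mul_assoc]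
    refine mul_le_mul_left ?_ _
    push_cast
    have h1 : (k : ENNReal) + 1 + 1 ≤ 2 * ((k : ENNReal) + 1) := by
      rw [two_mul]; exact add_le_add_right le_add_self _
    calc ((k : ENNReal) + 1 + 1) ^ (j + 1) ≤ (2 * ((k : ENNReal) + 1)) ^ (j + 1) := by gcongr
      _ = 2 ^ j * ((k : ENNReal) + 1) ^ j * (2 * ((k : ENNReal) + 1)) := by
        rw [pow_succ, mul_pow]

/-- Constants in the ladder estimate. -/
def ladC : ℕ → ENNReal
  | 0 => 1
  | j + 1 => 1 + 2 ^ j * (4 * ladC j)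

theorem ladC_ne_top (j : ℕ) : ladC j ≠ ⊤ := by
  induction j with
  | zero => simp [ladC]
  | succ j ih => simp [ladC, ENNReal.mul_eq_top, ih]

theorem memLp_of_sqn_le {f : ℝ × ℝ → ℂ} (hf : AEStronglyMeasurable f volume) {X : ENNReal}
    (hX : X ≠ ⊤) (h : sqn f ≤ X) : MemLp f 2 := (memLp_iff_sqn hf).2 (h.trans_lt hX.lt_top)

theorem SS_le_of_family (j : ℕ) : ∀ (G : ℕ → ℝ → ℝ → ℝ) (f : 𝓢(ℝ × ℝ, ℂ)) (X : ENNReal), X ≠ ⊤ →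
    (∀ i ≤ j, PolyGrowth (G i)) → (∀ i < j, ∀ x y, HasDerivAt (G i x) (G (i + 1) x y) y) →
    (∀ i ≤ j, ∀ l ≤ j, sqn (fun p => ((G i p.1 p.2 : ℝ) : ℂ) * (bop ^ l) f p) ≤ X) →
    SS j (fun p => ((G 0 p.1 p.2 : ℝ) : ℂ) * f p) ≤ ladC j * X := by
  induction j with
  | zero =>
    intro G f X hX hG _ hs
    have h1 := hs 0 le_rfl 0 le_rfl
    have h2 := (hG 0 le_rfl).1
    simp only [pow_zero, Module.End.one_apply] at h1
    have c := f.continuous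
    rw [SS_zero (memLp_of_sqn_le (Continuous.aestronglyMeasurable (by fun_prop)) hX h1)]
    simpa [ladC] using h1
  | succ j ih =>
    intro G f X hX hG hd hs
    have hm : ∀ i ≤ j + 1, ∀ g : 𝓢(ℝ × ℝ, ℂ), sqn (fun p => ((G i p.1 p.2 : ℝ) : ℂ) * g p) ≤ X →
        MemLp (fun p => ((G i p.1 p.2 : ℝ) : ℂ) * g p) 2 := by
      intro i hi g hle
      have h2 := (hG i hi).1
      have c := g.continuous
      exact memLp_of_sqn_le (Continuous.aestronglyMeasurable (by fun_prop)) hX hle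
    have h00 := hs 0 (by omega) 0 (by omega)
    have h10 := hs 1 (by omega) 0 (by omega)
    have h01 := hs 0 (by omega) 1 (by omega)
    simp only [pow_zero, Module.End.one_apply, pow_one] at h00 h10 h01
    have a1 := ih (fun i => G (i + 1)) f X hX (fun i hi => hG (i + 1) (by omega))
      (fun i hi => hd (i + 1) (by omega)) (fun i hi l hl => hs (i + 1) (by omega) l (by omega))
    have a2 := ih G (bop f) X hX (fun i hi => hG i (by omega))
      (fun i hi => hd i (by omega)) (fun i hi l hl => by
        have := hs i (by omega) (l + 1) (by omega)
        rwa [pow_succ] at this)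
    refine (SS_succ_le (hG 0 (by omega)) (hG 1 (by omega)) (hd 0 (by omega)) f j
      (hm 0 (by omega) f h00)).trans ?_
    rw [ladC, add_mul, one_mul]
    refine add_le_add h00 ?_
    rw [mul_assoc]
    refine mul_le_mul_right ?_ _
    refine (SS_add_le (hm 1 (by omega) f h10) (hm 0 (by omega) _ h01) j).trans ?_
    refine (add_le_add (mul_le_mul_right a1 2) (mul_le_mul_right a2 2)).trans (le_of_eq ?_)
    ring

/-- Admissible weights: multiplication by `ρ` costs at most `n` orders. -/
structure Weight (n : ℕ) (ρ : ℝ → ℝ → ℝ) : Prop where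
  growth : PolyGrowth ρ
  bound : ∀ (m : ℕ) (T : Module.End ℂ 𝓢(ℝ × ℝ, ℂ)), T ∈ W m →
    ∃ C, 0 ≤ C ∧ ∀ (u : 𝓢(ℝ × ℝ, ℂ)) (p : ℝ × ℝ), ρ p.1 p.2 * ‖T u p‖ ≤ C * Pt (m + n) u p

theorem Weight.exists_SS_le {n : ℕ} {ρ : ℝ → ℝ → ℝ} (hρ : Weight n ρ) {m : ℕ}
    {T : Module.End ℂ 𝓢(ℝ × ℝ, ℂ)} (hT : T ∈ W m) (j : ℕ) :
    ∃ C, 0 ≤ C ∧ ∀ (G : ℕ → ℝ → ℝ → ℝ) (K : ℝ), 0 ≤ K →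
      (∀ i ≤ j, Continuous (fun p : ℝ × ℝ => G i p.1 p.2)) →
      (∀ i < j, ∀ x y, HasDerivAt (G i x) (G (i + 1) x y) y) →
      (∀ i ≤ j, ∀ x y, |G i x y| ≤ K * ρ x y) → ∀ u : 𝓢(ℝ × ℝ, ℂ),
      SS j (fun p => ((G 0 p.1 p.2 : ℝ) : ℂ) * T u p) ≤
        ENNReal.ofReal (C * (K * NN (m + n + j) (cur u)) ^ 2) := by
  choose C hC0 hC using fun l => hρ.bound (m + l) (bop ^ l * T) (bop_pow_mul_mem_W hT l)
  set D := ∑ l ∈ Finset.range (j + 1), C l with hD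
  have hD0 : 0 ≤ D := Finset.sum_nonneg fun l _ => hC0 l
  refine ⟨(ladC j).toReal * D ^ 2, by positivity, fun G K hK hc hd hb u => ?_⟩
  have hN := NN_nonneg (m + n + j) u
  have h1 := SS_le_of_family j G (T u) (ENNReal.ofReal ((K * D * NN (m + n + j) (cur u)) ^ 2))
    ENNReal.ofReal_ne_top
    (fun i hi => ⟨hc i hi, fun x => by
      obtain ⟨B, r, hB⟩ := hρ.growth.2 x
      refine ⟨K * B, r, fun y => (hb i hi x y).trans ?_⟩
      rw [mul_assoc]
      exact mul_le_mul_of_nonneg_left ((le_abs_self _).trans (hB y)) hK⟩) hd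
    (fun i hi l hl => by
      refine sqn_le_of_le_Pt (by positivity) fun p => ?_
      have h2 := hC l u p
      have h3 : C l ≤ D := Finset.single_le_sum (f := C) (fun l _ => hC0 l)
        (Finset.mem_range.2 (by omega))
      have h4 : Pt (m + l + n) u p ≤ Pt (m + n + j) u p := Pt_mono (by omega) u p
      rw [norm_mul, Complex.norm_real, Real.norm_eq_abs]
      calc |G i p.1 p.2| * ‖(bop ^ l) (T u) p‖
          ≤ K * ρ p.1 p.2 * ‖(bop ^ l) (T u) p‖ := by gcongr; exact hb i hi _ _
        _ = K * (ρ p.1 p.2 * ‖(bop ^ l * T) u p‖) := by rw [mul_assoc]; rfl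
        _ ≤ K * (D * Pt (m + n + j) u p) := by
          refine mul_le_mul_of_nonneg_left (h2.trans ?_) hK
          exact mul_le_mul h3 h4 (Pt_nonneg _ _ _) hD0
        _ = K * D * Pt (m + n + j) u p := by ring)
  refine h1.trans (le_of_eq ?_)
  rw [← ENNReal.ofReal_toReal (ladC_ne_top j), ← ENNReal.ofReal_mul ENNReal.toReal_nonneg,
    ENNReal.toReal_ofReal ENNReal.toReal_nonneg]
  congr 1
  ring

theorem weight_one : Weight 0 (fun _ _ => 1) where
  growth := ⟨continuous_const, fun _ => ⟨1, 0, fun y => by simp⟩⟩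
  bound m T hT := by
    obtain ⟨C, h0, h⟩ := exists_bound_of_mem_W hT
    exact ⟨C, h0, fun u p => by simpa using h u p⟩

theorem weight_one_add_abs : Weight 1 (fun x _ => 1 + |x|) where
  growth := ⟨by fun_prop, fun x => ⟨1 + |x|, 0, fun y => by simp [abs_of_nonneg, add_nonneg]⟩⟩
  bound m T hT := by
    obtain ⟨C, h0, h⟩ := exists_bound_of_mem_W (W_mono (Nat.le_succ m) hT)
    obtain ⟨D, h0', h'⟩ := exists_bound_of_mem_W (mx_mul_mem_W hT)
    refine ⟨C + D, add_nonneg h0 h0', fun u p => ?_⟩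
    have h2 := h' u p
    rw [Module.End.mul_apply, mx_apply, norm_mul, Complex.norm_real, Real.norm_eq_abs] at h2
    rw [add_mul, add_mul, one_mul]
    exact add_le_add (h u p) h2

theorem weight_one_add_sq : Weight 2 (fun _ y => 1 + y ^ 2) where
  growth := ⟨by fun_prop, fun x => ⟨1, 2, fun y => by
    rw [abs_of_nonneg (by positivity), one_mul]
    change 1 + y ^ 2 ≤ (1 + |y|) ^ 2
    rw [← sq_abs y]
    nlinarith [abs_nonneg y]⟩⟩
  bound m T hT := by
    obtain ⟨C, h0, h⟩ := exists_bound_of_mem_W (W_mono (Nat.le_add_right m 2) hT)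
    obtain ⟨D, h0', h'⟩ := exists_bound_of_mem_W (my_mul_mem_W (my_mul_mem_W hT))
    refine ⟨C + D, add_nonneg h0 h0', fun u p => ?_⟩
    have h2 := h' u p
    rw [Module.End.mul_apply, my_apply, Module.End.mul_apply, my_apply, norm_mul, norm_mul,
      Complex.norm_real, Real.norm_eq_abs, ← mul_assoc, abs_mul_abs_self, ← sq] at h2
    rw [add_mul, add_mul, one_mul]
    exact add_le_add (h u p) h2

theorem integrable_slice_mul_Φh {g : ℝ × ℝ → ℂ} (hg : MemLp g 2) :
    ∀ᵐ x, ∀ k, Integrable (fun y => g (x, y) * ((Φh k y : ℝ) : ℂ)) := by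
  filter_upwards [memLp_slice hg] with x hx k
  exact hx.integrable_mul (memLp_Φh k)

theorem cf_my_ae {g : ℝ × ℝ → ℂ} (hg : MemLp g 2) (k : ℕ) :
    cf k (fun p => (p.2 : ℂ) * g p) =ᵐ[volume]
      ((√((k : ℝ) / 2) : ℂ) • cf (k - 1) g + (√(((k : ℝ) + 1) / 2) : ℂ) • cf (k + 1) g) := by
  filter_upwards [integrable_slice_mul_Φh hg] with x hx
  simp only [cf, Pi.add_apply, Pi.smul_apply, smul_eq_mul]
  rw [← integral_const_mul, ← integral_const_mul,
    ← integral_add ((hx _).const_mul _) ((hx _).const_mul _)]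
  refine integral_congr_ae (Filter.Eventually.of_forall fun y => ?_)
  have h := congrArg (fun r : ℝ => (r : ℂ)) (mul_Φh k y)
  push_cast at h
  simp only
  linear_combination g (x, y) * h

theorem enorm_sqrt_sq {a : ℝ} (ha : 0 ≤ a) : ‖((√a : ℝ) : ℂ)‖ₑ ^ 2 = ENNReal.ofReal a := by
  rw [← ofReal_norm, Complex.norm_real, Real.norm_of_nonneg (Real.sqrt_nonneg _),
    ← ENNReal.ofReal_pow (Real.sqrt_nonneg _), Real.sq_sqrt ha]

theorem SS_my_le {g : ℝ × ℝ → ℂ} (hg : MemLp g 2) (j : ℕ) :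
    SS j (fun p => (p.2 : ℂ) * g p) ≤ (2 ^ j + 1) * SS (j + 1) g := by
  set s : ℕ → ENNReal := fun k => sqn (cf k g)
  have h1 : ∀ k : ℕ, ((k : ENNReal) + 1) ^ j * sqn (cf k (fun p => (p.2 : ℂ) * g p)) ≤
      ((k : ENNReal) + 1) ^ j * (k * s (k - 1)) + ((k : ENNReal) + 1) ^ (j + 1) * s (k + 1) := by
    intro k
    rw [sqn_congr (cf_my_ae hg k), pow_succ, mul_assoc _ _ (s (k + 1)), ← mul_add]
    refine mul_le_mul_right ?_ _
    refine (sqn_add_le _ _ ((memLp_cf hg _).1.const_smul _)).trans (le_of_eq ?_)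
    have hs : ∀ (c : ℂ) (f : ℝ → ℂ), sqn (c • f) = ‖c‖ₑ ^ 2 * sqn f := sqn_smul
    rw [hs, hs, enorm_sqrt_sq (by positivity), enorm_sqrt_sq (by positivity),
      ← mul_assoc, ← mul_assoc]
    have e : ∀ a : ℝ, 2 * ENNReal.ofReal (a / 2) = ENNReal.ofReal a := fun a => by
      rw [show (2 : ENNReal) = ENNReal.ofReal 2 by simp, ← ENNReal.ofReal_mul (by norm_num)]
      congr 1; ring
    rw [e, e, ENNReal.ofReal_add (by positivity) zero_le_one]
    simp [s]
  refine (ENNReal.tsum_le_tsum h1).trans ?_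
  rw [ENNReal.tsum_add, add_mul, one_mul]
  refine add_le_add ?_ ?_
  · rw [tsum_eq_zero_add' ENNReal.summable, SS, ← ENNReal.tsum_mul_left]
    simp only [Nat.cast_zero, zero_mul, mul_zero, zero_add, Nat.add_sub_cancel]
    refine ENNReal.tsum_le_tsum fun k => ?_
    rw [← mul_assoc, ← mul_assoc]
    refine mul_le_mul_left ?_ _
    push_cast
    have h2 : (k : ENNReal) + 1 + 1 ≤ 2 * ((k : ENNReal) + 1) := by
      rw [two_mul]; exact add_le_add_right le_add_self _
    calc ((k : ENNReal) + 1 + 1) ^ j * (k + 1) ≤ (2 * ((k : ENNReal) + 1)) ^ j * (k + 1) := by gcongr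
      _ = 2 ^ j * ((k : ENNReal) + 1) ^ (j + 1) := by rw [mul_pow, pow_succ, mul_assoc]
  · rw [SS, tsum_eq_zero_add' (f := fun k : ℕ => ((k : ENNReal) + 1) ^ (j + 1) * sqn (cf k g))
      ENNReal.summable]
    refine le_trans (ENNReal.tsum_le_tsum fun k => ?_) le_add_self
    refine mul_le_mul_left ?_ _
    push_cast
    gcongr
    exact le_self_add

theorem sqn_sq_mul_le {g : ℝ × ℝ → ℂ} (h0 : MemLp g 2) (h1 : MemLp (fun p => (p.2 : ℂ) * g p) 2)
    (h2 : MemLp (fun p => (p.2 : ℂ) * ((p.2 : ℂ) * g p)) 2) :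
    sqn (fun p => (p.2 : ℂ) * ((p.2 : ℂ) * g p)) ≤ 6 * SS 2 g := by
  rw [← SS_zero h2]
  refine (SS_my_le h1 0).trans ?_
  refine (mul_le_mul_right (SS_my_le h0 1) _).trans (le_of_eq ?_)
  rw [← mul_assoc]
  norm_num

/-- Cut-off coefficients: `1` for `k ≤ (N+1)/2`, `0` for `k ≥ N+1`. -/
def cut (N k : ℕ) : ℝ := max 0 (min 1 (2 - 2 * k / (N + 1)))

theorem cut_nonneg (N k : ℕ) : 0 ≤ cut N k := le_max_left _ _

theorem cut_le_one (N k : ℕ) : cut N k ≤ 1 := max_le zero_le_one (min_le_left _ _)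

theorem cut_eq_zero {N k : ℕ} (h : N + 1 ≤ k) : cut N k = 0 := by
  have h' : ((N : ℝ) + 1) ≤ k := by exact_mod_cast h
  refine max_eq_left ((min_le_right _ _).trans ?_)
  rw [sub_nonpos, le_div_iff₀ (by positivity)]
  linarith

theorem le_of_cut_ne_one {N k : ℕ} (h : cut N k ≠ 1) : 2 * N + 3 ≤ 4 * k := by
  by_contra! hk
  have hk' : 2 * k ≤ N + 1 := by omega
  have h' : 2 * (k : ℝ) ≤ (N : ℝ) + 1 := by exact_mod_cast hk'
  refine h ?_
  have h2 : 2 * (k : ℝ) / (N + 1) ≤ 1 := (div_le_one (by positivity)).2 h'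
  rw [cut, min_eq_left (by linarith)]
  exact max_eq_right zero_le_one

theorem abs_cut_sub_le (N k : ℕ) : |cut N (k + 1) - cut N k| ≤ 2 / ((N : ℝ) + 1) := by
  have h2 : 2 * ((k : ℝ) + 1) / ((N : ℝ) + 1) = 2 * (k : ℝ) / ((N : ℝ) + 1) + 2 / ((N : ℝ) + 1) := by
    ring
  unfold cut
  push_cast
  rw [h2]
  refine (abs_max_sub_max_le_max _ _ _ _).trans (max_le (by simp; positivity) ?_)
  refine (abs_min_sub_min_le_max _ _ _ _).trans (max_le (by simp; positivity) ?_)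
  rw [show ∀ a b : ℝ, 2 - (a + b) - (2 - a) = -b by intros; ring, abs_neg,
    abs_of_nonneg (by positivity)]

/-- Polynomially weighted tails are controlled by higher weighted sums. -/
theorem tail_le (N i j : ℕ) (a : ℕ → ENNReal) (f : ℝ × ℝ → ℂ) (ha : ∀ k, a k ≤ 1)
    (h : ∀ k, a k ≠ 0 → 2 * N + 3 ≤ 4 * (k + 1)) :
    ∑' k : ℕ, ((k : ENNReal) + 1) ^ i * (a k * sqn (cf k f)) ≤
      ENNReal.ofReal ((4 / (2 * N + 3)) ^ j) * SS (i + j) f := by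
  rw [SS, ← ENNReal.tsum_mul_left]
  refine ENNReal.tsum_le_tsum fun k => ?_
  by_cases hk : a k = 0
  · simp [hk]
  have h1 : (2 * (N : ℝ) + 3) ≤ 4 * (k + 1) := by exact_mod_cast h k hk
  have h2 : (1 : ENNReal) ≤ ENNReal.ofReal ((4 / (2 * N + 3)) ^ j) * ((k : ENNReal) + 1) ^ j := by
    have e : ((k : ENNReal) + 1) = ENNReal.ofReal ((k : ℝ) + 1) := by
      rw [ENNReal.ofReal_add (by positivity) zero_le_one]; simp
    rw [e, ← ENNReal.ofReal_pow (by positivity), ← ENNReal.ofReal_mul (by positivity), ← mul_pow,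
      ← ENNReal.ofReal_one]
    refine ENNReal.ofReal_le_ofReal (one_le_pow₀ ?_)
    rw [div_mul_eq_mul_div, le_div_iff₀ (by positivity)]
    linarith
  calc ((k : ENNReal) + 1) ^ i * (a k * sqn (cf k f))
      ≤ 1 * (((k : ENNReal) + 1) ^ i * (1 * sqn (cf k f))) := by
        rw [one_mul]
        exact mul_le_mul_right (mul_le_mul_left (ha k) _) _
    _ ≤ ENNReal.ofReal ((4 / (2 * N + 3)) ^ j) * ((k : ENNReal) + 1) ^ j *
          (((k : ENNReal) + 1) ^ i * (1 * sqn (cf k f))) := mul_le_mul_left h2 _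
    _ = ENNReal.ofReal ((4 / (2 * N + 3)) ^ j) * (((k : ENNReal) + 1) ^ (i + j) * sqn (cf k f)) := by
        rw [pow_add]; ring

theorem integrable_slice (u : 𝓢(ℝ × ℝ, ℂ)) (k : ℕ) (x : ℝ) :
    Integrable (fun y => u (x, y) * ((Φh k y : ℝ) : ℂ)) := by
  obtain ⟨C, hC0, hC⟩ := exists_norm_le u
  have h2 := u.continuous
  exact integrable_mul_Φh (B := C) (n := 0)
    (by fun_prop : Continuous fun y => u (x, y)).aestronglyMeasurable k (fun y => by simpa using hC _)

theorem hasDerivAt_cf (u : 𝓢(ℝ × ℝ, ℂ)) (k : ℕ) (x : ℝ) :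
    HasDerivAt (cf k u) (cf k (dx u) x) x := by
  obtain ⟨C, hC0, hC⟩ := exists_norm_le (dx u)
  have hΦ : Integrable (fun y => ((1 : ℂ) * ((Φh k y : ℝ) : ℂ))) :=
    integrable_mul_Φh (B := 1) (n := 0) aestronglyMeasurable_const k (by simp)
  refine (hasDerivAt_integral_of_dominated_loc_of_deriv_le
    (F := fun x y => u (x, y) * ((Φh k y : ℝ) : ℂ))
    (F' := fun x y => dx u (x, y) * ((Φh k y : ℝ) : ℂ)) (s := Set.univ)
    (bound := fun y => C * ‖(1 : ℂ) * ((Φh k y : ℝ) : ℂ)‖) Filter.univ_mem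
    (Filter.Eventually.of_forall fun x => (integrable_slice u k x).1) (integrable_slice u k x)
    (integrable_slice (dx u) k x).1 (Filter.Eventually.of_forall fun y x _ => ?_)
    (hΦ.norm.const_mul C) (Filter.Eventually.of_forall fun y x _ => ?_)).2
  · rw [norm_mul, one_mul]
    exact mul_le_mul_of_nonneg_right (hC _) (norm_nonneg _)
  · exact (hasDerivAt_fst u x y).mul_const _

theorem cf_dy (u : 𝓢(ℝ × ℝ, ℂ)) (k : ℕ) (x : ℝ) :
    cf k (dy u) x = -((√((k : ℝ) / 2) : ℂ) * cf (k - 1) u x) +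
      (√(((k : ℝ) + 1) / 2) : ℂ) * cf (k + 1) u x := by
  have i1 := integrable_slice u (k - 1) x
  have i2 := integrable_slice u (k + 1) x
  have ip := integral_mul_deriv_eq_deriv_mul_of_integrable
    (u := fun y => u (x, y)) (v := fun y => ((Φh k y : ℝ) : ℂ))
    (v' := fun y => ((√((k : ℝ) / 2) * Φh (k - 1) y - √(((k : ℝ) + 1) / 2) * Φh (k + 1) y : ℝ) : ℂ))
    (fun y _ => hasDerivAt_snd u x y) (fun y _ => (hasDerivAt_Φh k y).ofReal_comp)
    (by
      refine ((i1.const_mul (√((k : ℝ) / 2) : ℂ)).sub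
        (i2.const_mul (√(((k : ℝ) + 1) / 2) : ℂ))).congr (Filter.Eventually.of_forall fun y => ?_)
      simp only [Pi.mul_apply, Pi.sub_apply]
      push_cast
      ring)
    (integrable_slice (dy u) k x) (integrable_slice u k x)
  rw [cf, ← neg_eq_iff_eq_neg.2 ip, cf, cf, ← integral_const_mul, ← integral_const_mul, ← integral_neg,
    ← integral_neg, ← integral_add]
  · refine integral_congr_ae (Filter.Eventually.of_forall fun y => ?_)
    simp only
    push_cast
    ring
  · exact (i1.const_mul _).neg
  · exact i2.const_mul _

theorem cf_my (u : 𝓢(ℝ × ℝ, ℂ)) (k : ℕ) (x : ℝ) :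
    cf k (my u) x = (√((k : ℝ) / 2) : ℂ) * cf (k - 1) u x +
      (√(((k : ℝ) + 1) / 2) : ℂ) * cf (k + 1) u x := by
  rw [cf, cf, cf, ← integral_const_mul, ← integral_const_mul,
    ← integral_add ((integrable_slice u _ x).const_mul _) ((integrable_slice u _ x).const_mul _)]
  refine integral_congr_ae (Filter.Eventually.of_forall fun y => ?_)
  have h := congrArg (fun r : ℝ => (r : ℂ)) (mul_Φh k y)
  push_cast at h
  simp only [my_apply]
  linear_combination u (x, y) * h

section
variable {L : ℕ} {B : ℝ} {V : ℝ → ℝ} {h : ℝ}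

theorem PotBound.continuous_Eh (hV : PotBound L B V) :
    Continuous (fun p : ℝ × ℝ => Eh h V p.1 p.2) := hV.continuous_Ed (i := 0) (Nat.zero_le _)

theorem PotBound.polyGrowth_Eh (hV : PotBound L B V) (h0 : 0 < h) : PolyGrowth (Eh h V) := by
  refine ⟨hV.continuous_Eh, fun x => ⟨B * h, 2, fun y => (hV.abs_Eh_le h0 x y).trans ?_⟩⟩
  have := hV.nonneg
  refine mul_le_mul_of_nonneg_left ?_ (by positivity)
  rw [← sq_abs y]
  exact pow_le_pow_left₀ (abs_nonneg _) (by linarith) _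

/-- Hermite coefficients of the right-hand side of the von Neumann equation. -/
theorem PotBound.cf_vnRhs (hV : PotBound L B V) (h0 : 0 < h) (u : 𝓢(ℝ × ℝ, ℂ)) (k : ℕ) (x : ℝ) :
    cf k (unc (vnRhs h V u)) x =
      -Complex.I * ((√((k : ℝ) / 2) : ℂ) *
          (cf (k - 1) (dx u) x + ((deriv V x : ℝ) : ℂ) * cf (k - 1) u x) +
        (√(((k : ℝ) + 1) / 2) : ℂ) *
          (-cf (k + 1) (dx u) x + ((deriv V x : ℝ) : ℂ) * cf (k + 1) u x)) -
      Complex.I * cf k (fun p => ((Eh h V p.1 p.2 : ℝ) : ℂ) * u p) x := by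
  have e1 : cf k (unc (vnRhs h V u)) x = Complex.I * cf k (dx (dy u)) x -
      Complex.I * ((deriv V x : ℝ) : ℂ) * cf k (my u) x -
      Complex.I * cf k (fun p => ((Eh h V p.1 p.2 : ℝ) : ℂ) * u p) x := by
    rw [cf, cf, cf, cf, ← integral_const_mul, ← integral_const_mul, ← integral_const_mul,
      ← integral_sub, ← integral_sub]
    · refine integral_congr_ae (Filter.Eventually.of_forall fun y => ?_)
      simp only [unc, vnRhs, Fd_zero_zero, my_apply]
      have : (V (x + h * y / 2) - V (x - h * y / 2)) / h = deriv V x * y + Eh h V x y := by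
        rw [Eh]; ring
      rw [this]
      push_cast
      ring
    · exact ((integrable_slice _ k x).const_mul _).sub ((integrable_slice _ k x).const_mul _)
    · exact ((hV.polyGrowth_Eh h0).integrable u x k).const_mul _
    · exact (integrable_slice _ k x).const_mul _
    · exact (integrable_slice _ k x).const_mul _
  have e2 : dx (dy u) = dy (dx u) := by rw [dx_dy]
  rw [e1, e2, cf_dy, cf_my]
  ring

theorem PotBound.integrable_Eh_mul (hV : PotBound L B V) (h0 : 0 < h) (k l : ℕ) (x : ℝ) :
    Integrable (fun y => ((Eh h V x y * Φh k y * Φh l y : ℝ) : ℂ)) := by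
  obtain ⟨C, hC0, hC⟩ := norm_Φh_le k
  obtain ⟨D, n, hD⟩ := (hV.polyGrowth_Eh h0).2 x
  have h1 : Continuous fun y => Eh h V x y :=
    (hV.continuous_Eh (h := h)).comp (continuous_const.prodMk continuous_id)
  have h2 := continuous_Φh k
  refine (integrable_mul_Φh (g := fun y => ((Eh h V x y * Φh k y : ℝ) : ℂ)) (B := D * C) (n := n)
    (by fun_prop : Continuous fun y => ((Eh h V x y * Φh k y : ℝ) : ℂ)).aestronglyMeasurable l
    fun y => ?_).congr (Filter.Eventually.of_forall fun y => by simp)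
  rw [Complex.norm_real, Real.norm_eq_abs, abs_mul, mul_right_comm]
  exact mul_le_mul (hD y) (hC y) (abs_nonneg _) ((abs_nonneg _).trans (hD y))

end

/-- Function with prescribed Hermite coefficients up to order `N`. -/
def synth (N : ℕ) (c : ℕ → ℝ → ℂ) (p : ℝ × ℝ) : ℂ :=
  ∑ l ∈ Finset.range (N + 1), c l p.1 * ((Φh l p.2 : ℝ) : ℂ)

theorem cf_synth (N : ℕ) (c : ℕ → ℝ → ℂ) (k : ℕ) (x : ℝ) :
    cf k (synth N c) x = if k ≤ N then c k x else 0 := by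
  have e : ∀ l, ∫ y, c l x * ((Φh l y : ℝ) : ℂ) * ((Φh k y : ℝ) : ℂ) = if k = l then c l x else 0 := by
    intro l
    have h1 : ∀ y, c l x * ((Φh l y : ℝ) : ℂ) * ((Φh k y : ℝ) : ℂ) =
        c l x * ((Φh k y * Φh l y : ℝ) : ℂ) := fun y => by push_cast; ring
    simp_rw [h1]
    rw [integral_const_mul, integral_complex_ofReal, integral_Φh_mul_Φh]
    split_ifs <;> simp
  simp only [cf, synth, Finset.sum_mul]
  rw [integral_finsetSum]
  · simp_rw [e]
    simp
  · intro l _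
    refine ((integrable_Φh_mul_Φh l k).ofReal.const_mul (c l x)).congr
      (Filter.Eventually.of_forall fun y => ?_)
    simp [mul_assoc]

theorem cf_Eh_mul_synth {L : ℕ} {B : ℝ} {V : ℝ → ℝ} {h : ℝ} (hV : PotBound L B V) (h0 : 0 < h)
    (N : ℕ) (c : ℕ → ℝ → ℂ) (k : ℕ) (x : ℝ) :
    Integrable (fun y => ((Eh h V x y : ℝ) : ℂ) * synth N c (x, y) * ((Φh k y : ℝ) : ℂ)) ∧
    cf k (fun p => ((Eh h V p.1 p.2 : ℝ) : ℂ) * synth N c p) x =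
      ∑ l ∈ Finset.range (N + 1), ((Ekl h V k l x : ℝ) : ℂ) * c l x := by
  have i : ∀ l ∈ Finset.range (N + 1),
      Integrable (fun y => ((Eh h V x y * Φh k y * Φh l y : ℝ) : ℂ) * c l x) := fun l _ =>
    (hV.integrable_Eh_mul h0 k l x).mul_const _
  have e : ∀ y, ((Eh h V x y : ℝ) : ℂ) * synth N c (x, y) * ((Φh k y : ℝ) : ℂ) =
      ∑ l ∈ Finset.range (N + 1), ((Eh h V x y * Φh k y * Φh l y : ℝ) : ℂ) * c l x := by
    intro y
    rw [synth, Finset.mul_sum, Finset.sum_mul]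
    refine Finset.sum_congr rfl fun l _ => ?_
    push_cast
    ring
  refine ⟨(integrable_finsetSum _ i).congr (Filter.Eventually.of_forall fun y => (e y).symm), ?_⟩
  simp only [cf, e]
  rw [integral_finsetSum _ i]
  refine Finset.sum_congr rfl fun l _ => ?_
  rw [integral_mul_const, integral_complex_ofReal, Ekl]

theorem memLp_tensor {a b : ℝ → ℂ} (ha : MemLp a 2) (hb : MemLp b 2) :
    MemLp (fun p : ℝ × ℝ => a p.1 * b p.2) 2 := by
  have hm : AEStronglyMeasurable (fun p : ℝ × ℝ => a p.1 * b p.2) volume :=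
    ha.1.comp_fst.mul hb.1.comp_snd
  refine (memLp_iff_sqn hm).2 ?_
  have : sqn (fun p : ℝ × ℝ => a p.1 * b p.2) = sqn a * sqn b := by
    unfold sqn
    simp only [enorm_mul, mul_pow]
    rw [Measure.volume_eq_prod]
    exact lintegral_prod_mul (ha.1.enorm.pow_const 2) (hb.1.enorm.pow_const 2)
  rw [this]
  exact ENNReal.mul_lt_top ((memLp_iff_sqn ha.1).1 ha) ((memLp_iff_sqn hb.1).1 hb)

theorem memLp_synth (N : ℕ) {c : ℕ → ℝ → ℂ} (hc : ∀ k ≤ N, MemLp (c k) 2) (n : ℕ) :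
    MemLp (fun p => (p.2 : ℂ) ^ n * synth N c p) 2 := by
  have h := memLp_finsetSum (Finset.range (N + 1)) (f := fun l (p : ℝ × ℝ) => c l p.1 *
    ((p.2 ^ n * Φh l p.2 : ℝ) : ℂ)) (p := 2) (μ := volume) fun l hl =>
    memLp_tensor (hc l (by simpa [Nat.lt_succ_iff] using hl)) (memLp_pow_mul_Φh l n)
  refine h.ae_eq (Filter.Eventually.of_forall fun p => ?_)
  simp only [synth, Finset.mul_sum]
  refine Finset.sum_congr rfl fun l _ => ?_
  push_cast
  ring

/-- What the smooth truncation of order `N` leaves out. -/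
def cutRem (N : ℕ) (u : 𝓢(ℝ × ℝ, ℂ)) (p : ℝ × ℝ) : ℂ :=
  u p - synth N (fun l x => (cut N l : ℂ) * cf l u x) p

theorem cf_cutRem (N : ℕ) (u : 𝓢(ℝ × ℝ, ℂ)) (k : ℕ) (x : ℝ) :
    cf k (cutRem N u) x = ((1 - cut N k : ℝ) : ℂ) * cf k u x := by
  have i : ∀ l ∈ Finset.range (N + 1), Integrable (fun y =>
      (cut N l : ℂ) * cf l u x * ((Φh l y : ℝ) : ℂ) * ((Φh k y : ℝ) : ℂ)) := fun l _ => by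
    refine ((integrable_Φh_mul_Φh l k).ofReal.const_mul ((cut N l : ℂ) * cf l u x)).congr
      (Filter.Eventually.of_forall fun y => ?_)
    simp [mul_assoc]
  have e : cf k (cutRem N u) x =
      cf k u x - cf k (synth N (fun l x => (cut N l : ℂ) * cf l u x)) x := by
    rw [cf, cf, cf, ← integral_sub (integrable_slice u k x)]
    · simp only [cutRem, sub_mul]
    · simp only [synth, Finset.sum_mul]
      exact integrable_finsetSum _ i
  rw [e, cf_synth]
  split_ifs with hk
  · push_cast; ring
  · rw [cut_eq_zero (by omega)]; simp

theorem memLp_cutRem (N : ℕ) (u : 𝓢(ℝ × ℝ, ℂ)) (n : ℕ) :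
    MemLp (fun p => (p.2 : ℂ) ^ n * cutRem N u p) 2 := by
  have h1 : MemLp (fun p => (p.2 : ℂ) ^ n * u p) 2 volume := by
    have h := ((my ^ n) u).memLp 2 volume
    refine h.ae_eq (Filter.Eventually.of_forall fun p => ?_)
    have : ∀ v : 𝓢(ℝ × ℝ, ℂ), (my ^ n) v p = (p.2 : ℂ) ^ n * v p := by
      induction n with
      | zero => simp
      | succ n ih =>
        intro v
        have := ih ((my ^ n) u |>.memLp 2 volume) (my v)
        rw [pow_succ, Module.End.mul_apply, this, my_apply]
        ring
    exact this u
  have h2 := memLp_synth N (c := fun l x => (cut N l : ℂ) * cf l u x)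
    (fun k _ => (memLp_cf (u.memLp 2 volume) k).const_mul _) n
  refine (h1.sub h2).ae_eq (Filter.Eventually.of_forall fun p => ?_)
  simp [cutRem, mul_sub]

theorem cutRem_coeff_ne (N k : ℕ) (hk : ENNReal.ofReal ((1 - cut N k) ^ 2) ≠ 0) :
    2 * N + 3 ≤ 4 * (k + 1) := by
  have h : cut N k ≠ 1 := fun h => hk (by simp [h])
  have := le_of_cut_ne_one h
  omega

theorem sq_one_sub_cut_le (N k : ℕ) : ENNReal.ofReal ((1 - cut N k) ^ 2) ≤ 1 := by
  rw [← ENNReal.ofReal_one]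
  refine ENNReal.ofReal_le_ofReal ?_
  have h0 := cut_nonneg N k
  have h1 := cut_le_one N k
  nlinarith

theorem sqn_real_smul (a : ℝ) (f : ℝ → ℂ) :
    sqn (fun x => (a : ℂ) * f x) = ENNReal.ofReal (a ^ 2) * sqn f := by
  rw [sqn_smul, ← ofReal_norm, Complex.norm_real, ← ENNReal.ofReal_pow (norm_nonneg _),
    Real.norm_eq_abs, sq_abs]

theorem SS_cutRem_le (N i j : ℕ) (u : 𝓢(ℝ × ℝ, ℂ)) :
    SS i (cutRem N u) ≤ ENNReal.ofReal ((4 / (2 * N + 3)) ^ j) * SS (i + j) u := by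
  refine le_trans (le_of_eq ?_) (tail_le N i j (fun k => ENNReal.ofReal ((1 - cut N k) ^ 2)) u
    (sq_one_sub_cut_le N) (cutRem_coeff_ne N))
  refine tsum_congr fun k => ?_
  rw [funext (cf_cutRem N u k), sqn_real_smul]

theorem sqn_sq_mul_cutRem_le (N j : ℕ) (u : 𝓢(ℝ × ℝ, ℂ)) :
    sqn (fun p => (p.2 : ℂ) * ((p.2 : ℂ) * cutRem N u p)) ≤
      6 * (ENNReal.ofReal ((4 / (2 * N + 3)) ^ j) * SS (2 + j) u) := by
  refine (sqn_sq_mul_le ?_ ?_ ?_).trans (mul_le_mul_right (SS_cutRem_le N 2 j u) _)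
  · simpa using memLp_cutRem N u 0
  · simpa using memLp_cutRem N u 1
  · refine (memLp_cutRem N u 2).ae_eq (Filter.Eventually.of_forall fun p => ?_)
    simp only
    ring

section
variable {L : ℕ} {B : ℝ} {V : ℝ → ℝ} {h : ℝ}

/-- Multiplication by the force `V'`. -/
def mulForce (V : ℝ → ℝ) (u : 𝓢(ℝ × ℝ, ℂ)) (p : ℝ × ℝ) : ℂ := ((deriv V p.1 : ℝ) : ℂ) * u p

/-- Multiplication by the quantum correction. -/
def mulEh (h : ℝ) (V : ℝ → ℝ) (f : ℝ × ℝ → ℂ) (p : ℝ × ℝ) : ℂ := ((Eh h V p.1 p.2 : ℝ) : ℂ) * f p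

theorem PotBound.exists_SS_mulForce_le (hV : PotBound L B V) (j : ℕ) : ∃ C, 0 ≤ C ∧
    ∀ u : 𝓢(ℝ × ℝ, ℂ), SS j (mulForce V u) ≤ ENNReal.ofReal (C * NN (j + 1) (cur u) ^ 2) := by
  obtain ⟨C, hC0, hC⟩ := weight_one_add_abs.exists_SS_le (one_mem_W 0) j
  refine ⟨C * B ^ 2, by positivity, fun u => ?_⟩
  have hB := hV.nonneg
  have h := hC (fun i x _ => if i = 0 then deriv V x else 0) B hB
    (fun i _ => by
      by_cases hi : i = 0
      · have := hV.continuous_deriv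
        simp only [hi, if_true]
        fun_prop
      · simpa [hi] using continuous_const)
    (fun i _ x y => by
      by_cases hi : i = 0
      · simpa [hi] using hasDerivAt_const y _
      · simpa [hi] using hasDerivAt_const y _)
    (fun i _ x y => by
      by_cases hi : i = 0
      · simpa [hi] using abs_deriv_le hV x
      · simp only [hi, if_false, abs_zero]; positivity) u
  refine h.trans (le_of_eq ?_)
  rw [show 0 + 1 + j = j + 1 by ring]
  congr 1
  ring

theorem exists_SS_le {m : ℕ} {T : Module.End ℂ 𝓢(ℝ × ℝ, ℂ)} (hT : T ∈ W m) (j : ℕ) : ∃ C, 0 ≤ C ∧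
    ∀ u : 𝓢(ℝ × ℝ, ℂ), SS j (T u) ≤ ENNReal.ofReal (C * NN (m + j) (cur u) ^ 2) := by
  obtain ⟨C, hC0, hC⟩ := weight_one.exists_SS_le hT j
  refine ⟨C, hC0, fun u => ?_⟩
  have h := hC (fun i _ _ => if i = 0 then 1 else 0) 1 zero_le_one
    (fun i _ => continuous_const) (fun i _ x y => by
      by_cases hi : i = 0
      · simpa [hi] using hasDerivAt_const y _
      · simpa [hi] using hasDerivAt_const y _)
    (fun i _ x y => by split_ifs <;> simp) u
  simpa using h

theorem PotBound.exists_SS_mulEh_le (hV : PotBound L B V) {j : ℕ} (hj : j ≤ L) : ∃ C, 0 ≤ C ∧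
    ∀ h, 0 < h → h ≤ 1 → ∀ u : 𝓢(ℝ × ℝ, ℂ),
      SS j (mulEh h V u) ≤ ENNReal.ofReal (C * (h ^ 2 * NN (j + 2) (cur u) ^ 2)) := by
  obtain ⟨C, hC0, hC⟩ := weight_one_add_sq.exists_SS_le (one_mem_W 0) j
  have hB := hV.nonneg
  refine ⟨C * B ^ 2, by positivity, fun h h0 h1 u => ?_⟩
  have h := hC (Ed h V) (B * h) (by positivity)
    (fun i hi => hV.continuous_Ed (hi.trans hj)) (fun i hi x y => hV.hasDerivAt_Ed (by omega) x y)
    (fun i hi x y => hV.abs_Ed_le h0 h1 (hi.trans hj) x y) u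
  refine h.trans (le_of_eq ?_)
  rw [show 0 + 2 + j = j + 2 by ring]
  congr 1
  ring

theorem PotBound.memLp_mulForce (hV : PotBound L B V) (u : 𝓢(ℝ × ℝ, ℂ)) :
    MemLp (mulForce V u) 2 := by
  have h1 := (u.memLp 2 volume).const_mul (B : ℂ)
  have h2 := ((mx u).memLp 2 volume).const_mul (B : ℂ)
  have hc : Continuous (mulForce V u) := by
    have h1 := hV.continuous_deriv
    have h2 := u.continuous
    unfold mulForce
    fun_prop
  have hB := hV.nonneg
  refine (h1.norm.add h2.norm).mono hc.aestronglyMeasurable (Filter.Eventually.of_forall fun p => ?_)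
  rw [mulForce, norm_mul, Complex.norm_real, Real.norm_eq_abs]
  refine (mul_le_mul_of_nonneg_right (abs_deriv_le hV p.1) (norm_nonneg _)).trans
    (le_of_eq ?_)
  simp only [Pi.add_apply, norm_mul, Complex.norm_real, Real.norm_eq_abs, mx_apply, abs_of_nonneg hB]
  rw [abs_of_nonneg (a := _ + _) (by positivity)]
  ring

theorem PotBound.norm_mulEh_le (hV : PotBound L B V) (h0 : 0 < h) (f : ℝ × ℝ → ℂ) (p : ℝ × ℝ) :
    ‖mulEh h V f p‖ ≤ ‖((B * h : ℝ) : ℂ) * ((p.2 : ℂ) * ((p.2 : ℂ) * f p))‖ := by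
  have hB := hV.nonneg
  rw [mulEh, norm_mul, norm_mul, norm_mul, norm_mul, Complex.norm_real, Complex.norm_real,
    Complex.norm_real, Real.norm_eq_abs, Real.norm_eq_abs, Real.norm_eq_abs,
    abs_of_nonneg (by positivity : 0 ≤ B * h),
    ← mul_assoc |p.2|, abs_mul_abs_self, ← mul_assoc, ← sq]
  exact mul_le_mul_of_nonneg_right (hV.abs_Eh_le h0 p.1 p.2) (norm_nonneg _)

theorem PotBound.memLp_mulEh (hV : PotBound L B V) (h0 : 0 < h) {f : ℝ × ℝ → ℂ}
    (hf : AEStronglyMeasurable f volume)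
    (h2 : MemLp (fun p => (p.2 : ℂ) * ((p.2 : ℂ) * f p)) 2) : MemLp (mulEh h V f) 2 := by
  have hc := hV.continuous_Eh (h := h)
  exact (h2.const_mul ((B * h : ℝ) : ℂ)).mono (AEStronglyMeasurable.mul (by fun_prop) hf)
    (Filter.Eventually.of_forall (hV.norm_mulEh_le h0 f))

theorem PotBound.sqn_mulEh_le (hV : PotBound L B V) (h0 : 0 < h) (f : ℝ × ℝ → ℂ) :
    sqn (mulEh h V f) ≤
      ENNReal.ofReal ((B * h) ^ 2) * sqn (fun p => (p.2 : ℂ) * ((p.2 : ℂ) * f p)) := by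
  have e : ENNReal.ofReal ((B * h) ^ 2) = ‖((B * h : ℝ) : ℂ)‖ₑ ^ 2 := by
    rw [← ofReal_norm, Complex.norm_real, ← ENNReal.ofReal_pow (norm_nonneg _),
      Real.norm_eq_abs, sq_abs]
  rw [e, ← sqn_smul]
  exact sqn_mono (hV.norm_mulEh_le h0 f)

theorem PotBound.memLp_mulEh_schwartz (hV : PotBound L B V) (h0 : 0 < h) (u : 𝓢(ℝ × ℝ, ℂ)) :
    MemLp (mulEh h V u) 2 := by
  refine hV.memLp_mulEh h0 u.continuous.aestronglyMeasurable ?_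
  refine ((my (my u)).memLp 2 volume).ae_eq (Filter.Eventually.of_forall fun p => ?_)
  simp [my_apply]

theorem PotBound.memLp_mulEh_cutRem (hV : PotBound L B V) (h0 : 0 < h) (N : ℕ) (u : 𝓢(ℝ × ℝ, ℂ)) :
    MemLp (mulEh h V (cutRem N u)) 2 := by
  refine hV.memLp_mulEh h0 ?_ ?_
  · simpa using (memLp_cutRem N u 0).1
  · refine (memLp_cutRem N u 2).ae_eq (Filter.Eventually.of_forall fun p => ?_)
    simp only
    ring

end

/-- The transport operators applied to a function of two variables. -/
def transp (s : ℝ) (V : ℝ → ℝ) (u : 𝓢(ℝ × ℝ, ℂ)) (p : ℝ × ℝ) : ℂ := (s : ℂ) * dx u p + mulForce V u p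

/-- Consistency error produced by the down-neighbour. -/
def errLow (N : ℕ) (f : ℝ × ℝ → ℂ) (k : ℕ) (x : ℝ) : ℂ :=
  ((√((k : ℝ) / 2) * (cut N k - cut N (k - 1)) : ℝ) : ℂ) * cf (k - 1) f x

/-- Consistency error produced by the up-neighbour. -/
def errUp (N : ℕ) (f : ℝ × ℝ → ℂ) (k : ℕ) (x : ℝ) : ℂ :=
  ((√(((k : ℝ) + 1) / 2) * (cut N k - cut N (k + 1)) : ℝ) : ℂ) * cf (k + 1) f x

theorem ofReal_sq_cut_le {N m : ℕ} {a : ℝ} (ha : |a| ≤ 2 / ((N : ℝ) + 1)) (hm : m ≤ N) :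
    (√(((m : ℝ) + 1) / 2) * a) ^ 2 ≤ 2 * (4 / (2 * N + 3)) := by
  rw [mul_pow, Real.sq_sqrt (by positivity), ← sq_abs a]
  have hm' : (m : ℝ) + 1 ≤ N + 1 := by exact_mod_cast Nat.succ_le_succ hm
  calc ((m : ℝ) + 1) / 2 * |a| ^ 2 ≤ ((N : ℝ) + 1) / 2 * (2 / ((N : ℝ) + 1)) ^ 2 := by gcongr
    _ = 2 / ((N : ℝ) + 1) := by field_simp
    _ ≤ 2 * (4 / (2 * N + 3)) := by
      rw [mul_div_assoc', div_le_div_iff₀ (by positivity) (by positivity)]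
      have := Nat.cast_nonneg (α := ℝ) N
      linarith

theorem four_div_le (N : ℕ) (c : ℝ) (hc : 0 ≤ c) (j : ℕ) (a : ℕ → ENNReal)
    (f : ℝ × ℝ → ℂ) (ha : ∀ k, a k ≤ ENNReal.ofReal (c * (4 / (2 * N + 3))))
    (h : ∀ k, a k ≠ 0 → 2 * N + 3 ≤ 4 * (k + 1)) :
    ∑' k : ℕ, a k * sqn (cf k f) ≤ ENNReal.ofReal (c * (4 / (2 * N + 3)) ^ (1 + j)) * SS j f := by
  set b : ℕ → ENNReal := fun k => if a k = 0 then 0 else 1 with hb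
  have h1 := tail_le N 0 j b f (fun k => by simp only [hb]; split_ifs <;> simp)
    (fun k hk => h k fun h0 => hk (by simp [hb, h0]))
  calc ∑' k : ℕ, a k * sqn (cf k f)
      ≤ ∑' k : ℕ, ENNReal.ofReal (c * (4 / (2 * N + 3))) *
          (((k : ENNReal) + 1) ^ 0 * (b k * sqn (cf k f))) := by
        refine ENNReal.tsum_le_tsum fun k => ?_
        by_cases hk : a k = 0
        · simp [hk]
        · simp only [hb, hk, if_false, pow_zero, one_mul]
          exact mul_le_mul_left (ha k) _
    _ ≤ ENNReal.ofReal (c * (4 / (2 * N + 3))) *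
          (ENNReal.ofReal ((4 / (2 * N + 3)) ^ j) * SS (0 + j) f) := by
        rw [ENNReal.tsum_mul_left]
        exact mul_le_mul_right h1 _
    _ = _ := by
        rw [← mul_assoc, ← ENNReal.ofReal_mul (by positivity), zero_add, mul_assoc, pow_add, pow_one]

theorem sum_errLow_le (N j : ℕ) (f : ℝ × ℝ → ℂ) :
    ∑ k ∈ Finset.range (N + 1), sqn (errLow N f k) ≤
      ENNReal.ofReal (2 * (4 / (2 * N + 3)) ^ (1 + j)) * SS j f := by
  set a : ℕ → ENNReal := fun k => if k < N then
    ENNReal.ofReal ((√(((k : ℝ) + 1) / 2) * (cut N (k + 1) - cut N k)) ^ 2) else 0 with ha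
  have e0 : sqn (errLow N f 0) = 0 := by
    unfold errLow
    rw [sqn_real_smul]
    simp
  have e1 : ∀ k ∈ Finset.range N, sqn (errLow N f (k + 1)) = a k * sqn (cf k f) := by
    intro k hk
    unfold errLow
    rw [sqn_real_smul]
    simp [ha, Finset.mem_range.1 hk]
  rw [Finset.sum_range_succ', e0, add_zero, Finset.sum_congr rfl e1]
  refine (ENNReal.sum_le_tsum _).trans (four_div_le N 2 zero_le_two j a f (fun k => ?_) fun k hk => ?_)
  · simp only [ha]
    split_ifs with hk
    · exact ENNReal.ofReal_le_ofReal (ofReal_sq_cut_le (abs_cut_sub_le N k) hk.le)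
    · exact zero_le
  · by_contra! h
    have h1 : cut N (k + 1) = 1 := by
      by_contra h1
      have := le_of_cut_ne_one h1
      omega
    have h2 : cut N k = 1 := by
      by_contra h1
      have := le_of_cut_ne_one h1
      omega
    simp [ha, h1, h2] at hk

theorem sum_errUp_le (N j : ℕ) (f : ℝ × ℝ → ℂ) :
    ∑ k ∈ Finset.range (N + 1), sqn (errUp N f k) ≤
      ENNReal.ofReal (2 * (4 / (2 * N + 3)) ^ (1 + j)) * SS j f := by
  set a : ℕ → ENNReal := fun m => if 1 ≤ m ∧ m ≤ N + 1 then
    ENNReal.ofReal ((√((((m - 1 : ℕ) : ℝ) + 1) / 2) * (cut N (m - 1) - cut N m)) ^ 2) else 0 with ha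
  have e1 : ∀ k ∈ Finset.range (N + 1), sqn (errUp N f k) = a (k + 1) * sqn (cf (k + 1) f) := by
    intro k hk
    unfold errUp
    rw [sqn_real_smul]
    have := Finset.mem_range.1 hk
    have h1 : 1 ≤ k + 1 ∧ k + 1 ≤ N + 1 := by omega
    simp only [ha, h1, and_self, if_true, Nat.add_sub_cancel]
  rw [Finset.sum_congr rfl e1]
  refine le_trans ?_ (four_div_le N 2 zero_le_two j a f (fun k => ?_) fun k hk => ?_)
  · have h3 := ENNReal.sum_le_tsum (f := fun m => a m * sqn (cf m f)) (Finset.range (N + 1 + 1))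
    rw [Finset.sum_range_succ'] at h3
    exact le_trans le_self_add h3
  · simp only [ha]
    split_ifs with hk
    · obtain ⟨m, rfl⟩ : ∃ m, k = m + 1 := ⟨k - 1, by omega⟩
      refine ENNReal.ofReal_le_ofReal (ofReal_sq_cut_le ?_ (by omega))
      rw [Nat.add_sub_cancel, abs_sub_comm]
      exact abs_cut_sub_le N m
    · exact zero_le
  · by_contra! h
    have h1 : cut N (k - 1) = 1 := by
      by_contra h1
      have := le_of_cut_ne_one h1
      omega
    have h2 : cut N k = 1 := by
      by_contra h1
      have := le_of_cut_ne_one h1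
      omega
    simp [ha, h1, h2] at hk

section
variable {L : ℕ} {B : ℝ} {V : ℝ → ℝ} {h : ℝ}

/-- The consistency error of the smoothly truncated exact solution. -/
def consF (h : ℝ) (V : ℝ → ℝ) (N : ℕ) (u : 𝓢(ℝ × ℝ, ℂ)) (k : ℕ) (x : ℝ) : ℂ :=
  Complex.I * ((errLow N (transp 1 V u) k x + errUp N (transp (-1) V u) k x) +
    (cf k (mulEh h V (cutRem N u)) x + ((cut N k - 1 : ℝ) : ℂ) * cf k (mulEh h V u) x))

theorem PotBound.memLp_transp (hV : PotBound L B V) (s : ℝ) (u : 𝓢(ℝ × ℝ, ℂ)) :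
    MemLp (transp s V u) 2 :=
  (((dx u).memLp 2 volume).const_mul (s : ℂ)).add (hV.memLp_mulForce u)

theorem cf_transp (s : ℝ) (V : ℝ → ℝ) (u : 𝓢(ℝ × ℝ, ℂ)) (k : ℕ) (x : ℝ) :
    cf k (transp s V u) x = (s : ℂ) * cf k (dx u) x + ((deriv V x : ℝ) : ℂ) * cf k u x := by
  rw [cf, cf, cf, ← integral_const_mul, ← integral_const_mul,
    ← integral_add ((integrable_slice _ k x).const_mul _) ((integrable_slice _ k x).const_mul _)]
  refine integral_congr_ae (Filter.Eventually.of_forall fun y => ?_)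
  simp only [transp, mulForce]
  ring

theorem memLp_errLow {f : ℝ × ℝ → ℂ} (hf : MemLp f 2) (N k : ℕ) : MemLp (errLow N f k) 2 :=
  (memLp_cf hf _).const_mul _

theorem memLp_errUp {f : ℝ × ℝ → ℂ} (hf : MemLp f 2) (N k : ℕ) : MemLp (errUp N f k) 2 :=
  (memLp_cf hf _).const_mul _

theorem PotBound.memLp_consF (hV : PotBound L B V) (h0 : 0 < h) (N : ℕ) (u : 𝓢(ℝ × ℝ, ℂ)) (k : ℕ) :
    MemLp (consF h V N u k) 2 :=
  (((memLp_errLow (hV.memLp_transp 1 u) N k).add (memLp_errUp (hV.memLp_transp (-1) u) N k)).add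
    ((memLp_cf (hV.memLp_mulEh_cutRem h0 N u) k).add
      ((memLp_cf (hV.memLp_mulEh_schwartz h0 u) k).const_mul _))).const_mul _

theorem PotBound.sqn_consF_le (hV : PotBound L B V) (h0 : 0 < h) (N : ℕ) (u : 𝓢(ℝ × ℝ, ℂ)) (k : ℕ) :
    sqn (consF h V N u k) ≤ 4 * (sqn (errLow N (transp 1 V u) k) + sqn (errUp N (transp (-1) V u) k) +
      (sqn (cf k (mulEh h V (cutRem N u))) +
        ENNReal.ofReal ((1 - cut N k) ^ 2) * sqn (cf k (mulEh h V u)))) := by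
  unfold consF
  rw [sqn_smul]
  have m1 := memLp_errLow (hV.memLp_transp 1 u) N k
  have m2 := memLp_errUp (hV.memLp_transp (-1) u) N k
  have m3 := memLp_cf (hV.memLp_mulEh_cutRem h0 N u) k
  have e : ‖Complex.I‖ₑ ^ 2 = 1 := by rw [← ofReal_norm]; simp
  rw [e, one_mul]
  refine (sqn_add_le (fun x => errLow N (transp 1 V u) k x + errUp N (transp (-1) V u) k x)
    (fun x => cf k (mulEh h V (cutRem N u)) x +
      ((cut N k - 1 : ℝ) : ℂ) * cf k (mulEh h V u) x) (m1.1.add m2.1)).trans ?_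
  refine (add_le_add (mul_le_mul_right (sqn_add_le _ _ m1.1) 2)
    (mul_le_mul_right (sqn_add_le _ (fun x => ((cut N k - 1 : ℝ) : ℂ) * cf k (mulEh h V u) x)
      m3.1) 2)).trans (le_of_eq ?_)
  rw [sqn_real_smul, show (cut N k - 1) ^ 2 = (1 - cut N k) ^ 2 by ring]
  ring

theorem PotBound.exists_SS_transp_le (hV : PotBound L B V) (s : ℝ) (j : ℕ) : ∃ C, 0 ≤ C ∧
    ∀ u : 𝓢(ℝ × ℝ, ℂ), SS j (transp s V u) ≤ ENNReal.ofReal (C * NN (j + 1) (cur u) ^ 2) := by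
  obtain ⟨C, hC0, hC⟩ := hV.exists_SS_mulForce_le j
  have hT : (s : ℂ) • dx ∈ W 1 := by
    have := dx_mul_mem_W (one_mem_W 0)
    rw [mul_one] at this
    exact Submodule.smul_mem _ _ this
  obtain ⟨D, hD0, hD⟩ := exists_SS_le hT j
  refine ⟨2 * D + 2 * C, by positivity, fun u => ?_⟩
  have h := SS_add_le ((((s : ℂ) • dx) u).memLp 2 volume) (hV.memLp_mulForce u) j
  refine (h.trans (add_le_add (mul_le_mul_right (hD u) 2) (mul_le_mul_right (hC u) 2))).trans
    (le_of_eq ?_)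
  rw [add_comm 1 j, show (2 : ENNReal) = ENNReal.ofReal 2 by simp, ← ENNReal.ofReal_mul zero_le_two,
    ← ENNReal.ofReal_mul zero_le_two, ← ENNReal.ofReal_add (by positivity) (by positivity)]
  congr 1
  ring

theorem PotBound.exists_consF_le (hV : PotBound L B V) (i : ℕ) {j : ℕ} (hj : j ≤ L) : ∃ C, 0 ≤ C ∧
    ∀ d : ℝ, (d = 0 ∧ ∀ x, iteratedDeriv 3 V x = 0) ∨ d = 1 →
    ∀ h, 0 < h → h ≤ 1 → ∀ (N : ℕ) (u : 𝓢(ℝ × ℝ, ℂ)),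
      ∑ k ∈ Finset.range (N + 1), sqn (consF h V N u k) ≤ ENNReal.ofReal
        (C * ((4 / (2 * N + 3)) ^ (1 + i) * NN (i + 1) (cur u) ^ 2 +
          d * h ^ 2 * (4 / (2 * N + 3)) ^ j * NN (j + 2) (cur u) ^ 2)) := by
  obtain ⟨C1, h1, hC1⟩ := hV.exists_SS_transp_le 1 i
  obtain ⟨C2, h2, hC2⟩ := hV.exists_SS_transp_le (-1) i
  obtain ⟨C3, h3, hC3⟩ := exists_SS_le (one_mem_W 0) (2 + j)
  obtain ⟨C4, h4, hC4⟩ := hV.exists_SS_mulEh_le hj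
  set D := 4 * (2 * C1 + 2 * C2 + (6 * B ^ 2 * C3 + C4)) with hD
  refine ⟨D, by positivity, fun d hd h h0 hle N u => ?_⟩
  set q : ℝ := 4 / (2 * N + 3) with hq
  have hq0 : 0 ≤ q := by positivity
  set n1 := NN (i + 1) (cur u)
  set n2 := NN (j + 2) (cur u)
  have s1 : ∑ k ∈ Finset.range (N + 1), sqn (errLow N (transp 1 V u) k) ≤
      ENNReal.ofReal (2 * q ^ (1 + i) * (C1 * n1 ^ 2)) := by
    rw [ENNReal.ofReal_mul (by positivity)]
    exact (sum_errLow_le N i _).trans (mul_le_mul_right (hC1 u) _)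
  have s2 : ∑ k ∈ Finset.range (N + 1), sqn (errUp N (transp (-1) V u) k) ≤
      ENNReal.ofReal (2 * q ^ (1 + i) * (C2 * n1 ^ 2)) := by
    rw [ENNReal.ofReal_mul (by positivity)]
    exact (sum_errUp_le N i _).trans (mul_le_mul_right (hC2 u) _)
  have hd0 : 0 ≤ d := by
    rcases hd with ⟨rfl, -⟩ | rfl
    exacts [le_rfl, zero_le_one]
  have hz : d = 0 → ∀ f, mulEh h V f = 0 := by
    rintro rfl f
    rcases hd with ⟨-, hd⟩ | hd
    · funext p
      simp [mulEh, hV.Eh_eq_zero h0 hd]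
    · exact absurd hd zero_ne_one
  have hz2 : ∀ k : ℕ, sqn (cf k 0) = 0 := by
    intro k
    simp [sqn, cf]
  have s3 : ∑ k ∈ Finset.range (N + 1), sqn (cf k (mulEh h V (cutRem N u))) ≤
      ENNReal.ofReal (d * ((B * h) ^ 2 * (6 * (q ^ j * (C3 * n2 ^ 2))))) := by
    rcases hd with hd | rfl
    · simp [hz hd.1, hz2]
    rw [one_mul]
    refine (ENNReal.sum_le_tsum _).trans ?_
    rw [tsum_sqn_cf (hV.memLp_mulEh_cutRem h0 N u), ENNReal.ofReal_mul (by positivity)]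
    refine (hV.sqn_mulEh_le h0 _).trans (mul_le_mul_right ?_ _)
    rw [ENNReal.ofReal_mul (by positivity), ENNReal.ofReal_mul (by positivity)]
    refine (sqn_sq_mul_cutRem_le N j u).trans ?_
    rw [show ENNReal.ofReal 6 = 6 by simp]
    refine mul_le_mul_right (mul_le_mul_right ?_ _) _
    have := hC3 u
    rwa [show 0 + (2 + j) = j + 2 by ring] at this
  have s4 : ∑ k ∈ Finset.range (N + 1), ENNReal.ofReal ((1 - cut N k) ^ 2) * sqn (cf k (mulEh h V u)) ≤
      ENNReal.ofReal (d * (q ^ j * (C4 * (h ^ 2 * n2 ^ 2)))) := by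
    rcases hd with hd | rfl
    · simp [hz hd.1, hz2]
    rw [one_mul]
    rw [ENNReal.ofReal_mul (by positivity)]
    refine (ENNReal.sum_le_tsum _).trans ?_
    have h5 := tail_le N 0 j (fun k => ENNReal.ofReal ((1 - cut N k) ^ 2)) (mulEh h V u)
      (sq_one_sub_cut_le N) (cutRem_coeff_ne N)
    simp only [pow_zero, one_mul, zero_add] at h5
    exact h5.trans (mul_le_mul_right (hC4 h h0 hle u) _)
  refine (Finset.sum_le_sum fun k _ => hV.sqn_consF_le h0 N u k).trans ?_
  rw [← Finset.mul_sum, Finset.sum_add_distrib, Finset.sum_add_distrib, Finset.sum_add_distrib]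
  refine (mul_le_mul_right (add_le_add (add_le_add s1 s2) (add_le_add s3 s4)) 4).trans ?_
  rw [show (4 : ENNReal) = ENNReal.ofReal 4 by simp, ← ENNReal.ofReal_add (by positivity) (by positivity),
    ← ENNReal.ofReal_add (by positivity) (by positivity),
    ← ENNReal.ofReal_add (by positivity) (by positivity), ← ENNReal.ofReal_mul (by norm_num)]
  refine ENNReal.ofReal_le_ofReal ?_
  set X := q ^ (1 + i) * n1 ^ 2
  set Y := d * h ^ 2 * q ^ j * n2 ^ 2
  have hX : 0 ≤ X := by positivity
  have hY : 0 ≤ Y := by positivity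
  calc _ = 4 * ((2 * C1 + 2 * C2) * X + (6 * B ^ 2 * C3 + C4) * Y) := by simp only [X, Y]; ring
    _ ≤ 4 * ((2 * C1 + 2 * C2 + (6 * B ^ 2 * C3 + C4)) * X +
          (2 * C1 + 2 * C2 + (6 * B ^ 2 * C3 + C4)) * Y) := by
        have h6 : 0 ≤ 6 * B ^ 2 * C3 + C4 := by positivity
        refine mul_le_mul_of_nonneg_left (add_le_add (mul_le_mul_of_nonneg_right ?_ hX)
          (mul_le_mul_of_nonneg_right ?_ hY)) (by norm_num) <;> linarith
    _ = D * (X + Y) := by rw [hD]; ring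

end

section
variable {L : ℕ} {B : ℝ} {V : ℝ → ℝ} {h : ℝ}

/-- The right-hand side of the Galerkin system, for coefficients `w` with `x`-derivatives `w'`. -/
def galRhs (h : ℝ) (V : ℝ → ℝ) (N : ℕ) (w w' : ℕ → ℝ → ℂ) (k : ℕ) (x : ℝ) : ℂ :=
  -Complex.I * ((√((k : ℝ) / 2) : ℂ) * (w' (k - 1) x + ((deriv V x : ℝ) : ℂ) * w (k - 1) x) +
      (√(((k : ℝ) + 1) / 2) : ℂ) * (-w' (k + 1) x + ((deriv V x : ℝ) : ℂ) * w (k + 1) x)) -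
    Complex.I * ∑ l ∈ Finset.range (N + 1), ((Ekl h V k l x : ℝ) : ℂ) * w l x

theorem PotBound.cf_mulEh_cutRem (hV : PotBound L B V) (h0 : 0 < h) (N : ℕ) (u : 𝓢(ℝ × ℝ, ℂ))
    (k : ℕ) (x : ℝ) :
    cf k (mulEh h V (cutRem N u)) x = cf k (mulEh h V u) x -
      ∑ l ∈ Finset.range (N + 1), ((Ekl h V k l x : ℝ) : ℂ) * (((cut N l : ℝ) : ℂ) * cf l u x) := by
  obtain ⟨i2, e⟩ := cf_Eh_mul_synth hV h0 N (fun l x => ((cut N l : ℝ) : ℂ) * cf l u x) k x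
  rw [← e, cf, cf, cf]
  refine Eq.trans ?_ (integral_sub ((hV.polyGrowth_Eh h0).integrable u x k) i2)
  refine integral_congr_ae (Filter.Eventually.of_forall fun y => ?_)
  simp only [mulEh, cutRem]
  ring

/-- The smoothly truncated exact solution solves the Galerkin system up to `consF`. -/
theorem PotBound.galRhs_sub (hV : PotBound L B V) (h0 : 0 < h) (N : ℕ) (u : 𝓢(ℝ × ℝ, ℂ))
    (g g' : ℕ → ℝ → ℂ) (k : ℕ) (x : ℝ) :
    galRhs h V N g g' k x - ((cut N k : ℝ) : ℂ) * cf k (unc (vnRhs h V u)) x =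
      galRhs h V N (fun k x => g k x - ((cut N k : ℝ) : ℂ) * cf k u x)
        (fun k x => g' k x - ((cut N k : ℝ) : ℂ) * cf k (dx u) x) k x + consF h V N u k x := by
  rw [hV.cf_vnRhs h0, consF, hV.cf_mulEh_cutRem h0]
  simp only [galRhs, errLow, errUp, cf_transp, mul_sub, Finset.sum_sub_distrib]
  have e : cf k (fun p => ((Eh h V p.1 p.2 : ℝ) : ℂ) * u p) x = cf k (mulEh h V u) x := rfl
  rw [e]
  push_cast
  ring

theorem Ekl_comm (k l : ℕ) (x : ℝ) : Ekl h V k l x = Ekl h V l k x := by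
  unfold Ekl
  refine integral_congr_ae (Filter.Eventually.of_forall fun y => ?_)
  simp only
  ring

/-- The interaction matrix is real and symmetric, so it does not contribute to the energy. -/
theorem im_sum_Ekl (N : ℕ) (w : ℕ → ℂ) (x : ℝ) :
    (∑ k ∈ Finset.range (N + 1), (starRingEnd ℂ) (w k) *
      ∑ l ∈ Finset.range (N + 1), ((Ekl h V k l x : ℝ) : ℂ) * w l).im = 0 := by
  rw [← Complex.conj_eq_iff_im, map_sum]
  simp only [map_mul, map_sum, Complex.conj_conj, Complex.conj_ofReal, Finset.mul_sum]
  rw [Finset.sum_comm]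
  refine Finset.sum_congr rfl fun k _ => Finset.sum_congr rfl fun l _ => ?_
  rw [Ekl_comm l k]
  ring

theorem re_sum_galRhs {N : ℕ} (w w' : ℕ → ℝ → ℂ) (x : ℝ) (h1 : w (N + 1) x = 0) :
    ∑ k ∈ Finset.range (N + 1), ((starRingEnd ℂ) (w k x) * galRhs h V N w w' k x).re =
      ∑ k ∈ Finset.range (N + 1), √(((k : ℝ) + 1) / 2) *
        ((starRingEnd ℂ) (w' (k + 1) x) * w k x + (starRingEnd ℂ) (w (k + 1) x) * w' k x).im := by
  set a : ℕ → ℝ := fun k => √((k : ℝ) / 2) * ((starRingEnd ℂ) (w k x) *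
    (w' (k - 1) x + ((deriv V x : ℝ) : ℂ) * w (k - 1) x)).im with ha
  set b : ℕ → ℝ := fun k => √(((k : ℝ) + 1) / 2) * ((starRingEnd ℂ) (w k x) *
    (-w' (k + 1) x + ((deriv V x : ℝ) : ℂ) * w (k + 1) x)).im with hb
  have e1 : ∀ k, ((starRingEnd ℂ) (w k x) * galRhs h V N w w' k x).re = a k + b k +
      ((starRingEnd ℂ) (w k x) *
        ∑ l ∈ Finset.range (N + 1), ((Ekl h V k l x : ℝ) : ℂ) * w l x).im := by
    intro k
    have : (starRingEnd ℂ) (w k x) * galRhs h V N w w' k x = -Complex.I *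
      ((√((k : ℝ) / 2) : ℂ) * ((starRingEnd ℂ) (w k x) *
          (w' (k - 1) x + ((deriv V x : ℝ) : ℂ) * w (k - 1) x)) +
        (√(((k : ℝ) + 1) / 2) : ℂ) * ((starRingEnd ℂ) (w k x) *
          (-w' (k + 1) x + ((deriv V x : ℝ) : ℂ) * w (k + 1) x)) +
        (starRingEnd ℂ) (w k x) *
          ∑ l ∈ Finset.range (N + 1), ((Ekl h V k l x : ℝ) : ℂ) * w l x) := by
      rw [galRhs]
      ring
    rw [this, neg_mul, Complex.neg_re, Complex.I_mul_re, neg_neg, Complex.add_im, Complex.add_im,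
      Complex.im_ofReal_mul, Complex.im_ofReal_mul]
  have e2 : ∑ k ∈ Finset.range (N + 1), a k = ∑ k ∈ Finset.range (N + 1), a (k + 1) := by
    rw [Finset.sum_range_succ', Finset.sum_range_succ (fun k => a (k + 1))]
    simp [ha, h1]
  simp only [e1, Finset.sum_add_distrib]
  rw [e2, ← Complex.im_sum, im_sum_Ekl N (fun k => w k x), add_zero, ← Finset.sum_add_distrib]
  refine Finset.sum_congr rfl fun k _ => ?_
  simp only [ha, hb, Nat.add_sub_cancel]
  push_cast
  rw [← mul_add, ← Complex.add_im]
  congr 1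
  simp only [Complex.add_im, Complex.mul_im, Complex.add_re, Complex.mul_re, Complex.conj_re,
    Complex.conj_im, Complex.ofReal_re, Complex.ofReal_im, Complex.neg_re, Complex.neg_im]
  ring

/-- The Galerkin operator is skew-adjoint on `L²`. -/
theorem sum_inner_galRhs {N : ℕ} {w w' : ℕ → ℝ → ℂ} (hd : ∀ k x, HasDerivAt (w k) (w' k x) x)
    (m : ∀ k, MemLp (w k) 2) (m' : ∀ k, MemLp (w' k) 2) (h1 : w (N + 1) = 0)
    {ω γ : ℕ → Lp ℂ 2 (volume : Measure ℝ)} (hω : ∀ k, k ≤ N → ω k =ᵐ[volume] w k)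
    (hγ : ∀ k, k ≤ N → γ k =ᵐ[volume] galRhs h V N w w' k) :
    ∑ k ∈ Finset.range (N + 1), inner ℝ (ω k) (γ k) = 0 := by
  simp only [L2.inner_def]
  rw [← integral_finsetSum _ fun k _ => L2.integrable_inner (𝕜 := ℝ) _ _]
  have e : (fun x => ∑ k ∈ Finset.range (N + 1), inner ℝ (ω k x) (γ k x)) =ᵐ[volume]
      fun x => ∑ k ∈ Finset.range (N + 1), √(((k : ℝ) + 1) / 2) *
        ((starRingEnd ℂ) (w' (k + 1) x) * w k x + (starRingEnd ℂ) (w (k + 1) x) * w' k x).im := by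
    have a1 := (Finset.eventually_all (Finset.range (N + 1))).2 fun k hk =>
      hω k (Nat.lt_succ_iff.1 (Finset.mem_range.1 hk))
    have a2 := (Finset.eventually_all (Finset.range (N + 1))).2 fun k hk =>
      hγ k (Nat.lt_succ_iff.1 (Finset.mem_range.1 hk))
    filter_upwards [a1, a2] with x b1 b2
    rw [← re_sum_galRhs (h := h) (V := V) w w' x (by rw [h1]; rfl)]
    refine Finset.sum_congr rfl fun k hk => ?_
    rw [b1 k hk, b2 k hk, Complex.inner, mul_comm]
  have hs : ∀ k, MemLp (fun x => (starRingEnd ℂ) (w k x)) 2 := fun k =>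
    (memLp_congr_norm (m k).1 (Complex.continuous_conj.comp_aestronglyMeasurable (m k).1)
      (Filter.Eventually.of_forall fun x => (RCLike.norm_conj _).symm)).1 (m k)
  have hs' : ∀ k, MemLp (fun x => (starRingEnd ℂ) (w' k x)) 2 := fun k =>
    (memLp_congr_norm (m' k).1 (Complex.continuous_conj.comp_aestronglyMeasurable (m' k).1)
      (Filter.Eventually.of_forall fun x => (RCLike.norm_conj _).symm)).1 (m' k)
  have i1 : ∀ k, Integrable fun x =>
      (starRingEnd ℂ) (w' (k + 1) x) * w k x + (starRingEnd ℂ) (w (k + 1) x) * w' k x := fun k =>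
    ((hs' (k + 1)).integrable_mul (m k)).add ((hs (k + 1)).integrable_mul (m' k))
  have z : ∀ k, ∫ x, ((starRingEnd ℂ) (w' (k + 1) x) * w k x +
      (starRingEnd ℂ) (w (k + 1) x) * w' k x) = 0 := fun k =>
    integral_eq_zero_of_hasDerivAt_of_integrable
      (f := fun x => (starRingEnd ℂ) (w (k + 1) x) * w k x)
      (fun x => (hd (k + 1) x).star.mul (hd k x)) (i1 k) ((hs (k + 1)).integrable_mul (m k))
  have i2 : ∀ k, Integrable fun x => ((starRingEnd ℂ) (w' (k + 1) x) * w k x +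
      (starRingEnd ℂ) (w (k + 1) x) * w' k x).im := fun k => (i1 k).im
  rw [integral_congr_ae e, integral_finsetSum _ fun k _ => (i2 k).const_mul _]
  refine Finset.sum_eq_zero fun k _ => ?_
  rw [integral_const_mul]
  have := integral_im (i1 k)
  simp only [RCLike.im_to_complex] at this
  rw [this, z]
  simp

end

/-- A function satisfying `IsSchwartz1` as a Schwartz map. -/
def toS1 {f : ℝ → ℂ} (hf : IsSchwartz1 f) : 𝓢(ℝ, ℂ) where
  toFun := f
  smooth' := hf.1
  decay' k n := by
    obtain ⟨C, hC⟩ := hf.2 k n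
    refine ⟨C, fun x => ?_⟩
    rw [norm_iteratedFDeriv_eq_norm_iteratedDeriv, Real.norm_eq_abs]
    exact hC x

theorem isSchwartz1_zero : IsSchwartz1 0 := by
  refine ⟨contDiff_const, fun k n => ⟨0, fun x => ?_⟩⟩
  rw [show (0 : ℝ → ℂ) = fun _ => 0 from rfl, iteratedDeriv_const]
  simp

theorem hasDerivAt_of_isSchwartz1 {f : ℝ → ℂ} (hf : IsSchwartz1 f) (x : ℝ) :
    HasDerivAt f (deriv f x) x :=
  (hf.1.differentiable (by simp) x).hasDerivAt

theorem memLp_of_isSchwartz1 {f : ℝ → ℂ} (hf : IsSchwartz1 f) : MemLp f 2 :=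
  (toS1 hf).memLp 2 volume

theorem memLp_deriv_of_isSchwartz1 {f : ℝ → ℂ} (hf : IsSchwartz1 f) : MemLp (deriv f) 2 :=
  (SchwartzMap.derivCLM ℝ ℂ (toS1 hf)).memLp 2 volume

section
variable {L : ℕ} {B : ℝ} {V : ℝ → ℝ} {h : ℝ}

theorem isSchwartz1_of_isGalerkinReg {N : ℕ} {Q : ℕ → ℝ → ℝ → ℂ} (hQ : IsGalerkinReg N Q) {t : ℝ}
    (ht : 0 ≤ t) (k : ℕ) : IsSchwartz1 (Q k t) := by
  by_cases hk : k ≤ N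
  · exact hQ.2.1 k hk t ht
  · have : Q k t = 0 := funext fun x => hQ.2.2.2 k (by omega) t x
    rw [this]
    exact isSchwartz1_zero

theorem deriv_eq_galRhs {N : ℕ} {Q : ℕ → ℝ → ℝ → ℂ} (hQ : IsVNGalerkinSol h V N Q)
    {k : ℕ} (hk : k ≤ N) {t : ℝ} (ht : 0 ≤ t) (x : ℝ) :
    deriv (fun s => Q k s x) t =
      galRhs h V N (fun k => Q k t) (fun k => deriv (Q k t)) k x := by
  rw [eq_sub_of_add_eq (hQ.2 k hk t ht x), galRhs, Dop, Dstar]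
  ring

/-- Energy estimate for the Galerkin error relative to the truncated exact solution. -/
theorem PotBound.exists_energy_le (hV : PotBound L B V) (h0 : 0 < h) {R : ℝ → ℝ → ℝ → ℂ}
    (hR : IsVNSol h V R) {N : ℕ} {Q : ℕ → ℝ → ℝ → ℂ} (hQ : IsVNGalerkinSol h V N Q) {A C : ℝ}
    (hA : 0 ≤ A) (hC : 0 < C)
    (hF : ∀ (t : ℝ) (ht : 0 ≤ t), ∑ k ∈ Finset.range (N + 1),
      sqn (consF h V N (toS (hR.1.2.1 t ht)) k) ≤ ENNReal.ofReal ((A * Real.exp (C * t)) ^ 2)) :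
    ∃ e : ℝ → ℝ, (∀ t, 0 ≤ t → 0 ≤ e t ∧ ENNReal.ofReal (e t) = ∑ k ∈ Finset.range (N + 1),
        sqn (fun x => Q k t x - ((cut N k : ℝ) : ℂ) * cf k (unc (R t)) x)) ∧
      ∀ t, 0 ≤ t → √(e t) ≤ √(e 0) + A * ((Real.exp (C * t) - 1) / C) := by
  obtain ⟨Ψ, Ψ', hΨ, hΨ', hd, -⟩ := hR.1.2.2 0 0 0 0
  choose! P P' hP hP' hPd _ using hQ.1.2.2.1
  have hw : ∀ f : ℝ → ℝ → ℂ, wD 0 0 0 0 f = f := by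
    intro f
    funext x y
    simp [wD, pd2]
  simp only [hw] at hΨ hΨ'
  set ω : ℕ → ℝ → Lp ℂ 2 (volume : Measure ℝ) := fun k t =>
    P k t - ((cut N k : ℝ) : ℂ) • cL k (Ψ t) with hω
  set ω' : ℕ → ℝ → Lp ℂ 2 (volume : Measure ℝ) := fun k t =>
    P' k t - ((cut N k : ℝ) : ℂ) • cL k (Ψ' t) with hω'
  have dω : ∀ k, k ≤ N → ∀ t, 0 ≤ t → HasDerivWithinAt (ω k) (ω' k t) (Set.Ici 0) t := by
    intro k hk t ht
    have h1 := ((cL k).restrictScalars ℝ).hasFDerivAt.comp_hasDerivWithinAt t (hd t ht)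
    exact (hPd k hk t ht).sub (h1.const_smul ((cut N k : ℝ) : ℂ))
  have eω : ∀ k, k ≤ N → ∀ t, 0 ≤ t →
      ω k t =ᵐ[volume] fun x => Q k t x - ((cut N k : ℝ) : ℂ) * cf k (unc (R t)) x := by
    intro k hk t ht
    filter_upwards [Lp.coeFn_sub (P k t) (((cut N k : ℝ) : ℂ) • cL k (Ψ t)),
      Lp.coeFn_smul ((cut N k : ℝ) : ℂ) (cL k (Ψ t)), cL_coeFn k (Ψ t) (hΨ t ht),
      hP k hk t ht] with x h1 h2 h3 h4
    rw [h1, Pi.sub_apply, h2, Pi.smul_apply, h3, h4, smul_eq_mul]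
  set γ : ℕ → ℝ → Lp ℂ 2 (volume : Measure ℝ) := fun k t =>
    if ht : 0 ≤ t then (hV.memLp_consF h0 N (toS (hR.1.2.1 t ht)) k).toLp _ else 0 with hγ
  have nγ : ∀ t, 0 ≤ t →
      ∑ k ∈ Finset.range (N + 1), ‖γ k t‖ ^ 2 ≤ (A * Real.exp (C * t)) ^ 2 := by
    intro t ht
    rw [← ENNReal.ofReal_le_ofReal_iff (by positivity),
      ENNReal.ofReal_sum_of_nonneg fun k _ => by positivity]
    refine le_of_eq_of_le (Finset.sum_congr rfl fun k _ => ?_) (hF t ht)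
    simp only [hγ, dif_pos ht]
    exact norm_toLp_sq _
  refine ⟨fun t => ∑ k ∈ Finset.range (N + 1), ‖ω k t‖ ^ 2, fun t ht => ⟨by positivity, ?_⟩,
    fun t ht => ?_⟩
  · rw [ENNReal.ofReal_sum_of_nonneg fun k _ => by positivity]
    refine Finset.sum_congr rfl fun k hk => ?_
    rw [← sqn_congr (eω k (Nat.lt_succ_iff.1 (Finset.mem_range.1 hk)) t ht)]
    have := norm_toLp_sq (Lp.memLp (ω k t))
    rwa [Lp.toLp_coeFn] at this
  refine sqrt_le_of_deriv_le (e' := fun t => ∑ k ∈ Finset.range (N + 1), 2 * inner ℝ (ω k t) (ω' k t))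
    hC (fun t _ => by positivity) (fun t ht => HasDerivWithinAt.fun_sum fun k hk =>
      (dω k (Nat.lt_succ_iff.1 (Finset.mem_range.1 hk)) t ht).norm_sq) hA (fun t ht => ?_) ht
  set u := toS (hR.1.2.1 t ht) with hu
  have s0 : ∑ k ∈ Finset.range (N + 1), inner ℝ (ω k t) (ω' k t - γ k t) = 0 := by
    refine sum_inner_galRhs (h := h) (V := V)
      (w := fun k x => Q k t x - ((cut N k : ℝ) : ℂ) * cf k u x)
      (w' := fun k x => deriv (Q k t) x - ((cut N k : ℝ) : ℂ) * cf k (dx u) x)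
      (ω := fun k => ω k t) (γ := fun k => ω' k t - γ k t)
      (fun k x => (hasDerivAt_of_isSchwartz1 (isSchwartz1_of_isGalerkinReg hQ.1 ht k) x).sub
        ((hasDerivAt_cf u k x).const_mul _))
      (fun k => (memLp_of_isSchwartz1 (isSchwartz1_of_isGalerkinReg hQ.1 ht k)).sub
        ((memLp_cf (u.memLp 2 volume) k).const_mul _))
      (fun k => (memLp_deriv_of_isSchwartz1 (isSchwartz1_of_isGalerkinReg hQ.1 ht k)).sub
        ((memLp_cf ((dx u).memLp 2 volume) k).const_mul _)) ?_ (fun k hk => eω k hk t ht) ?_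
    · funext x
      simp [hQ.1.2.2.2 (N + 1) (by omega) t x, cut_eq_zero le_rfl]
    · intro k hk
      have g1 : γ k t =ᵐ[volume] consF h V N u k := by
        simp only [hγ, dif_pos ht]
        exact MemLp.coeFn_toLp _
      filter_upwards [Lp.coeFn_sub (ω' k t) (γ k t),
        Lp.coeFn_sub (P' k t) (((cut N k : ℝ) : ℂ) • cL k (Ψ' t)),
        Lp.coeFn_smul ((cut N k : ℝ) : ℂ) (cL k (Ψ' t)), cL_coeFn k (Ψ' t) (hΨ' t ht),
        hP' k hk t ht, g1] with x h1 h2 h3 h4 h5 h6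
      rw [h1, Pi.sub_apply, h2, Pi.sub_apply, h3, Pi.smul_apply, h4, h5, h6, smul_eq_mul,
        deriv_eq_galRhs hQ hk ht, dtR_eq_vnRhs hR ht, sub_eq_iff_eq_add]
      exact hV.galRhs_sub h0 N u _ _ k x
  have s1 : ∑ k ∈ Finset.range (N + 1), 2 * inner ℝ (ω k t) (ω' k t) =
      2 * ∑ k ∈ Finset.range (N + 1), inner ℝ (ω k t) (γ k t) := by
    rw [← Finset.mul_sum]
    simp only [inner_sub_right, Finset.sum_sub_distrib] at s0
    linarith
  rw [s1, mul_assoc]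
  refine mul_le_mul_of_nonneg_left ?_ zero_le_two
  refine (Finset.sum_le_sum fun k _ => real_inner_le_norm _ _).trans
    ((Real.sum_mul_le_sqrt_mul_sqrt _ _ _).trans ?_)
  exact mul_le_mul_of_nonneg_left (Real.sqrt_le_iff.2 ⟨by positivity, nγ t ht⟩) (Real.sqrt_nonneg _)

end

/-- Splitting of the Galerkin error into the energy of the truncated error and a spectral tail. -/
theorem sqn_synth_sub_le {N : ℕ} {g : ℕ → ℝ → ℂ} (hg : ∀ k, MemLp (g k) 2)
    (hg0 : ∀ k, N < k → g k = 0) (j : ℕ) (u : 𝓢(ℝ × ℝ, ℂ)) :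
    sqn (fun p => synth N g p - u p) ≤
      2 * ∑ k ∈ Finset.range (N + 1), sqn (fun x => g k x - ((cut N k : ℝ) : ℂ) * cf k u x) +
        2 * (ENNReal.ofReal ((4 / (2 * N + 3)) ^ j) * SS j u) := by
  have mu := u.memLp 2 volume
  have ms : MemLp (synth N g) 2 := by simpa using memLp_synth N (fun k _ => hg k) 0
  have mf : MemLp (fun p => synth N g p - u p) 2 := ms.sub mu
  set w : ℕ → ℝ → ℂ := fun k x => g k x - ((cut N k : ℝ) : ℂ) * cf k u x with hw
  have mw : ∀ k, MemLp (w k) 2 := fun k => (hg k).sub ((memLp_cf mu k).const_mul _)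
  have hw0 : ∀ k, k ∉ Finset.range (N + 1) → sqn (w k) = 0 := by
    intro k hk
    have hk' : N + 1 ≤ k := by simpa using hk
    simp [hw, hg0 k hk', cut_eq_zero hk', sqn]
  have hc : ∀ k, sqn (cf k (fun p => synth N g p - u p)) ≤
      2 * sqn (w k) + 2 * (ENNReal.ofReal ((1 - cut N k) ^ 2) * sqn (cf k u)) := by
    intro k
    have e : cf k (fun p => synth N g p - u p) =ᵐ[volume]
        (w k + fun x => ((cut N k - 1 : ℝ) : ℂ) * cf k u x) := by
      have h1 := cf_add_ae ms (mu.const_mul (-1)) k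
      have h2 : (synth N g + fun p => (-1) * u p) = fun p => synth N g p - u p := by
        funext p
        simp [sub_eq_add_neg]
      rw [h2] at h1
      filter_upwards [h1] with x hx
      have h3 := congrFun (cf_smul (-1) u k) x
      simp only [Pi.smul_apply, smul_eq_mul] at h3
      have h4 : cf k (fun p => (-1) * u p) x = (-1) * cf k u x := h3
      rw [hx, Pi.add_apply, Pi.add_apply, h4, cf_synth]
      have h5 : (if k ≤ N then g k x else 0) = g k x := by
        split_ifs with hk
        · rfl
        · rw [hg0 k (by omega)]; rfl
      rw [h5, hw]
      push_cast
      ring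
    rw [sqn_congr e]
    refine (sqn_add_le _ _ (mw k).1).trans (le_of_eq ?_)
    rw [sqn_real_smul, show (cut N k - 1) ^ 2 = (1 - cut N k) ^ 2 by ring]
  have h5 := tail_le N 0 j (fun k => ENNReal.ofReal ((1 - cut N k) ^ 2)) u
    (sq_one_sub_cut_le N) (cutRem_coeff_ne N)
  simp only [pow_zero, one_mul, zero_add] at h5
  rw [← tsum_sqn_cf mf]
  refine (ENNReal.tsum_le_tsum hc).trans ?_
  rw [ENNReal.tsum_add, ENNReal.tsum_mul_left, ENNReal.tsum_mul_left, tsum_eq_sum hw0]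
  exact add_le_add le_rfl (mul_le_mul_right h5 2)

theorem toReal_eLpNorm_le_sqrt {α : Type*} [MeasureSpace α] {f : α → ℂ} {a : ℝ} (ha : 0 ≤ a)
    (h : sqn f ≤ ENNReal.ofReal a) : (eLpNorm f 2 volume).toReal ≤ √a := by
  refine Real.le_sqrt_of_sq_le ?_
  rw [← ENNReal.toReal_pow, eLpNorm_sq]
  exact ENNReal.toReal_le_of_le_ofReal ha h

/-- Error estimate in terms of a bound on the consistency error. -/
theorem exists_error_le (j : ℕ) : ∃ K, 0 ≤ K ∧ ∀ (L : ℕ) (B : ℝ) (V : ℝ → ℝ), PotBound L B V →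
    ∀ h, 0 < h → ∀ (R : ℝ → ℝ → ℝ → ℂ) (hR : IsVNSol h V R) (N : ℕ) (Q : ℕ → ℝ → ℝ → ℂ),
    IsVNGalerkinSol h V N Q →
    (∀ k, k ≤ N → ∀ x, Q k 0 x = ∫ y, R 0 x y * ((Φh k y : ℝ) : ℂ)) → ∀ A C, 0 ≤ A → 0 < C →
    (∀ (t : ℝ) (ht : 0 ≤ t), ∑ k ∈ Finset.range (N + 1),
      sqn (consF h V N (toS (hR.1.2.1 t ht)) k) ≤ ENNReal.ofReal ((A * Real.exp (C * t)) ^ 2)) →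
    ∀ t, 0 ≤ t →
      L2 (fun x y => (∑ k ∈ Finset.range (N + 1), Q k t x * ((Φh k y : ℝ) : ℂ)) - R t x y) ≤
        K * √((4 / (2 * N + 3)) ^ j) * (NN j (R t) + NN j (R 0)) +
          2 * A * ((Real.exp (C * t) - 1) / C) := by
  obtain ⟨D, hD0, hD⟩ := exists_SS_le (one_mem_W 0) j
  refine ⟨2 * √D, by positivity, fun L B V hV h h0 R hR N Q hQ hQ0 A C hA hC hF t ht => ?_⟩
  obtain ⟨e, he, hle⟩ := hV.exists_energy_le h0 hR hQ hA hC hF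
  set q : ℝ := (4 / (2 * N + 3)) ^ j with hq
  have hq0 : 0 ≤ q := by positivity
  have hn : ∀ t, 0 ≤ t → 0 ≤ NN j (R t) := fun t ht => NN_nonneg j (toS (hR.1.2.1 t ht))
  have hS : ∀ (t : ℝ) (ht : 0 ≤ t), ENNReal.ofReal q * SS j (toS (hR.1.2.1 t ht)) ≤
      ENNReal.ofReal (q * (D * NN j (R t) ^ 2)) := by
    intro t ht
    rw [ENNReal.ofReal_mul hq0]
    have := hD (toS (hR.1.2.1 t ht))
    rw [zero_add] at this
    exact mul_le_mul_right this _
  have hs : ∀ n, 0 ≤ n → √(q * (D * n ^ 2)) = √D * √q * n := by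
    intro n hn
    rw [Real.sqrt_mul hq0, Real.sqrt_mul hD0, Real.sqrt_sq hn]
    ring
  have e0 : √(e 0) ≤ √D * √q * NN j (R 0) := by
    rw [← hs _ (hn 0 le_rfl)]
    refine Real.sqrt_le_sqrt ?_
    rw [← ENNReal.ofReal_le_ofReal_iff (by positivity), (he 0 le_rfl).2]
    refine le_trans ?_ (hS 0 le_rfl)
    have h5 := tail_le N 0 j (fun k => ENNReal.ofReal ((1 - cut N k) ^ 2)) (unc (R 0))
      (sq_one_sub_cut_le N) (cutRem_coeff_ne N)
    simp only [pow_zero, one_mul, zero_add] at h5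
    refine le_trans ?_ h5
    refine le_trans (Finset.sum_le_sum fun k hk => ?_) (ENNReal.sum_le_tsum _)
    rw [← sqn_real_smul]
    refine le_of_eq (congrArg _ (funext fun x => ?_))
    rw [hQ0 k (Nat.lt_succ_iff.1 (Finset.mem_range.1 hk)) x]
    have : ∫ y, R 0 x y * ((Φh k y : ℝ) : ℂ) = cf k (unc (R 0)) x := rfl
    rw [this]
    push_cast
    ring
  have h1 : L2 (fun x y => (∑ k ∈ Finset.range (N + 1), Q k t x * ((Φh k y : ℝ) : ℂ)) - R t x y) ≤
      √(2 * e t + 2 * (q * (D * NN j (R t) ^ 2))) := by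
    have ee := (he t ht).1
    refine toReal_eLpNorm_le_sqrt (by positivity) ?_
    rw [ENNReal.ofReal_add (by positivity) (by positivity), ENNReal.ofReal_mul zero_le_two,
      ENNReal.ofReal_mul zero_le_two, ENNReal.ofReal_ofNat, (he t ht).2]
    refine (sqn_synth_sub_le (g := fun k => Q k t)
      (fun k => memLp_of_isSchwartz1 (isSchwartz1_of_isGalerkinReg hQ.1 ht k))
      (fun k hk => funext fun x => hQ.1.2.2.2 k hk t x) j (toS (hR.1.2.1 t ht))).trans ?_
    exact add_le_add le_rfl (mul_le_mul_right (hS t ht) 2)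
  have h2 : √(2 * e t + 2 * (q * (D * NN j (R t) ^ 2))) ≤
      2 * √(e t) + 2 * (√D * √q * NN j (R t)) := by
    rw [← hs _ (hn t ht)]
    refine Real.sqrt_le_iff.2 ⟨by positivity, ?_⟩
    have a1 := Real.sq_sqrt (he t ht).1
    have a2 : √(q * (D * NN j (R t) ^ 2)) ^ 2 = q * (D * NN j (R t) ^ 2) :=
      Real.sq_sqrt (by positivity)
    nlinarith [Real.sqrt_nonneg (e t), Real.sqrt_nonneg (q * (D * NN j (R t) ^ 2)), (he t ht).1,
      mul_nonneg (Real.sqrt_nonneg (e t)) (Real.sqrt_nonneg (q * (D * NN j (R t) ^ 2))),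
      sq_nonneg (√(e t)), sq_nonneg √(q * (D * NN j (R t) ^ 2))]
  have h3 := hle t ht
  calc _ ≤ 2 * √(e t) + 2 * (√D * √q * NN j (R t)) := h1.trans h2
    _ ≤ 2 * (√D * √q * NN j (R 0) + A * ((Real.exp (C * t) - 1) / C)) +
        2 * (√D * √q * NN j (R t)) := by linarith
    _ = _ := by ring

section
variable {L : ℕ} {B : ℝ} {V : ℝ → ℝ}

/-- The consistency error in terms of the initial data. -/
theorem PotBound.exists_consF_exp_le (hV : PotBound L B V) {i j : ℕ} (hi : i + 1 < L)
    (hj : j + 2 < L) : ∃ a₀, 0 < a₀ ∧ ∀ a C, a₀ ≤ a → a₀ ≤ C →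
    ∀ d : ℝ, (d = 0 ∧ ∀ x, iteratedDeriv 3 V x = 0) ∨ d = 1 →
    ∀ h, 0 < h → h ≤ 1 → ∀ (R : ℝ → ℝ → ℝ → ℂ) (hR : IsVNSol h V R) (N : ℕ) (t : ℝ) (ht : 0 ≤ t),
      ∑ k ∈ Finset.range (N + 1), sqn (consF h V N (toS (hR.1.2.1 t ht)) k) ≤
        ENNReal.ofReal ((a * (√((4 / (2 * N + 3)) ^ (1 + i)) * NN (i + 1) (R 0) +
          d * (h * √((4 / (2 * N + 3)) ^ j)) * NN (j + 2) (R 0)) * Real.exp (C * t)) ^ 2) := by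
  obtain ⟨D, hD0, hD⟩ := hV.exists_consF_le i (j := j) (by omega)
  obtain ⟨K, hK0, hK⟩ := exists_NN_le (i + 1) hi hV
  obtain ⟨K', hK'0, hK'⟩ := exists_NN_le (j + 2) hj hV
  set G := √((idx (i + 1)).card)
  set G' := √((idx (j + 2)).card)
  have hG : 0 ≤ G := Real.sqrt_nonneg _
  have hG' : 0 ≤ G' := Real.sqrt_nonneg _
  have hsD := Real.sqrt_nonneg D
  refine ⟨1 + √D * (G + G') + K + K', by positivity, fun a C ha hC d hd h h0 h1 R hR N t ht => ?_⟩
  refine (hD d hd h h0 h1 N _).trans (ENNReal.ofReal_le_ofReal ?_)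
  rw [cur_toS]
  have hd0 : 0 ≤ d := by
    rcases hd with ⟨rfl, -⟩ | rfl
    exacts [le_rfl, zero_le_one]
  have hdd : d ^ 2 = d := by
    rcases hd with ⟨rfl, -⟩ | rfl <;> norm_num
  set q : ℝ := 4 / (2 * N + 3) with hq
  have hq0 : 0 ≤ q := by positivity
  have hn : ∀ m t, 0 ≤ t → 0 ≤ NN m (R t) := fun m t ht => NN_nonneg m (toS (hR.1.2.1 t ht))
  have hGG : 0 ≤ √D * (G + G') := mul_nonneg hsD (add_nonneg hG hG')
  have s1 : √D * G ≤ a := by nlinarith [mul_nonneg hsD hG']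
  have s2 : √D * G' ≤ a := by nlinarith [mul_nonneg hsD hG]
  have e1 : Real.exp (K * t) ≤ Real.exp (C * t) :=
    Real.exp_le_exp.2 (mul_le_mul_of_nonneg_right (by linarith) ht)
  have e2 : Real.exp (K' * t) ≤ Real.exp (C * t) :=
    Real.exp_le_exp.2 (mul_le_mul_of_nonneg_right (by linarith) ht)
  have b1 : √D * NN (i + 1) (R t) ≤ a * Real.exp (C * t) * NN (i + 1) (R 0) := by
    refine (mul_le_mul_of_nonneg_left (hK h h0 h1 R hR t ht) hsD).trans ?_
    rw [← mul_assoc, ← mul_assoc]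
    refine mul_le_mul_of_nonneg_right ?_ (hn _ 0 le_rfl)
    exact mul_le_mul s1 e1 (Real.exp_pos _).le ((mul_nonneg hsD hG).trans s1)
  have b2 : √D * NN (j + 2) (R t) ≤ a * Real.exp (C * t) * NN (j + 2) (R 0) := by
    refine (mul_le_mul_of_nonneg_left (hK' h h0 h1 R hR t ht) hsD).trans ?_
    rw [← mul_assoc, ← mul_assoc]
    refine mul_le_mul_of_nonneg_right ?_ (hn _ 0 le_rfl)
    exact mul_le_mul s2 e2 (Real.exp_pos _).le ((mul_nonneg hsD hG').trans s2)
  set x := √(q ^ (1 + i)) * (√D * NN (i + 1) (R t)) with hx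
  set y := d * (h * √(q ^ j)) * (√D * NN (j + 2) (R t)) with hy
  have hx0 : 0 ≤ x := mul_nonneg (Real.sqrt_nonneg _) (mul_nonneg hsD (hn _ t ht))
  have hy0 : 0 ≤ y := mul_nonneg (by positivity) (mul_nonneg hsD (hn _ t ht))
  have exy : D * (q ^ (1 + i) * NN (i + 1) (R t) ^ 2 + d * h ^ 2 * q ^ j * NN (j + 2) (R t) ^ 2) =
      x ^ 2 + y ^ 2 := by
    rw [hx, hy, mul_pow, mul_pow, mul_pow, mul_pow, mul_pow, mul_pow,
      Real.sq_sqrt (pow_nonneg hq0 _), Real.sq_sqrt (pow_nonneg hq0 _), Real.sq_sqrt hD0, hdd]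
    ring
  rw [exy]
  have hxy : x ^ 2 + y ^ 2 ≤ (x + y) ^ 2 := by nlinarith [mul_nonneg hx0 hy0]
  refine hxy.trans (pow_le_pow_left₀ (add_nonneg hx0 hy0) ?_ 2)
  calc x + y ≤ √(q ^ (1 + i)) * (a * Real.exp (C * t) * NN (i + 1) (R 0)) +
        d * (h * √(q ^ j)) * (a * Real.exp (C * t) * NN (j + 2) (R 0)) :=
      add_le_add (mul_le_mul_of_nonneg_left b1 (Real.sqrt_nonneg _))
        (mul_le_mul_of_nonneg_left b2 (by positivity))
    _ = _ := by ring

end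

theorem exists_potBound {L : ℕ} (hL : 3 ≤ L) {V : ℝ → ℝ} (hV : ContDiff ℝ L V)
    (hb : ∀ n, 2 ≤ n → n ≤ L → ∃ C : ℝ, ∀ x, |iteratedDeriv n V x| ≤ C) : ∃ B, PotBound L B V := by
  choose! C hC using hb
  have hC0 : ∀ n ∈ Finset.Icc 2 L, 0 ≤ C n := fun n hn =>
    (abs_nonneg _).trans (hC n (Finset.mem_Icc.1 hn).1 (Finset.mem_Icc.1 hn).2 0)
  have hs : 0 ≤ ∑ n ∈ Finset.Icc 2 L, C n := Finset.sum_nonneg hC0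
  refine ⟨|deriv V 0| + ∑ n ∈ Finset.Icc 2 L, C n, hL, by positivity, hV, by linarith, ?_⟩
  intro n h2 hn x
  have h3 := Finset.single_le_sum hC0 (Finset.mem_Icc.2 ⟨h2, hn⟩)
  have h4 := hC n h2 hn x
  have h5 := abs_nonneg (deriv V 0)
  linarith

/-- `√((4/ν)^m)` in terms of powers of `ν`. -/
theorem sqrt_four_div_pow {ν : ℝ} (hν : 0 < ν) (m : ℕ) : √((4 / ν) ^ m) = 2 ^ m * √ν⁻¹ ^ m := by
  have h4 : √(4 : ℝ) = 2 := by
    rw [show (4 : ℝ) = 2 ^ 2 by norm_num]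
    exact Real.sqrt_sq zero_le_two
  have h1 : √((4 / ν) ^ m) = √(4 / ν) ^ m := by
    refine (Real.sqrt_eq_iff_mul_self_eq (by positivity) (by positivity)).2 ?_
    rw [← mul_pow, Real.mul_self_sqrt (by positivity)]
  rw [h1, div_eq_mul_inv, Real.sqrt_mul (by norm_num), h4, mul_pow]

theorem sqrt_inv_pow_two_mul_sub_one {ν : ℝ} (hν : 0 < ν) {p : ℕ} (hp : 1 ≤ p) :
    √ν⁻¹ ^ (2 * p - 1) = 1 / ν ^ ((p : ℝ) - 1 / 2) := by
  rw [Real.sqrt_inv, inv_pow, one_div, Real.sqrt_eq_rpow, ← Real.rpow_mul_natCast hν.le,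
    Nat.cast_sub (by omega)]
  congr 2
  push_cast
  ring

theorem exp_sub_one_div_le {C : ℝ} (hC : 0 < C) (t : ℝ) :
    (Real.exp (C * t) - 1) / C ≤ t * Real.exp (C * t) := by
  rw [div_le_iff₀ hC]
  have h1 := Real.add_one_le_exp (-(C * t))
  have h2 := mul_le_mul_of_nonneg_right h1 (Real.exp_pos (C * t)).le
  rw [← Real.exp_add, neg_add_cancel, Real.exp_zero] at h2
  linarith

/-- Absorption of a Duhamel term into a faster exponential. -/
theorem exp_absorb {K C b t : ℝ} (hK : 0 ≤ K) (hC : 0 < C) (hb : 0 ≤ b) (ht : 0 ≤ t) :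
    K * Real.exp (C * t) + b * ((Real.exp (C * t) - 1) / C) ≤
      (K + 1) * Real.exp ((C + b) * t) := by
  have h1 := mul_le_mul_of_nonneg_left (exp_sub_one_div_le hC t) hb
  have h2 := Real.add_one_le_exp (b * t)
  have h3 := Real.exp_pos (C * t)
  have h4 : Real.exp ((C + b) * t) = Real.exp (C * t) * Real.exp (b * t) := by
    rw [← Real.exp_add, add_mul]
  have hbt := mul_nonneg hb ht
  have h5 : Real.exp (C * t) * (b * t + 1) ≤ Real.exp (C * t) * Real.exp (b * t) :=
    mul_le_mul_of_nonneg_left h2 h3.le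
  have h6 : Real.exp (C * t) ≤ Real.exp (C * t) * Real.exp (b * t) := by nlinarith
  rw [h4]
  nlinarith [mul_le_mul_of_nonneg_left h6 hK]

end VNHermite

set_option maxHeartbeats 1000000 in
/-- Uniform-in-`ħ` spectral error estimate for the Hermite–Galerkin approximation of
the von Neumann equation (Theorem 2.1). -/
theorem vonNeumann_hermite_galerkin_error (p : ℕ) (hp : 1 ≤ p) :
    ∃ Kp Cp K'p : ℝ, 0 < Kp ∧ 0 < Cp ∧ 0 < K'p ∧
      ∀ V : ℝ → ℝ, ContDiff ℝ (2*p+3) V →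
        (∀ n : ℕ, 2 ≤ n → n ≤ 2*p+3 → ∃ C : ℝ, ∀ x : ℝ, |iteratedDeriv n V x| ≤ C) →
        ∃ C2p C2p1 C2p2 : ℝ, 0 < C2p ∧ 0 < C2p1 ∧ 0 < C2p2 ∧
          ∀ hbar : ℝ, 0 < hbar → hbar ≤ 1 →
          ∀ R : ℝ → ℝ → ℝ → ℂ, IsVNSol hbar V R →
          ∀ N : ℕ, ∀ Rk : ℕ → ℝ → ℝ → ℂ, IsVNGalerkinSol hbar V N Rk →
            (∀ k, k ≤ N → ∀ x : ℝ, Rk k 0 x = ∫ y : ℝ, R 0 x y * ((Φh k y : ℝ) : ℂ)) →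
            ∀ t : ℝ, 0 ≤ t →
              L2 (fun x y =>
                  (∑ k ∈ Finset.range (N+1), Rk k t x * ((Φh k y : ℝ) : ℂ)) - R t x y) ≤
                Kp / (2*(N:ℝ)+3)^p * Real.exp (C2p * t) * NN (2*p) (R 0) +
                Real.sqrt (Cp * max 1 (max |deriv V 0| (supN (iteratedDeriv 2 V)))) /
                  ((2*(N:ℝ)+3) ^ ((p : ℝ) - 1/2)) *
                  ((Real.exp (C2p1 * t) - 1) / C2p1) * NN (2*p+1) (R 0) +
                K'p * hbar^2 / 4 / ((2*(N:ℝ)+3) ^ ((p : ℝ) - 1/2)) *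
                  supN (iteratedDeriv 3 V) *
                  ((Real.exp (C2p2 * t) - 1) / C2p2) * NN (2*p+2) (R 0) := by
  obtain ⟨K, hK0, hK⟩ := VNHermite.exists_error_le (2 * p)
  set G := √((VNHermite.idx (2 * p)).card) with hG
  have hG0 : 0 ≤ G := Real.sqrt_nonneg _
  set K₁ := K * 4 ^ p * (G + 1) with hK₁
  have hK₁0 : 0 ≤ K₁ := by positivity
  refine ⟨K₁ + 1, 1, 1, by positivity, one_pos, one_pos, fun V hVc hVb => ?_⟩
  obtain ⟨B, hV⟩ := VNHermite.exists_potBound (L := 2 * p + 3) (by omega)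
    (by exact_mod_cast hVc) hVb
  obtain ⟨a₁, ha₁, h₁⟩ := hV.exists_consF_exp_le (i := 2 * p - 1) (j := 2 * p - 2)
    (by omega) (by omega)
  obtain ⟨a₂, ha₂, h₂⟩ := hV.exists_consF_exp_le (i := 2 * p) (j := 2 * p - 1)
    (by omega) (by omega)
  obtain ⟨a₃, ha₃, h₃⟩ := hV.exists_consF_exp_le (i := 2 * p) (j := 2 * p)
    (by omega) (by omega)
  rw [show 2 * p - 1 + 1 = 2 * p by omega, show 2 * p - 2 + 2 = 2 * p by omega] at h₁
  rw [show 2 * p - 1 + 2 = 2 * p + 1 by omega] at h₂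
  obtain ⟨κ, hκ0, hκ⟩ := VNHermite.exists_NN_le (2 * p) (by omega) hV
  set C := a₁ + a₂ + a₃ + κ with hC
  have hC0 : 0 < C := by positivity
  set M := supN (iteratedDeriv 3 V) with hM
  have hbdd : BddAbove (Set.range fun x => |iteratedDeriv 3 V x|) := by
    obtain ⟨c, hc⟩ := hVb 3 (by omega) (by omega)
    exact ⟨c, by rintro _ ⟨x, rfl⟩; exact hc x⟩
  have hM3 : ∀ x, |iteratedDeriv 3 V x| ≤ M := fun x => le_ciSup hbdd x
  have hM0 : 0 ≤ M := (abs_nonneg _).trans (hM3 0)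
  obtain ⟨d, hd, hd0, hd1, hdM⟩ : ∃ d : ℝ, ((d = 0 ∧ ∀ x, iteratedDeriv 3 V x = 0) ∨ d = 1) ∧
      0 ≤ d ∧ d ≤ 1 ∧ (d = 0 ∨ d = 1 ∧ 0 < M) := by
    rcases hM0.eq_or_lt with h | h
    · refine ⟨0, Or.inl ⟨rfl, fun x => ?_⟩, le_rfl, zero_le_one, Or.inl rfl⟩
      exact abs_nonpos_iff.1 (h ▸ hM3 x)
    · exact ⟨1, Or.inr rfl, zero_le_one, le_rfl, Or.inr ⟨rfl, h⟩⟩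
  set a := 2 * C * 2 ^ (2 * p + 1) with ha
  have ha0 : 0 < a := by positivity
  set ν₀ := max (2 * a) (64 * a ^ 4 / M ^ 2) with hν₀
  have hν₀0 : 0 < ν₀ := lt_max_of_lt_left (by positivity)
  set b := 2 * a * ν₀ ^ p with hb
  have hb0 : 0 < b := by positivity
  refine ⟨C + b, C, C, by positivity, hC0, hC0, fun h h0 h1 R hR N Q hQ hinit t ht => ?_⟩
  set S := √(1 * max 1 (max |deriv V 0| (supN (iteratedDeriv 2 V)))) with hS
  have hS1 : 1 ≤ S := by
    rw [hS, one_mul]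
    exact Real.one_le_sqrt.2 (le_max_left _ _)
  have hn : ∀ m t, 0 ≤ t → 0 ≤ NN m (R t) :=
    fun m t ht => VNHermite.NN_nonneg m (VNHermite.toS (hR.1.2.1 t ht))
  have hn0 := hn (2 * p) 0 le_rfl
  have hn1 := hn (2 * p + 1) 0 le_rfl
  have hn2 := hn (2 * p + 2) 0 le_rfl
  set ν : ℝ := 2 * N + 3 with hν
  have hν3 : 3 ≤ ν := by
    have : (0 : ℝ) ≤ N := Nat.cast_nonneg N
    linarith
  have hνpos : 0 < ν := by linarith
  have hνp : 0 < ν ^ p := pow_pos hνpos p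
  set E := Real.exp (C * t) with hE
  have hE1 : 1 ≤ E := Real.one_le_exp (mul_nonneg hC0.le ht)
  set F := (E - 1) / C with hF
  have hF0 : 0 ≤ F := div_nonneg (by linarith) hC0.le
  have key : ∀ A : ℝ, 0 ≤ A → (∀ t (ht : 0 ≤ t), ∑ k ∈ Finset.range (N + 1),
      VNHermite.sqn (VNHermite.consF h V N (VNHermite.toS (hR.1.2.1 t ht)) k) ≤
        ENNReal.ofReal ((A * Real.exp (C * t)) ^ 2)) →
      L2 (fun x y => (∑ k ∈ Finset.range (N + 1), Q k t x * ((Φh k y : ℝ) : ℂ)) - R t x y) ≤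
        K₁ / ν ^ p * E * NN (2 * p) (R 0) + 2 * A * F := by
    intro A hA hcons
    refine (hK _ B V hV h h0 R hR N Q hQ hinit A C hA hC0 hcons t ht).trans
      (add_le_add ?_ le_rfl)
    have e1 : √((4 / ν) ^ (2 * p)) = 4 ^ p / ν ^ p := by
      rw [VNHermite.sqrt_four_div_pow hνpos, pow_mul, pow_mul, Real.sq_sqrt (by positivity),
        inv_pow]
      norm_num [div_eq_mul_inv]
    have e2 : NN (2 * p) (R t) + NN (2 * p) (R 0) ≤ (G + 1) * E * NN (2 * p) (R 0) := by
      have e3 : Real.exp (κ * t) ≤ E :=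
        Real.exp_le_exp.2 (mul_le_mul_of_nonneg_right (by rw [hC]; linarith) ht)
      have e4 := hκ h h0 h1 R hR t ht
      have e5 := mul_le_mul_of_nonneg_right (mul_le_mul_of_nonneg_left e3 hG0) hn0
      have e6 := mul_le_mul_of_nonneg_right hE1 hn0
      linarith
    rw [e1]
    refine (mul_le_mul_of_nonneg_left e2 (by positivity)).trans_eq ?_
    rw [hK₁]
    ring
  have hsq : 0 < ν⁻¹ := inv_pos.2 hνpos
  set s := √ν⁻¹ with hs
  have hs0 : 0 < s := Real.sqrt_pos.2 hsq
  have hs2 : s ^ 2 = ν⁻¹ := Real.sq_sqrt hsq.le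
  have hs1 : s ≤ 1 := by
    exact Real.sqrt_le_one.2 (inv_le_one_of_one_le₀ (by linarith))
  have hpow : ∀ m, m ≤ 2 * p + 1 → √((4 / ν) ^ m) ≤ 2 ^ (2 * p + 1) * s ^ m := fun m hm => by
    rw [VNHermite.sqrt_four_div_pow hνpos]
    exact mul_le_mul_of_nonneg_right (pow_le_pow_right₀ one_le_two hm) (by positivity)
  set r := 1 / ν ^ ((p : ℝ) - 1 / 2) with hr
  have hrs : s ^ (2 * p - 1) = r := VNHermite.sqrt_inv_pow_two_mul_sub_one hνpos hp
  have hr0 : 0 < r := hrs ▸ pow_pos hs0 _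
  have hrs1 : s ^ (1 + 2 * p) = r * ν⁻¹ := by
    rw [← hrs, ← hs2, ← pow_add]
    congr 1
    omega
  have hrs2 : s ^ (2 * p) = r * s := by
    rw [← hrs, ← pow_succ]
    congr 1
    omega
  have hfirst : K₁ / ν ^ p * E * NN (2 * p) (R 0) ≤
      (K₁ + 1) / ν ^ p * Real.exp ((C + b) * t) * NN (2 * p) (R 0) := by
    have hEE : E ≤ Real.exp ((C + b) * t) :=
      Real.exp_le_exp.2 (mul_le_mul_of_nonneg_right (by linarith) ht)
    gcongr
    linarith
  have hsecond : r * F * NN (2 * p + 1) (R 0) ≤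
      S / ν ^ ((p : ℝ) - 1 / 2) * F * NN (2 * p + 1) (R 0) := by
    rw [div_eq_mul_one_div, ← hr]
    gcongr
    exact le_mul_of_one_le_left hr0.le hS1
  have hsecond0 : 0 ≤ r * F * NN (2 * p + 1) (R 0) := by positivity
  have hthird : 1 * h ^ 2 / 4 / ν ^ ((p : ℝ) - 1 / 2) * M * F * NN (2 * p + 2) (R 0) =
      h ^ 2 / 4 * M * (r * F * NN (2 * p + 2) (R 0)) := by
    rw [div_eq_mul_one_div _ (ν ^ ((p : ℝ) - 1 / 2)), ← hr]
    ring
  have hthird0 : 0 ≤ h ^ 2 / 4 * M * (r * F * NN (2 * p + 2) (R 0)) := by positivity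
  rw [hthird]
  by_cases hcase : ν ≤ ν₀
  · have hkey := key _ (by positivity) fun t ht =>
      h₁ C C (by rw [hC]; linarith) (by rw [hC]; linarith) d hd h h0 h1 R hR N t ht
    have p1 : √((4 / ν) ^ (1 + (2 * p - 1))) ≤ 2 ^ (2 * p + 1) :=
      (hpow _ (by omega)).trans (mul_le_of_le_one_right (by positivity) (pow_le_one₀ hs0.le hs1))
    have p2 : √((4 / ν) ^ (2 * p - 2)) ≤ 2 ^ (2 * p + 1) :=
      (hpow _ (by omega)).trans (mul_le_of_le_one_right (by positivity) (pow_le_one₀ hs0.le hs1))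
    have p3 : d * (h * √((4 / ν) ^ (2 * p - 2))) ≤ 2 ^ (2 * p + 1) := by
      have p4 : h * √((4 / ν) ^ (2 * p - 2)) ≤ 2 ^ (2 * p + 1) :=
        (mul_le_of_le_one_left (Real.sqrt_nonneg _) h1).trans p2
      exact (mul_le_of_le_one_left (by positivity) hd1).trans p4
    have hA : 2 * (C * (√((4 / ν) ^ (1 + (2 * p - 1))) * NN (2 * p) (R 0) +
        d * (h * √((4 / ν) ^ (2 * p - 2))) * NN (2 * p) (R 0))) ≤ b / ν ^ p * NN (2 * p) (R 0) := by
      have q1 : 2 * a ≤ b / ν ^ p := by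
        rw [le_div_iff₀ hνp, hb]
        gcongr
      refine le_trans ?_ (mul_le_mul_of_nonneg_right q1 hn0)
      have q2 := mul_le_mul_of_nonneg_right p1 hn0
      have q3 := mul_le_mul_of_nonneg_right p3 hn0
      have q4 := mul_le_mul_of_nonneg_left (add_le_add q2 q3) hC0.le
      rw [ha]
      linarith
    have hab := mul_le_mul_of_nonneg_left
      (VNHermite.exp_absorb (t := t) hK₁0 hC0 hb0.le ht) (div_nonneg hn0 hνp.le)
    have q5 := mul_le_mul_of_nonneg_right hA hF0
    have q6 : K₁ / ν ^ p * E * NN (2 * p) (R 0) + b / ν ^ p * NN (2 * p) (R 0) * F ≤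
        (K₁ + 1) / ν ^ p * Real.exp ((C + b) * t) * NN (2 * p) (R 0) := by
      refine (Eq.trans_le ?_ hab).trans_eq ?_ <;> ring
    linarith
  · have hν₀ν : ν₀ < ν := not_le.1 hcase
    have hν1 : 2 * a < ν := (le_max_left _ _).trans_lt hν₀ν
    have haν : a * ν⁻¹ ≤ 1 / 2 := by
      rw [← div_eq_mul_inv, div_le_iff₀ hνpos]
      linarith
    have p1 : √((4 / ν) ^ (1 + 2 * p)) ≤ 2 ^ (2 * p + 1) * (r * ν⁻¹) :=
      hrs1 ▸ hpow _ (by omega)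
    have z1 : 2 * C * √((4 / ν) ^ (1 + 2 * p)) ≤ 1 / 2 * r := by
      have := mul_le_mul_of_nonneg_left p1 (by positivity : 0 ≤ 2 * C)
      have := mul_le_mul_of_nonneg_right haν hr0.le
      rw [ha] at this
      linarith
    by_cases hah : d = 0 ∨ a * h ≤ 1 / 2
    · have hkey := key _ (by positivity) fun t ht =>
        h₂ C C (by rw [hC]; linarith) (by rw [hC]; linarith) d hd h h0 h1 R hR N t ht
      have p2 : √((4 / ν) ^ (2 * p - 1)) ≤ 2 ^ (2 * p + 1) * r := hrs ▸ hpow _ (by omega)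
      have z2 : 2 * C * (d * (h * √((4 / ν) ^ (2 * p - 1)))) ≤ 1 / 2 * r := by
        rcases hah with rfl | hah
        · rw [zero_mul, mul_zero]
          positivity
        · have y1 := mul_le_mul_of_nonneg_left p2 (by positivity : 0 ≤ 2 * C * h)
          have y2 := mul_le_mul_of_nonneg_right hah hr0.le
          have y3 : d * (h * √((4 / ν) ^ (2 * p - 1))) ≤ h * √((4 / ν) ^ (2 * p - 1)) :=
            mul_le_of_le_one_left (by positivity) hd1
          have y4 := mul_le_mul_of_nonneg_left y3 (by positivity : 0 ≤ 2 * C)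
          rw [ha] at y2
          linarith
      have z3 := mul_le_mul_of_nonneg_right (add_le_add z1 z2) (mul_nonneg hF0 hn1)
      linarith
    · push Not at hah
      obtain ⟨hd', hah⟩ := hah
      obtain ⟨hd1', hMpos⟩ := hdM.resolve_left hd'
      have hkey := key _ (by positivity) fun t ht =>
        h₃ C C (by rw [hC]; linarith) (by rw [hC]; linarith) d hd h h0 h1 R hR N t ht
      have p2 : √((4 / ν) ^ (2 * p)) ≤ 2 ^ (2 * p + 1) * (r * s) := hrs2 ▸ hpow _ (by omega)
      have hν2 : 64 * a ^ 4 / M ^ 2 < ν := (le_max_right _ _).trans_lt hν₀ν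
      have has : a * s ≤ h * M / 4 := by
        have w1 : s ≤ M / (8 * a ^ 2) := by
          refine Real.sqrt_le_iff.2 ⟨by positivity, ?_⟩
          rw [div_pow, inv_le_comm₀ hνpos (by positivity), inv_div]
          refine le_trans (le_of_eq ?_) hν2.le
          ring
        calc a * s ≤ a * (M / (8 * a ^ 2)) := mul_le_mul_of_nonneg_left w1 ha0.le
          _ = M / 4 * (1 / 2 / a) := by field_simp; norm_num
          _ ≤ M / 4 * h := by
            refine mul_le_mul_of_nonneg_left ?_ (by positivity)
            rw [div_le_iff₀ ha0]
            linarith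
          _ = h * M / 4 := by ring
      have z2 : 2 * C * (d * (h * √((4 / ν) ^ (2 * p)))) ≤ h ^ 2 / 4 * M * r := by
        have y1 := mul_le_mul_of_nonneg_left p2 (by positivity : 0 ≤ 2 * C * h)
        have y2 := mul_le_mul_of_nonneg_right has (by positivity : 0 ≤ h * r)
        rw [ha] at y2
        rw [hd1', one_mul]
        linarith
      have z3 := mul_le_mul_of_nonneg_right z1 (mul_nonneg hF0 hn1)
      have z4 := mul_le_mul_of_nonneg_right z2 (mul_nonneg hF0 hn2)
      linarith

end
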